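/- arXiv:1009.0045 — 3 statements merged into one kernel-verified Lean document; each statement's English description precedes it below -/
import Mathlib

section
/- There is a constant c > 0 such that every finite simple graph G on n vertices with maximum degree at most 3 has a non-crossing polyline drawing in ℝ³ such that: every vertex and every bend is placed at a point with integer coordinates; the entire drawing is contained in an axis-parallel box with all side lengths at most c·n³; every edge is drawn with at most 3 bends; every segment of every edge's path is parallel to a face diagonal of the integer grid (a vector having one coordinate 0 and the other two coordinates in {+1,−1}); and the drawing has angular resolution at least 2π/3 (120°). -/
open InnerProductGeometry

noncomputable section

/-- Points of three-dimensional Euclidean space. -/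
abbrev Pt : Type := EuclideanSpace ℝ (Fin 3)

/-- The image of a polyline given by a list of points: the union of the closed
segments between consecutive points. -/
def polyImage (l : List Pt) : Set Pt :=
  ⋃ q ∈ l.zip l.tail, segment ℝ q.1 q.2

/-- A polyline is simple (its image is a simple arc): consecutive points are distinct,
two consecutive segments meet exactly in their shared endpoint, and two
non-consecutive segments are disjoint. -/
def SimplePolyline (l : List Pt) : Prop :=
  l.Chain' (· ≠ ·) ∧
  ∀ i j : ℕ, ∀ hi : i + 1 < l.length, ∀ hj : j + 1 < l.length, i < j →
    segment ℝ (l.get ⟨i, by omega⟩) (l.get ⟨i + 1, hi⟩) ∩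
      segment ℝ (l.get ⟨j, by omega⟩) (l.get ⟨j + 1, hj⟩) =
      if j = i + 1 then {l.get ⟨j, by omega⟩} else ∅

/-- A polyline drawing of a (finite simple) graph `G` in ℝ³: an injective placement
`p` of the vertices, and for each (oriented) edge `uv` a list of points, starting at
`p u` and ending at `p v`, giving the polygonal path of the edge; the path of `vu`
is the reverse of the path of `uv`.  The interior points of the list are the bends
of the edge. -/
structure PolylineDrawing {V : Type*} (G : SimpleGraph V) where
  p : V → Pt
  p_inj : Function.Injective p
  seq : ∀ u v : V, G.Adj u v → List Pt
  seq_head : ∀ u v h, (seq u v h).head? = some (p u)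
  seq_last : ∀ u v h, (seq u v h).getLast? = some (p v)
  seq_symm : ∀ u v h, seq v u h.symm = (seq u v h).reverse

variable {V : Type*} {G : SimpleGraph V}

/-- Every edge is drawn with at most `k` bends, i.e. its point list has at most
`k + 2` points. -/
def MaxBends (D : PolylineDrawing G) (k : ℕ) : Prop :=
  ∀ u v h, (D.seq u v h).length ≤ k + 2

/-- The image of the whole drawing: all vertex points and all edge paths. -/
def drawingImage (D : PolylineDrawing G) : Set Pt :=
  Set.range D.p ∪ ⋃ (u) (v) (h : G.Adj u v), polyImage (D.seq u v h)

/-- The drawing has angular resolution at least `θ`: the angle at every bend of every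
edge, and the angle at a common vertex between the initial segments of any two
distinct edges, is at least `θ`. -/
def AngularResAtLeast (D : PolylineDrawing G) (θ : ℝ) : Prop :=
  (∀ u v h, ∀ a q b : Pt, [a, q, b] <:+: D.seq u v h →
    θ ≤ angle (a - q) (b - q)) ∧
  (∀ v u w : V, ∀ hu : G.Adj v u, ∀ hw : G.Adj v w, u ≠ w →
    ∀ a b : Pt, (D.seq v u hu)[1]? = some a → (D.seq v w hw)[1]? = some b →
      θ ≤ angle (a - D.p v) (b - D.p v))

/-- The drawing is non-crossing: every edge path is a simple arc meeting the vertex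
points only in its endpoints, and the paths of two distinct edges intersect exactly
in the images of their common endpoints. -/
def NonCrossing (D : PolylineDrawing G) : Prop :=
  (∀ u v h, SimplePolyline (D.seq u v h)) ∧
  (∀ u v h, polyImage (D.seq u v h) ∩ Set.range D.p = {D.p u, D.p v}) ∧
  (∀ u v u' v' : V, ∀ h : G.Adj u v, ∀ h' : G.Adj u' v', s(u, v) ≠ s(u', v') →
    polyImage (D.seq u v h) ∩ polyImage (D.seq u' v' h') =
      D.p '' (({u, v} : Set V) ∩ {u', v'}))

/-- The point of `ℝ³` with adapted integer coordinates `(height, column, row)`. -/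
def toPt (P : ℤ × ℤ × ℤ) : Pt :=
  !₂[(P.1 + P.2.1 - P.2.2 : ℝ), P.2.1 - P.2.2 - P.1, 2 * P.2.1 + 2 * P.2.2]

/-- The height coordinate. -/
def height : Pt →ₗ[ℝ] ℝ where
  toFun x := (x 0 - x 1) / 2
  map_add' x y := by simp; ring
  map_smul' c x := by simp; ring

/-- The column coordinate. -/
def column : Pt →ₗ[ℝ] ℝ where
  toFun x := (x 0 + x 1 + x 2) / 4
  map_add' x y := by simp; ring
  map_smul' c x := by simp; ring

/-- The row coordinate. -/
def row : Pt →ₗ[ℝ] ℝ where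
  toFun x := (x 2 - x 0 - x 1) / 4
  map_add' x y := by simp; ring
  map_smul' c x := by simp; ring

@[simp] theorem height_toPt (P : ℤ × ℤ × ℤ) : height (toPt P) = P.1 := by
  simp [height, toPt]; ring

@[simp] theorem column_toPt (P : ℤ × ℤ × ℤ) : column (toPt P) = P.2.1 := by
  simp [column, toPt]; ring

@[simp] theorem row_toPt (P : ℤ × ℤ × ℤ) : row (toPt P) = P.2.2 := by
  simp [row, toPt]; ring

theorem pt_ext {x y : Pt} (h₁ : height x = height y) (h₂ : column x = column y)
    (h₃ : row x = row y) : x = y := by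
  simp only [height, column, row, LinearMap.coe_mk, AddHom.coe_mk] at h₁ h₂ h₃
  ext i
  fin_cases i <;> simp <;> linarith

theorem toPt_injective : Function.Injective toPt := by
  intro P Q h
  have h₁ := congrArg height h
  have h₂ := congrArg column h
  have h₃ := congrArg row h
  simp only [height_toPt, column_toPt, row_toPt, Int.cast_inj] at h₁ h₂ h₃
  exact Prod.ext h₁ (Prod.ext h₂ h₃)

/-- The directions used by the drawing: five forward ones and their opposites. -/
inductive Dir
  | fa | fp | fm | fq | fn | ba | bp | bm | bq | bn
  deriving DecidableEq

namespace Dir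

/-- The opposite direction. -/
def neg : Dir → Dir
  | fa => ba | fp => bp | fm => bm | fq => bq | fn => bn
  | ba => fa | bp => fp | bm => fm | bq => fq | bn => fn

/-- The displacement of a unit step, in adapted coordinates. -/
def shift : Dir → ℤ × ℤ × ℤ
  | fa => (1, 0, 0) | fp => (1, 1, 0) | fm => (1, -1, 0) | fq => (1, 0, 1) | fn => (1, 0, -1)
  | ba => (-1, 0, 0) | bp => (-1, -1, 0) | bm => (-1, 1, 0) | bq => (-1, 0, -1) | bn => (-1, 0, 1)

/-- The face diagonal along the direction. -/
def diag : Dir → ℤ × ℤ × ℤ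
  | fa => (1, -1, 0) | fp => (1, 0, 1) | fm => (0, -1, -1) | fq => (0, -1, 1) | fn => (1, 0, -1)
  | ba => (-1, 1, 0) | bp => (-1, 0, -1) | bm => (0, 1, 1) | bq => (0, 1, -1) | bn => (-1, 0, 1)

/-- The factor between a unit step and the face diagonal. -/
def scale : Dir → ℤ
  | fa => 1 | ba => 1 | _ => 2

/-- The face diagonal as a vector. -/
def vec (d : Dir) : Pt := !₂[(d.diag.1 : ℝ), d.diag.2.1, d.diag.2.2]

/-- The scalar product of two face diagonals. -/
def dot (d e : Dir) : ℤ :=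
  d.diag.1 * e.diag.1 + d.diag.2.1 * e.diag.2.1 + d.diag.2.2 * e.diag.2.2

theorem inner_vec (d e : Dir) : inner ℝ d.vec e.vec = (d.dot e : ℝ) := by
  simp [vec, dot, PiLp.inner_apply, Fin.sum_univ_three]
  ring

theorem dot_self (d : Dir) : d.dot d = 2 := by cases d <;> rfl

theorem scale_pos (d : Dir) : 0 < d.scale := by cases d <;> decide

theorem vec_neg (d : Dir) : d.neg.vec = -d.vec := by
  ext i
  cases d <;> fin_cases i <;> simp [neg, vec, diag]

theorem dot_neg_left (d e : Dir) : d.neg.dot e = -d.dot e := by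
  cases d <;> cases e <;> rfl

theorem norm_vec (d : Dir) : ‖d.vec‖ = √2 := by
  rw [norm_eq_sqrt_real_inner, inner_vec, dot_self]; norm_num

theorem le_angle {d e : Dir} (h : d.dot e ≤ -1) {κ μ : ℝ} (hκ : 0 < κ) (hμ : 0 < μ) :
    2 * Real.pi / 3 ≤ angle (κ • d.vec) (μ • e.vec) := by
  rw [angle_smul_left_of_pos _ _ hκ, angle_smul_right_of_pos _ _ hμ, angle, inner_vec, norm_vec,
    norm_vec, Real.mul_self_sqrt (by norm_num)]
  have h1 : Real.arccos (Real.cos (2 * Real.pi / 3)) = 2 * Real.pi / 3 :=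
    Real.arccos_cos (by positivity) (by linarith [Real.pi_pos])
  have h2 : Real.cos (2 * Real.pi / 3) = -1 / 2 := by
    rw [show 2 * Real.pi / 3 = Real.pi - Real.pi / 3 by ring, Real.cos_pi_sub,
      Real.cos_pi_div_three]
    norm_num
  rw [h2] at h1
  rw [← h1]
  apply Real.arccos_le_arccos
  have : (d.dot e : ℝ) ≤ -1 := by exact_mod_cast h
  linarith

theorem vec_isDiagonal (d : Dir) :
    ∃ j : Fin 3, d.vec j = 0 ∧ ∀ i : Fin 3, i ≠ j → (d.vec i = 1 ∨ d.vec i = -1) := by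
  cases d
  case fa | ba => exact ⟨2, by simp [vec, diag], fun i hi => by
      fin_cases i <;> simp_all [vec, diag]⟩
  case fp | fn | bp | bn =>
    exact ⟨1, by simp [vec, diag], fun i hi => by fin_cases i <;> simp_all [vec, diag]⟩
  all_goals exact ⟨0, by simp [vec, diag], fun i hi => by fin_cases i <;> simp_all [vec, diag]⟩

end Dir

/-- The result of moving `l` unit steps from `P` in direction `d`. -/
def move (P : ℤ × ℤ × ℤ) (d : Dir) (l : ℤ) : ℤ × ℤ × ℤ :=
  (P.1 + l * d.shift.1, P.2.1 + l * d.shift.2.1, P.2.2 + l * d.shift.2.2)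

theorem toPt_move_sub (P : ℤ × ℤ × ℤ) (d : Dir) (l : ℤ) :
    toPt (move P d l) - toPt P = ((l * d.scale : ℤ) : ℝ) • d.vec := by
  ext i
  cases d <;> fin_cases i <;>
    simp [toPt, move, Dir.shift, Dir.scale, Dir.vec, Dir.diag] <;> ring

theorem exists_of_mem_segment_move {P : ℤ × ℤ × ℤ} {d : Dir} {l : ℤ} (hl : 0 < l) {x : Pt}
    (hx : x ∈ segment ℝ (toPt P) (toPt (move P d l))) :
    ∃ s : ℝ, 0 ≤ s ∧ s ≤ l ∧ height x = P.1 + s * d.shift.1 ∧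
      column x = P.2.1 + s * d.shift.2.1 ∧ row x = P.2.2 + s * d.shift.2.2 := by
  obtain ⟨a, b, ha, hb, hab, rfl⟩ := hx
  have hl' : (0 : ℝ) < l := by exact_mod_cast hl
  refine ⟨b * l, by positivity, by nlinarith, ?_, ?_, ?_⟩
  all_goals
    simp [move]
    obtain rfl : a = 1 - b := by linarith
    ring

theorem mem_segment_exists {p q x : Pt} (hx : x ∈ segment ℝ p q) :
    ∃ t : ℝ, 0 ≤ t ∧ t ≤ 1 ∧ x = p + t • (q - p) := by
  rw [segment_eq_image'] at hx
  obtain ⟨t, ⟨h0, h1⟩, rfl⟩ := hx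
  exact ⟨t, h0, h1, rfl⟩

theorem le_of_mem_segment (f : Pt →ₗ[ℝ] ℝ) {p q x : Pt} (hx : x ∈ segment ℝ p q)
    (h : f p ≤ f q) : f p ≤ f x ∧ f x ≤ f q := by
  obtain ⟨t, h0, h1, rfl⟩ := mem_segment_exists hx
  simp only [map_add, map_smul, map_sub, smul_eq_mul]
  constructor <;> nlinarith

theorem eq_right_of_mem_segment (f : Pt →ₗ[ℝ] ℝ) {p q x : Pt} (hx : x ∈ segment ℝ p q)
    (h : f p < f q) (hfx : f x = f q) : x = q := by
  obtain ⟨t, h0, h1, rfl⟩ := mem_segment_exists hx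
  simp only [map_add, map_smul, map_sub, smul_eq_mul] at hfx
  obtain rfl : t = 1 := by
    have : (1 - t) * (f q - f p) = 0 := by linarith
    rcases mul_eq_zero.1 this with h' | h' <;> linarith
  simp

theorem eq_left_of_mem_segment (f : Pt →ₗ[ℝ] ℝ) {p q x : Pt} (hx : x ∈ segment ℝ p q)
    (h : f p < f q) (hfx : f x = f p) : x = p := by
  rw [segment_symm] at hx
  refine eq_right_of_mem_segment (-f) hx (by simpa using h) (by simpa using hfx)

/-- A polyline of four segments along which a linear functional increases, strictly so on the two
middle segments, is a simple arc. -/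
theorem simplePolyline_of_monotone (f : Pt →ₗ[ℝ] ℝ) {a b c d e : Pt} (hab : a ≠ b) (hde : d ≠ e)
    (h₁ : f a ≤ f b) (h₂ : f b < f c) (h₃ : f c < f d) (h₄ : f d ≤ f e) :
    SimplePolyline [a, b, c, d, e] := by
  have hbc : b ≠ c := fun h => by simp [h] at h₂
  have hcd : c ≠ d := fun h => by simp [h] at h₃
  refine ⟨show List.IsChain _ _ by simp [hab, hbc, hcd, hde], ?_⟩
  have L1 : ∀ x ∈ segment ℝ a b, f x ≤ f b := fun x hx => (le_of_mem_segment f hx h₁).2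
  have L2 : ∀ x ∈ segment ℝ b c, f b ≤ f x ∧ f x ≤ f c := fun x hx =>
    le_of_mem_segment f hx h₂.le
  have L3 : ∀ x ∈ segment ℝ c d, f c ≤ f x ∧ f x ≤ f d := fun x hx =>
    le_of_mem_segment f hx h₃.le
  have L4 : ∀ x ∈ segment ℝ d e, f d ≤ f x := fun x hx => (le_of_mem_segment f hx h₄).1
  intro i j hi hj hij
  simp only [List.length_cons, List.length_nil] at hi hj
  have hj' : j ≤ 3 := by omega
  have hi' : i ≤ 2 := by omega
  interval_cases j <;> interval_cases i <;> try omega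
  · simp only [List.get_eq_getElem, List.getElem_cons_zero, List.getElem_cons_succ, if_true]
    ext x
    refine ⟨fun hx => eq_left_of_mem_segment f hx.2 h₂ (le_antisymm (L1 x hx.1) (L2 x hx.2).1), ?_⟩
    rintro rfl
    exact ⟨right_mem_segment ℝ _ _, left_mem_segment ℝ _ _⟩
  · simp only [List.get_eq_getElem, List.getElem_cons_zero, List.getElem_cons_succ]
    rw [if_neg (by norm_num), Set.eq_empty_iff_forall_notMem]
    rintro x ⟨hx, hx'⟩
    linarith [L1 x hx, (L3 x hx').1]
  · simp only [List.get_eq_getElem, List.getElem_cons_zero, List.getElem_cons_succ, if_true]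
    ext x
    refine ⟨fun hx => eq_left_of_mem_segment f hx.2 h₃
      (le_antisymm (L2 x hx.1).2 (L3 x hx.2).1), ?_⟩
    rintro rfl
    exact ⟨right_mem_segment ℝ _ _, left_mem_segment ℝ _ _⟩
  · simp only [List.get_eq_getElem, List.getElem_cons_zero, List.getElem_cons_succ]
    rw [if_neg (by norm_num), Set.eq_empty_iff_forall_notMem]
    rintro x ⟨hx, hx'⟩
    linarith [L1 x hx, L4 x hx']
  · simp only [List.get_eq_getElem, List.getElem_cons_zero, List.getElem_cons_succ]
    rw [if_neg (by norm_num), Set.eq_empty_iff_forall_notMem]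
    rintro x ⟨hx, hx'⟩
    linarith [(L2 x hx).2, L4 x hx']
  · simp only [List.get_eq_getElem, List.getElem_cons_zero, List.getElem_cons_succ, if_true]
    ext x
    refine ⟨fun hx => eq_right_of_mem_segment f hx.1 h₃
      (le_antisymm (L3 x hx.1).2 (L4 x hx.2)), ?_⟩
    rintro rfl
    exact ⟨right_mem_segment ℝ _ _, left_mem_segment ℝ _ _⟩

theorem polyImage_five (a b c d e : Pt) : polyImage [a, b, c, d, e] =
    segment ℝ a b ∪ segment ℝ b c ∪ segment ℝ c d ∪ segment ℝ d e := by
  simp [polyImage, Set.union_assoc]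

theorem polyImage_reverse_five (a b c d e : Pt) :
    polyImage [a, b, c, d, e].reverse = polyImage [a, b, c, d, e] := by
  simp only [List.reverse_cons, List.reverse_nil, List.nil_append, List.cons_append,
    polyImage_five]
  rw [segment_symm ℝ e d, segment_symm ℝ d c, segment_symm ℝ c b, segment_symm ℝ b a]
  ext x
  simp only [Set.mem_union]
  tauto

/-- The open region, relative to a vertex at height `r` and column `b`, reserved for an edge that
leaves the vertex in the given direction. -/
def Dir.Sector (r b h k : ℝ) : Dir → Prop
  | .fp => r < h ∧ b < k
  | .fm => r < h ∧ k < b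
  | .ba => h < r
  | .bm => h < r ∧ b < k
  | .bp => h < r ∧ k < b
  | .fa => r < h
  | _ => False

theorem Dir.not_sector_of_sector {d e : Dir} (hde : d.dot e ≤ -1) {r b h k : ℝ}
    (hd : d.Sector r b h k) : ¬ e.Sector r b h k := by
  intro he
  cases d <;> cases e <;> simp only [Sector] at hd he <;>
    first
    | linarith
    | exact absurd hde (by decide)

/-- What an edge from `P` to `Q` may occupy: the rows of its ends near their heights, and
the column `k`, away from the ends only near their heights or in their rows. In the rows of its
ends the edge stays within the sectors of its first and last directions `d` and `e`. -/
structure Allowed (P Q : ℤ × ℤ × ℤ) (d e : Dir) (k M N : ℤ) (h b c : ℝ) : Prop where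
  region : (c = P.2.2 ∧ |h - P.1| ≤ M) ∨ (c = Q.2.2 ∧ |h - Q.1| ≤ M) ∨
    (b = k ∧ (|h - P.1| ≤ M ∨ |h - Q.1| ≤ M ∨ c = P.2.2 ∨ c = Q.2.2))
  left : c = P.2.2 → (h = P.1 ∧ b = P.2.1) ∨ d.Sector P.1 P.2.1 h b
  right : c = Q.2.2 → (h = Q.1 ∧ b = Q.2.1) ∨ e.Sector Q.1 Q.2.1 h b
  height_le : |h| ≤ N
  column_le : |b| ≤ N
  row_le : |c| ≤ N

/-- A path of four segments from `P` to `Q` that leaves `P` in direction `d` and arrives at `Q`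
from direction `e`, uses column `k`, turns by at most 60 degrees, and is monotone in height or in
row. -/
structure Route (P Q : ℤ × ℤ × ℤ) (d e : Dir) (k M N : ℤ) where
  d₂ : Dir
  d₃ : Dir
  l₁ : ℤ
  l₂ : ℤ
  l₃ : ℤ
  l₄ : ℤ
  l₁_pos : 0 < l₁
  l₂_pos : 0 < l₂
  l₃_pos : 0 < l₃
  l₄_pos : 0 < l₄
  arrive : move (move (move (move P d l₁) d₂ l₂) d₃ l₃) e.neg l₄ = Q
  dot₁ : 1 ≤ d.dot d₂
  dot₂ : 1 ≤ d₂.dot d₃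
  dot₃ : 1 ≤ d₃.dot e.neg
  mono : (0 ≤ d.shift.1 ∧ 0 < d₂.shift.1 ∧ 0 < d₃.shift.1 ∧ 0 ≤ e.neg.shift.1) ∨
    (0 ≤ d.shift.2.2 ∧ 0 < d₂.shift.2.2 ∧ 0 < d₃.shift.2.2 ∧ 0 ≤ e.neg.shift.2.2)
  allowed₁ : ∀ t : ℝ, 0 ≤ t → t ≤ l₁ → Allowed P Q d e k M N
    (P.1 + t * d.shift.1) (P.2.1 + t * d.shift.2.1) (P.2.2 + t * d.shift.2.2)
  allowed₂ : ∀ t : ℝ, 0 ≤ t → t ≤ l₂ → Allowed P Q d e k M N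
    ((move P d l₁).1 + t * d₂.shift.1) ((move P d l₁).2.1 + t * d₂.shift.2.1)
    ((move P d l₁).2.2 + t * d₂.shift.2.2)
  allowed₃ : ∀ t : ℝ, 0 ≤ t → t ≤ l₃ → Allowed P Q d e k M N
    ((move (move P d l₁) d₂ l₂).1 + t * d₃.shift.1)
    ((move (move P d l₁) d₂ l₂).2.1 + t * d₃.shift.2.1)
    ((move (move P d l₁) d₂ l₂).2.2 + t * d₃.shift.2.2)
  allowed₄ : ∀ t : ℝ, 0 ≤ t → t ≤ l₄ → Allowed P Q d e k M N
    ((move (move (move P d l₁) d₂ l₂) d₃ l₃).1 + t * e.neg.shift.1)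
    ((move (move (move P d l₁) d₂ l₂) d₃ l₃).2.1 + t * e.neg.shift.2.1)
    ((move (move (move P d l₁) d₂ l₂) d₃ l₃).2.2 + t * e.neg.shift.2.2)

/-- The numerical conditions under which two points can be joined by a route using column `k`. -/
structure Fits (P Q : ℤ × ℤ × ℤ) (k X M N : ℤ) : Prop where
  column_left : |P.2.1| ≤ X
  column_right : |Q.2.1| ≤ X
  column_le : |k| ≤ X
  row_left : |P.2.2| ≤ X
  row_right : |Q.2.2| ≤ X
  width : 4 * X + 5 ≤ M
  height_lt : P.1 + 2 * M < Q.1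
  height_left : |P.1| + M ≤ N
  height_right : |Q.1| + M ≤ N

/-- Unfolds the numerical conditions into inequalities between real numbers. -/
theorem Fits.cast {r₀ b₀ c₀ r₁ b₁ c₁ k X M N : ℤ}
    (h : Fits (r₀, b₀, c₀) (r₁, b₁, c₁) k X M N) :
    ((-X : ℝ) ≤ b₀ ∧ (b₀ : ℝ) ≤ X) ∧ ((-X : ℝ) ≤ b₁ ∧ (b₁ : ℝ) ≤ X) ∧
    ((-X : ℝ) ≤ k ∧ (k : ℝ) ≤ X) ∧ ((-X : ℝ) ≤ c₀ ∧ (c₀ : ℝ) ≤ X) ∧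
    ((-X : ℝ) ≤ c₁ ∧ (c₁ : ℝ) ≤ X) ∧ (4 * X + 5 : ℝ) ≤ M ∧ (r₀ + 2 * M : ℝ) < r₁ ∧
    ((-N : ℝ) ≤ r₀ - M ∧ (r₀ + M : ℝ) ≤ N) ∧ ((-N : ℝ) ≤ r₁ - M ∧ (r₁ + M : ℝ) ≤ N) := by
  obtain ⟨h1, h2, h3, h4, h5, h6, h7, h8, h9⟩ := h
  have h8' := abs_le.1 (le_sub_iff_add_le.2 h8)
  have h9' := abs_le.1 (le_sub_iff_add_le.2 h9)
  rw [abs_le] at h1 h2 h3 h4 h5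
  simp only at h1 h2 h3 h4 h5 h6 h7 h8' h9'
  refine ⟨⟨?_, ?_⟩, ⟨?_, ?_⟩, ⟨?_, ?_⟩, ⟨?_, ?_⟩, ⟨?_, ?_⟩, ?_, ?_, ⟨?_, ?_⟩, ⟨?_, ?_⟩⟩ <;>
    norm_cast <;> omega

theorem exists_route_dip {r₀ b c₀ r₁ c₁ X M N : ℤ}
    (h : Fits (r₀, b, c₀) (r₁, b, c₁) b X M N) (hc : c₁ = c₀ + 2) :
    Nonempty (Route (r₀, b, c₀) (r₁, b, c₁) .ba .ba b M N) := by
  obtain ⟨_, _, _, _, _, _, _, _, _⟩ := h.cast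
  have h₁ := abs_le.1 h.column_left
  have h₂ := abs_le.1 h.column_right
  have h₃ := abs_le.1 h.column_le
  have h₄ := abs_le.1 h.row_left
  have h₅ := abs_le.1 h.row_right
  have h₆ := h.width
  have h₇ := h.height_lt
  simp only at h₁ h₂ h₃ h₄ h₅ h₆ h₇
  have hc' : (c₁ : ℝ) = c₀ + 2 := by exact_mod_cast hc
  refine ⟨⟨.bn, .fq, 1, 1, 1, r₁ - r₀ + 1, by omega, by omega, by omega, by omega, ?_, by decide,
    by decide, by decide, by decide, ?_, ?_, ?_, ?_⟩⟩
  · simp [move, Dir.shift, Dir.neg]; omega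
  all_goals
    intro t ht0 ht1
    simp [move, Dir.shift, Dir.neg] at ht1 ⊢
    refine ⟨?_, ?_, ?_, ?_, ?_, ?_⟩ <;> simp only [Dir.Sector, abs_le] <;> grind

theorem exists_route_overshoot {r₀ b c₀ r₁ c₁ X M N : ℤ}
    (h : Fits (r₀, b, c₀) (r₁, b, c₁) b X M N) (hc : c₁ = c₀ + 2) :
    Nonempty (Route (r₀, b, c₀) (r₁, b, c₁) .fa .fa b M N) := by
  obtain ⟨_, _, _, _, _, _, _, _, _⟩ := h.cast
  have h₁ := abs_le.1 h.column_left
  have h₂ := abs_le.1 h.column_right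
  have h₃ := abs_le.1 h.column_le
  have h₄ := abs_le.1 h.row_left
  have h₅ := abs_le.1 h.row_right
  have h₆ := h.width
  have h₇ := h.height_lt
  simp only at h₁ h₂ h₃ h₄ h₅ h₆ h₇
  have hc' : (c₁ : ℝ) = c₀ + 2 := by exact_mod_cast hc
  refine ⟨⟨.fq, .bn, r₁ - r₀ + 1, 1, 1, 1, by omega, by omega, by omega, by omega, ?_, by decide,
    by decide, by decide, by decide, ?_, ?_, ?_, ?_⟩⟩
  · simp [move, Dir.shift, Dir.neg]; omega
  all_goals
    intro t ht0 ht1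
    simp [move, Dir.shift, Dir.neg] at ht1 ⊢
    refine ⟨?_, ?_, ?_, ?_, ?_, ?_⟩ <;> simp only [Dir.Sector, abs_le] <;> grind

theorem exists_route_private_pos_pos {r₀ b₀ c₀ r₁ b₁ c₁ k X M N : ℤ}
    (h : Fits (r₀, b₀, c₀) (r₁, b₁, c₁) k X M N)
    (hb₀ : b₀ < k) (hb₁ : b₁ < k) (hc : c₀ < c₁) :
    Nonempty (Route (r₀, b₀, c₀) (r₁, b₁, c₁) .fp .bm k M N) := by
  obtain ⟨_, _, _, _, _, _, _, _, _⟩ := h.cast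
  have h₁ := abs_le.1 h.column_left
  have h₂ := abs_le.1 h.column_right
  have h₃ := abs_le.1 h.column_le
  have h₄ := abs_le.1 h.row_left
  have h₅ := abs_le.1 h.row_right
  have h₆ := h.width
  have h₇ := h.height_lt
  simp only at h₁ h₂ h₃ h₄ h₅ h₆ h₇
  have hb₀' : (((b₀ : ℤ) : ℝ) < ((k : ℤ) : ℝ)) := by exact_mod_cast hb₀
  have hb₁' : (((b₁ : ℤ) : ℝ) < ((k : ℤ) : ℝ)) := by exact_mod_cast hb₁
  have hc' : (((c₀ : ℤ) : ℝ) < ((c₁ : ℤ) : ℝ)) := by exact_mod_cast hc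
  refine ⟨⟨.fq, .fa, k - b₀, c₁ - c₀,
    r₁ - r₀ - (k - b₀) - (k - b₁) - (c₁ - c₀), k - b₁,
    by omega, by omega, by omega, by omega, ?_, by decide,
    by decide, by decide, by decide, ?_, ?_, ?_, ?_⟩⟩
  · simp [move, Dir.shift, Dir.neg]; omega
  all_goals
    intro t ht0 ht1
    simp [move, Dir.shift, Dir.neg] at ht1 ⊢
    refine ⟨?_, ?_, ?_, ?_, ?_, ?_⟩ <;> simp only [Dir.Sector, abs_le] <;> grind

theorem exists_route_private_pos_neg {r₀ b₀ c₀ r₁ b₁ c₁ k X M N : ℤ}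
    (h : Fits (r₀, b₀, c₀) (r₁, b₁, c₁) k X M N)
    (hb₀ : b₀ < k) (hb₁ : b₁ < k) (hc : c₁ < c₀) :
    Nonempty (Route (r₀, b₀, c₀) (r₁, b₁, c₁) .fp .bm k M N) := by
  obtain ⟨_, _, _, _, _, _, _, _, _⟩ := h.cast
  have h₁ := abs_le.1 h.column_left
  have h₂ := abs_le.1 h.column_right
  have h₃ := abs_le.1 h.column_le
  have h₄ := abs_le.1 h.row_left
  have h₅ := abs_le.1 h.row_right
  have h₆ := h.width
  have h₇ := h.height_lt
  simp only at h₁ h₂ h₃ h₄ h₅ h₆ h₇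
  have hb₀' : (((b₀ : ℤ) : ℝ) < ((k : ℤ) : ℝ)) := by exact_mod_cast hb₀
  have hb₁' : (((b₁ : ℤ) : ℝ) < ((k : ℤ) : ℝ)) := by exact_mod_cast hb₁
  have hc' : (((c₁ : ℤ) : ℝ) < ((c₀ : ℤ) : ℝ)) := by exact_mod_cast hc
  refine ⟨⟨.fa, .fn, k - b₀,
    r₁ - r₀ - (k - b₀) - (k - b₁) - (c₀ - c₁), c₀ - c₁, k - b₁,
    by omega, by omega, by omega, by omega, ?_, by decide,
    by decide, by decide, by decide, ?_, ?_, ?_, ?_⟩⟩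
  · simp [move, Dir.shift, Dir.neg]; omega
  all_goals
    intro t ht0 ht1
    simp [move, Dir.shift, Dir.neg] at ht1 ⊢
    refine ⟨?_, ?_, ?_, ?_, ?_, ?_⟩ <;> simp only [Dir.Sector, abs_le] <;> grind

theorem exists_route_forward_pos {r₀ b₀ c₀ r₁ b₁ c₁ X M N : ℤ}
    (h : Fits (r₀, b₀, c₀) (r₁, b₁, c₁) b₁ X M N)
    (hb : b₀ < b₁) (hc : c₀ < c₁) :
    Nonempty (Route (r₀, b₀, c₀) (r₁, b₁, c₁) .fp .ba b₁ M N) := by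
  obtain ⟨_, _, _, _, _, _, _, _, _⟩ := h.cast
  have h₁ := abs_le.1 h.column_left
  have h₂ := abs_le.1 h.column_right
  have h₃ := abs_le.1 h.column_le
  have h₄ := abs_le.1 h.row_left
  have h₅ := abs_le.1 h.row_right
  have h₆ := h.width
  have h₇ := h.height_lt
  simp only at h₁ h₂ h₃ h₄ h₅ h₆ h₇
  have hb' : (((b₀ : ℤ) : ℝ) < ((b₁ : ℤ) : ℝ)) := by exact_mod_cast hb
  have hc' : (((c₀ : ℤ) : ℝ) < ((c₁ : ℤ) : ℝ)) := by exact_mod_cast hc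
  refine ⟨⟨.fq, .fa, b₁ - b₀, c₁ - c₀,
    r₁ - r₀ - (b₁ - b₀) - (c₁ - c₀) - 1, 1, by omega, by omega, by omega, by omega, ?_, by decide,
    by decide, by decide, by decide, ?_, ?_, ?_, ?_⟩⟩
  · simp [move, Dir.shift, Dir.neg]; omega
  all_goals
    intro t ht0 ht1
    simp [move, Dir.shift, Dir.neg] at ht1 ⊢
    refine ⟨?_, ?_, ?_, ?_, ?_, ?_⟩ <;> simp only [Dir.Sector, abs_le] <;> grind

theorem exists_route_backward_pos {r₀ b₀ c₀ r₁ b₁ c₁ X M N : ℤ}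
    (h : Fits (r₀, b₀, c₀) (r₁, b₁, c₁) b₀ X M N)
    (hb : b₀ < b₁) (hc : c₀ < c₁) :
    Nonempty (Route (r₀, b₀, c₀) (r₁, b₁, c₁) .fa .bp b₀ M N) := by
  obtain ⟨_, _, _, _, _, _, _, _, _⟩ := h.cast
  have h₁ := abs_le.1 h.column_left
  have h₂ := abs_le.1 h.column_right
  have h₃ := abs_le.1 h.column_le
  have h₄ := abs_le.1 h.row_left
  have h₅ := abs_le.1 h.row_right
  have h₆ := h.width
  have h₇ := h.height_lt
  simp only at h₁ h₂ h₃ h₄ h₅ h₆ h₇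
  have hb' : (((b₀ : ℤ) : ℝ) < ((b₁ : ℤ) : ℝ)) := by exact_mod_cast hb
  have hc' : (((c₀ : ℤ) : ℝ) < ((c₁ : ℤ) : ℝ)) := by exact_mod_cast hc
  refine ⟨⟨.fa, .fq, 1, r₁ - r₀ - (b₁ - b₀) - (c₁ - c₀) - 1,
    c₁ - c₀, b₁ - b₀, by omega, by omega, by omega, by omega, ?_, by decide,
    by decide, by decide, by decide, ?_, ?_, ?_, ?_⟩⟩
  · simp [move, Dir.shift, Dir.neg]; omega
  all_goals
    intro t ht0 ht1
    simp [move, Dir.shift, Dir.neg] at ht1 ⊢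
    refine ⟨?_, ?_, ?_, ?_, ?_, ?_⟩ <;> simp only [Dir.Sector, abs_le] <;> grind

theorem exists_route_axial_pos {r₀ b₀ c₀ r₁ b₁ c₁ X M N : ℤ}
    (h : Fits (r₀, b₀, c₀) (r₁, b₁, c₁) b₁ X M N)
    (hb : b₀ < b₁) (hc : c₀ < c₁) :
    Nonempty (Route (r₀, b₀, c₀) (r₁, b₁, c₁) .fa .ba b₁ M N) := by
  obtain ⟨_, _, _, _, _, _, _, _, _⟩ := h.cast
  have h₁ := abs_le.1 h.column_left
  have h₂ := abs_le.1 h.column_right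
  have h₃ := abs_le.1 h.column_le
  have h₄ := abs_le.1 h.row_left
  have h₅ := abs_le.1 h.row_right
  have h₆ := h.width
  have h₇ := h.height_lt
  simp only at h₁ h₂ h₃ h₄ h₅ h₆ h₇
  have hb' : (((b₀ : ℤ) : ℝ) < ((b₁ : ℤ) : ℝ)) := by exact_mod_cast hb
  have hc' : (((c₀ : ℤ) : ℝ) < ((c₁ : ℤ) : ℝ)) := by exact_mod_cast hc
  refine ⟨⟨.fp, .fq, 1, b₁ - b₀, c₁ - c₀,
    r₁ - r₀ - (b₁ - b₀) - (c₁ - c₀) - 1, by omega, by omega, by omega, by omega, ?_, by decide,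
    by decide, by decide, by decide, ?_, ?_, ?_, ?_⟩⟩
  · simp [move, Dir.shift, Dir.neg]; omega
  all_goals
    intro t ht0 ht1
    simp [move, Dir.shift, Dir.neg] at ht1 ⊢
    refine ⟨?_, ?_, ?_, ?_, ?_, ?_⟩ <;> simp only [Dir.Sector, abs_le] <;> grind

theorem exists_route_private_neg_neg {r₀ b₀ c₀ r₁ b₁ c₁ k X M N : ℤ}
    (h : Fits (r₀, b₀, c₀) (r₁, b₁, c₁) k X M N)
    (hb₀ : k < b₀) (hb₁ : k < b₁) (hc : c₁ < c₀) :
    Nonempty (Route (r₀, b₀, c₀) (r₁, b₁, c₁) .fm .bp k M N) := by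
  obtain ⟨_, _, _, _, _, _, _, _, _⟩ := h.cast
  have h₁ := abs_le.1 h.column_left
  have h₂ := abs_le.1 h.column_right
  have h₃ := abs_le.1 h.column_le
  have h₄ := abs_le.1 h.row_left
  have h₅ := abs_le.1 h.row_right
  have h₆ := h.width
  have h₇ := h.height_lt
  simp only at h₁ h₂ h₃ h₄ h₅ h₆ h₇
  have hb₀' : (((k : ℤ) : ℝ) < ((b₀ : ℤ) : ℝ)) := by exact_mod_cast hb₀
  have hb₁' : (((k : ℤ) : ℝ) < ((b₁ : ℤ) : ℝ)) := by exact_mod_cast hb₁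
  have hc' : (((c₁ : ℤ) : ℝ) < ((c₀ : ℤ) : ℝ)) := by exact_mod_cast hc
  refine ⟨⟨.fn, .fa, b₀ - k, c₀ - c₁,
    r₁ - r₀ - (b₀ - k) - (b₁ - k) - (c₀ - c₁), b₁ - k,
    by omega, by omega, by omega, by omega, ?_, by decide,
    by decide, by decide, by decide, ?_, ?_, ?_, ?_⟩⟩
  · simp [move, Dir.shift, Dir.neg]; omega
  all_goals
    intro t ht0 ht1
    simp [move, Dir.shift, Dir.neg] at ht1 ⊢
    refine ⟨?_, ?_, ?_, ?_, ?_, ?_⟩ <;> simp only [Dir.Sector, abs_le] <;> grind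

theorem exists_route_private_neg_pos {r₀ b₀ c₀ r₁ b₁ c₁ k X M N : ℤ}
    (h : Fits (r₀, b₀, c₀) (r₁, b₁, c₁) k X M N)
    (hb₀ : k < b₀) (hb₁ : k < b₁) (hc : c₀ < c₁) :
    Nonempty (Route (r₀, b₀, c₀) (r₁, b₁, c₁) .fm .bp k M N) := by
  obtain ⟨_, _, _, _, _, _, _, _, _⟩ := h.cast
  have h₁ := abs_le.1 h.column_left
  have h₂ := abs_le.1 h.column_right
  have h₃ := abs_le.1 h.column_le
  have h₄ := abs_le.1 h.row_left
  have h₅ := abs_le.1 h.row_right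
  have h₆ := h.width
  have h₇ := h.height_lt
  simp only at h₁ h₂ h₃ h₄ h₅ h₆ h₇
  have hb₀' : (((k : ℤ) : ℝ) < ((b₀ : ℤ) : ℝ)) := by exact_mod_cast hb₀
  have hb₁' : (((k : ℤ) : ℝ) < ((b₁ : ℤ) : ℝ)) := by exact_mod_cast hb₁
  have hc' : (((c₀ : ℤ) : ℝ) < ((c₁ : ℤ) : ℝ)) := by exact_mod_cast hc
  refine ⟨⟨.fa, .fq, b₀ - k,
    r₁ - r₀ - (b₀ - k) - (b₁ - k) - (c₁ - c₀), c₁ - c₀, b₁ - k,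
    by omega, by omega, by omega, by omega, ?_, by decide,
    by decide, by decide, by decide, ?_, ?_, ?_, ?_⟩⟩
  · simp [move, Dir.shift, Dir.neg]; omega
  all_goals
    intro t ht0 ht1
    simp [move, Dir.shift, Dir.neg] at ht1 ⊢
    refine ⟨?_, ?_, ?_, ?_, ?_, ?_⟩ <;> simp only [Dir.Sector, abs_le] <;> grind

theorem exists_route_forward_neg {r₀ b₀ c₀ r₁ b₁ c₁ X M N : ℤ}
    (h : Fits (r₀, b₀, c₀) (r₁, b₁, c₁) b₁ X M N)
    (hb : b₁ < b₀) (hc : c₁ < c₀) :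
    Nonempty (Route (r₀, b₀, c₀) (r₁, b₁, c₁) .fm .ba b₁ M N) := by
  obtain ⟨_, _, _, _, _, _, _, _, _⟩ := h.cast
  have h₁ := abs_le.1 h.column_left
  have h₂ := abs_le.1 h.column_right
  have h₃ := abs_le.1 h.column_le
  have h₄ := abs_le.1 h.row_left
  have h₅ := abs_le.1 h.row_right
  have h₆ := h.width
  have h₇ := h.height_lt
  simp only at h₁ h₂ h₃ h₄ h₅ h₆ h₇
  have hb' : (((b₁ : ℤ) : ℝ) < ((b₀ : ℤ) : ℝ)) := by exact_mod_cast hb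
  have hc' : (((c₁ : ℤ) : ℝ) < ((c₀ : ℤ) : ℝ)) := by exact_mod_cast hc
  refine ⟨⟨.fn, .fa, b₀ - b₁, c₀ - c₁,
    r₁ - r₀ - (b₀ - b₁) - (c₀ - c₁) - 1, 1, by omega, by omega, by omega, by omega, ?_, by decide,
    by decide, by decide, by decide, ?_, ?_, ?_, ?_⟩⟩
  · simp [move, Dir.shift, Dir.neg]; omega
  all_goals
    intro t ht0 ht1
    simp [move, Dir.shift, Dir.neg] at ht1 ⊢
    refine ⟨?_, ?_, ?_, ?_, ?_, ?_⟩ <;> simp only [Dir.Sector, abs_le] <;> grind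

theorem exists_route_backward_neg {r₀ b₀ c₀ r₁ b₁ c₁ X M N : ℤ}
    (h : Fits (r₀, b₀, c₀) (r₁, b₁, c₁) b₀ X M N)
    (hb : b₁ < b₀) (hc : c₁ < c₀) :
    Nonempty (Route (r₀, b₀, c₀) (r₁, b₁, c₁) .fa .bm b₀ M N) := by
  obtain ⟨_, _, _, _, _, _, _, _, _⟩ := h.cast
  have h₁ := abs_le.1 h.column_left
  have h₂ := abs_le.1 h.column_right
  have h₃ := abs_le.1 h.column_le
  have h₄ := abs_le.1 h.row_left
  have h₅ := abs_le.1 h.row_right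
  have h₆ := h.width
  have h₇ := h.height_lt
  simp only at h₁ h₂ h₃ h₄ h₅ h₆ h₇
  have hb' : (((b₁ : ℤ) : ℝ) < ((b₀ : ℤ) : ℝ)) := by exact_mod_cast hb
  have hc' : (((c₁ : ℤ) : ℝ) < ((c₀ : ℤ) : ℝ)) := by exact_mod_cast hc
  refine ⟨⟨.fa, .fn, 1, r₁ - r₀ - (b₀ - b₁) - (c₀ - c₁) - 1,
    c₀ - c₁, b₀ - b₁, by omega, by omega, by omega, by omega, ?_, by decide,
    by decide, by decide, by decide, ?_, ?_, ?_, ?_⟩⟩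
  · simp [move, Dir.shift, Dir.neg]; omega
  all_goals
    intro t ht0 ht1
    simp [move, Dir.shift, Dir.neg] at ht1 ⊢
    refine ⟨?_, ?_, ?_, ?_, ?_, ?_⟩ <;> simp only [Dir.Sector, abs_le] <;> grind

theorem exists_route_axial_neg {r₀ b₀ c₀ r₁ b₁ c₁ X M N : ℤ}
    (h : Fits (r₀, b₀, c₀) (r₁, b₁, c₁) b₁ X M N)
    (hb : b₁ < b₀) (hc : c₁ < c₀) :
    Nonempty (Route (r₀, b₀, c₀) (r₁, b₁, c₁) .fa .ba b₁ M N) := by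
  obtain ⟨_, _, _, _, _, _, _, _, _⟩ := h.cast
  have h₁ := abs_le.1 h.column_left
  have h₂ := abs_le.1 h.column_right
  have h₃ := abs_le.1 h.column_le
  have h₄ := abs_le.1 h.row_left
  have h₅ := abs_le.1 h.row_right
  have h₆ := h.width
  have h₇ := h.height_lt
  simp only at h₁ h₂ h₃ h₄ h₅ h₆ h₇
  have hb' : (((b₁ : ℤ) : ℝ) < ((b₀ : ℤ) : ℝ)) := by exact_mod_cast hb
  have hc' : (((c₁ : ℤ) : ℝ) < ((c₀ : ℤ) : ℝ)) := by exact_mod_cast hc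
  refine ⟨⟨.fm, .fn, 1, b₀ - b₁, c₀ - c₁,
    r₁ - r₀ - (b₀ - b₁) - (c₀ - c₁) - 1, by omega, by omega, by omega, by omega, ?_, by decide,
    by decide, by decide, by decide, ?_, ?_, ?_, ?_⟩⟩
  · simp [move, Dir.shift, Dir.neg]; omega
  all_goals
    intro t ht0 ht1
    simp [move, Dir.shift, Dir.neg] at ht1 ⊢
    refine ⟨?_, ?_, ?_, ?_, ?_, ?_⟩ <;> simp only [Dir.Sector, abs_le] <;> grind

namespace Route

variable {P Q : ℤ × ℤ × ℤ} {d e : Dir} {k M N : ℤ} (R : Route P Q d e k M N)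

/-- The first bend. -/
def bend₁ : ℤ × ℤ × ℤ := move P d R.l₁

/-- The second bend. -/
def bend₂ : ℤ × ℤ × ℤ := move R.bend₁ R.d₂ R.l₂

/-- The third bend. -/
def bend₃ : ℤ × ℤ × ℤ := move R.bend₂ R.d₃ R.l₃

theorem move_bend₃ : move R.bend₃ e.neg R.l₄ = Q := R.arrive

/-- The polyline of a route. -/
def path : List Pt := [toPt P, toPt R.bend₁, toPt R.bend₂, toPt R.bend₃, toPt Q]

theorem move_ne {P : ℤ × ℤ × ℤ} {d : Dir} {l : ℤ} (hl : 0 < l) : move P d l ≠ P := by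
  intro h
  have h1 := congrArg Prod.fst h
  have h2 := congrArg (fun x => x.2.1) h
  have h3 := congrArg (fun x => x.2.2) h
  cases d <;> simp [move, Dir.shift] at h1 h2 h3 <;> omega

theorem toPt_arrive : toPt (move R.bend₃ e.neg R.l₄) = toPt Q := congrArg toPt R.arrive

theorem exists_monotone : ∃ f : Pt →ₗ[ℝ] ℝ, f (toPt P) ≤ f (toPt R.bend₁) ∧
    f (toPt R.bend₁) < f (toPt R.bend₂) ∧ f (toPt R.bend₂) < f (toPt R.bend₃) ∧
    f (toPt R.bend₃) ≤ f (toPt Q) := by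
  have h₁ := R.l₁_pos
  have h₂ := R.l₂_pos
  have h₃ := R.l₃_pos
  have h₄ := R.l₄_pos
  rw [← R.toPt_arrive]
  rcases R.mono with ⟨m₁, m₂, m₃, m₄⟩ | ⟨m₁, m₂, m₃, m₄⟩
  · refine ⟨height, ?_, ?_, ?_, ?_⟩ <;> simp only [height_toPt, Int.cast_le, Int.cast_lt]
    · simp only [bend₁, move]; nlinarith
    · simp only [bend₂, move]; nlinarith
    · simp only [bend₃, move]; nlinarith
    · simp only [move]; nlinarith
  · refine ⟨row, ?_, ?_, ?_, ?_⟩ <;> simp only [row_toPt, Int.cast_le, Int.cast_lt]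
    · simp only [bend₁, move]; nlinarith
    · simp only [bend₂, move]; nlinarith
    · simp only [bend₃, move]; nlinarith
    · simp only [move]; nlinarith

theorem left_ne : toPt P ≠ toPt R.bend₁ := fun h => move_ne R.l₁_pos (toPt_injective h).symm

theorem right_ne : toPt R.bend₃ ≠ toPt Q := fun h =>
  move_ne R.l₄_pos (R.move_bend₃.trans (toPt_injective h).symm)

theorem simplePolyline_path : SimplePolyline R.path := by
  obtain ⟨f, h₁, h₂, h₃, h₄⟩ := R.exists_monotone
  exact simplePolyline_of_monotone f R.left_ne R.right_ne h₁ h₂ h₃ h₄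

theorem simplePolyline_path_reverse : SimplePolyline R.path.reverse := by
  obtain ⟨f, h₁, h₂, h₃, h₄⟩ := R.exists_monotone
  exact simplePolyline_of_monotone (-f) R.right_ne.symm R.left_ne.symm (neg_le_neg h₄)
    (neg_lt_neg h₃) (neg_lt_neg h₂) (neg_le_neg h₁)

theorem polyImage_path_reverse : polyImage R.path.reverse = polyImage R.path :=
  polyImage_reverse_five _ _ _ _ _

theorem allowed_of_mem {x : Pt} (hx : x ∈ polyImage R.path) :
    Allowed P Q d e k M N (height x) (column x) (row x) := by
  rw [path, polyImage_five] at hx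
  rcases hx with ((hx | hx) | hx) | hx
  · obtain ⟨t, h0, h1, hh, hc, hr⟩ := exists_of_mem_segment_move R.l₁_pos hx
    rw [hh, hc, hr]
    exact R.allowed₁ t h0 h1
  · obtain ⟨t, h0, h1, hh, hc, hr⟩ := exists_of_mem_segment_move R.l₂_pos hx
    rw [hh, hc, hr]
    exact R.allowed₂ t h0 h1
  · obtain ⟨t, h0, h1, hh, hc, hr⟩ := exists_of_mem_segment_move R.l₃_pos hx
    rw [hh, hc, hr]
    exact R.allowed₃ t h0 h1
  · rw [← R.toPt_arrive] at hx
    obtain ⟨t, h0, h1, hh, hc, hr⟩ := exists_of_mem_segment_move R.l₄_pos hx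
    rw [hh, hc, hr]
    exact R.allowed₄ t h0 h1

theorem left_mem : toPt P ∈ polyImage R.path := by
  rw [path, polyImage_five]
  exact Or.inl (Or.inl (Or.inl (left_mem_segment ℝ _ _)))

theorem right_mem : toPt Q ∈ polyImage R.path := by
  rw [path, polyImage_five]
  exact Or.inr (right_mem_segment ℝ _ _)

theorem exists_eq_toPt {q : Pt} (hq : q ∈ R.path) : ∃ A, q = toPt A := by
  simp only [path, List.mem_cons, List.not_mem_nil, or_false] at hq
  rcases hq with rfl | rfl | rfl | rfl | rfl <;> exact ⟨_, rfl⟩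

/-- Each segment of a route is a positive multiple of a face diagonal. -/
theorem exists_of_consecutive {a b : Pt} (h : [a, b] <:+: R.path) :
    ∃ κ : ℝ, 0 < κ ∧ ∃ f : Dir, b - a = κ • f.vec := by
  have key : ∀ (A : ℤ × ℤ × ℤ) (f : Dir) (l : ℤ), 0 < l → ∃ κ : ℝ, 0 < κ ∧ ∃ f' : Dir,
      toPt (move A f l) - toPt A = κ • f'.vec := fun A f l hl =>
    ⟨_, by exact_mod_cast mul_pos hl f.scale_pos, f, toPt_move_sub A f l⟩
  have key₄ := key R.bend₃ e.neg R.l₄ R.l₄_pos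
  rw [R.toPt_arrive] at key₄
  obtain ⟨s, t, h⟩ := h
  rcases s with _ | ⟨_, _ | ⟨_, _ | ⟨_, _ | ⟨_, _ | ⟨_, s⟩⟩⟩⟩⟩ <;> simp [path] at h
  · obtain ⟨rfl, rfl, -⟩ := h
    exact key _ _ _ R.l₁_pos
  · obtain ⟨-, rfl, rfl, -⟩ := h
    exact key _ _ _ R.l₂_pos
  · obtain ⟨-, -, rfl, rfl, -⟩ := h
    exact key _ _ _ R.l₃_pos
  · obtain ⟨-, -, -, rfl, rfl, -⟩ := h
    exact key₄

theorem le_angle_move {A B C : ℤ × ℤ × ℤ} {f g : Dir} {l m : ℤ} (hl : 0 < l) (hm : 0 < m)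
    (hB : move A f l = B) (hC : move B g m = C) (hfg : 1 ≤ f.dot g) :
    2 * Real.pi / 3 ≤ angle (toPt A - toPt B) (toPt C - toPt B) := by
  rw [← neg_sub (toPt B) (toPt A), ← hC, toPt_move_sub, ← hB, toPt_move_sub, ← smul_neg,
    ← Dir.vec_neg]
  refine Dir.le_angle ?_ ?_ ?_
  · rw [Dir.dot_neg_left]; omega
  · exact_mod_cast mul_pos hl f.scale_pos
  · exact_mod_cast mul_pos hm g.scale_pos

theorem le_angle_of_triple {a q b : Pt} (h : [a, q, b] <:+: R.path) :
    2 * Real.pi / 3 ≤ angle (a - q) (b - q) := by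
  obtain ⟨s, t, h⟩ := h
  rcases s with _ | ⟨_, _ | ⟨_, _ | ⟨_, _ | ⟨_, _ | ⟨_, s⟩⟩⟩⟩⟩ <;> simp [path] at h
  · obtain ⟨rfl, rfl, rfl, -⟩ := h
    exact le_angle_move R.l₁_pos R.l₂_pos rfl rfl R.dot₁
  · obtain ⟨-, rfl, rfl, rfl, -⟩ := h
    exact le_angle_move R.l₂_pos R.l₃_pos rfl rfl R.dot₂
  · obtain ⟨-, -, rfl, rfl, rfl, -⟩ := h
    exact le_angle_move R.l₃_pos R.l₄_pos rfl R.move_bend₃ R.dot₃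

theorem exists_of_getElem?_one {a : Pt} (h : R.path[1]? = some a) :
    ∃ κ : ℝ, 0 < κ ∧ a - toPt P = κ • d.vec := by
  simp only [path, List.getElem?_cons_succ, List.getElem?_cons_zero, Option.some.injEq] at h
  subst h
  exact ⟨_, by exact_mod_cast mul_pos R.l₁_pos d.scale_pos, toPt_move_sub _ _ _⟩

theorem exists_of_reverse_getElem?_one {a : Pt} (h : R.path.reverse[1]? = some a) :
    ∃ κ : ℝ, 0 < κ ∧ a - toPt Q = κ • e.vec := by
  simp only [path, List.reverse_cons, List.reverse_nil, List.nil_append, List.cons_append,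
    List.getElem?_cons_succ, List.getElem?_cons_zero, Option.some.injEq] at h
  subst h
  refine ⟨((R.l₄ * e.neg.scale : ℤ) : ℝ), by exact_mod_cast mul_pos R.l₄_pos e.neg.scale_pos, ?_⟩
  rw [← neg_sub, ← R.toPt_arrive, toPt_move_sub, Dir.vec_neg, smul_neg, neg_neg]

end Route

/-- Positions of the vertices of a graph, directions in which the edges leave their ends, and
routes for the edges, chosen so that the routes do not interfere with one another. -/
structure Layout (G : SimpleGraph V) (M N : ℤ) where
  rk : V → ℕ
  rk_inj : Function.Injective rk
  pos : V → ℤ × ℤ × ℤ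
  port : V → V → Dir
  col : V → V → ℤ
  margin_nonneg : 0 ≤ M
  row_inj : ∀ u v, (pos u).2.2 = (pos v).2.2 → u = v
  height_far : ∀ u v, u ≠ v → 2 * M < |(pos u).1 - (pos v).1|
  col_inj : ∀ u v u' v', G.Adj u v → G.Adj u' v' → rk u < rk v → rk u' < rk v' →
    col u v = col u' v' → u = u' ∧ v = v'
  port_dot : ∀ v u w, G.Adj v u → G.Adj v w → u ≠ w → (port v u).dot (port v w) ≤ -1
  route : ∀ u v, G.Adj u v → rk u < rk v →
    Route (pos u) (pos v) (port u v) (port v u) (col u v) M N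

namespace Layout

variable {M N : ℤ} (L : Layout G M N)

theorem rk_lt_of_not_lt {u v : V} (h : G.Adj u v) (hr : ¬ L.rk u < L.rk v) : L.rk v < L.rk u :=
  lt_of_le_of_ne (not_lt.1 hr) fun he => h.ne (L.rk_inj he).symm

/-- The polyline of an edge, oriented from its first to its second end. -/
def seq (u v : V) (h : G.Adj u v) : List Pt :=
  if hr : L.rk u < L.rk v then (L.route u v h hr).path
  else (L.route v u h.symm (L.rk_lt_of_not_lt h hr)).path.reverse

theorem seq_of_lt {u v : V} (h : G.Adj u v) (hr : L.rk u < L.rk v) :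
    L.seq u v h = (L.route u v h hr).path := dif_pos hr

theorem seq_of_gt {u v : V} (h : G.Adj u v) (hr : L.rk v < L.rk u) :
    L.seq u v h = (L.route v u h.symm hr).path.reverse := dif_neg hr.not_gt

/-- The drawing given by a layout. -/
def drawing : PolylineDrawing G where
  p v := toPt (L.pos v)
  p_inj u v h := L.row_inj u v (congrArg (fun P => P.2.2) (toPt_injective h))
  seq := L.seq
  seq_head u v h := by
    rcases lt_or_gt_of_ne (L.rk_inj.ne h.ne) with hr | hr
    · rw [L.seq_of_lt h hr]; simp [Route.path]
    · rw [L.seq_of_gt h hr]; simp [Route.path]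
  seq_last u v h := by
    rcases lt_or_gt_of_ne (L.rk_inj.ne h.ne) with hr | hr
    · rw [L.seq_of_lt h hr]; simp [Route.path]
    · rw [L.seq_of_gt h hr]; simp [Route.path]
  seq_symm u v h := by
    rcases lt_or_gt_of_ne (L.rk_inj.ne h.ne) with hr | hr
    · rw [L.seq_of_lt h hr, L.seq_of_gt h.symm hr]
    · rw [L.seq_of_gt h hr, L.seq_of_lt h.symm hr, List.reverse_reverse]

theorem polyImage_seq_of_gt {u v : V} (h : G.Adj u v) (hr : L.rk v < L.rk u) :
    polyImage (L.seq u v h) = polyImage (L.route v u h.symm hr).path := by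
  rw [L.seq_of_gt h hr, Route.polyImage_path_reverse]

/-- A point of an edge lies in the row of one of its ends, near the height of that end, or
in the column of the edge, near the height of an end or in the row of an end. -/
theorem exists_of_mem {u v : V} (h : G.Adj u v) (hr : L.rk u < L.rk v) {x : Pt}
    (hx : x ∈ polyImage (L.route u v h hr).path) :
    (∃ w, (w = u ∨ w = v) ∧ row x = (L.pos w).2.2 ∧ |height x - (L.pos w).1| ≤ M) ∨
    (column x = L.col u v ∧ ∃ w, (w = u ∨ w = v) ∧
      (|height x - (L.pos w).1| ≤ M ∨ row x = (L.pos w).2.2)) := by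
  have A := (L.route u v h hr).allowed_of_mem hx
  rcases A.region with ⟨h1, h2⟩ | ⟨h1, h2⟩ | ⟨h1, h2 | h2 | h2 | h2⟩
  · exact Or.inl ⟨u, Or.inl rfl, h1, h2⟩
  · exact Or.inl ⟨v, Or.inr rfl, h1, h2⟩
  · exact Or.inr ⟨h1, u, Or.inl rfl, Or.inl h2⟩
  · exact Or.inr ⟨h1, v, Or.inr rfl, Or.inl h2⟩
  · exact Or.inr ⟨h1, u, Or.inl rfl, Or.inr h2⟩
  · exact Or.inr ⟨h1, v, Or.inr rfl, Or.inr h2⟩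

/-- A point of an edge in the row of one of its ends is that end or lies in its sector. -/
theorem eq_or_sector {u v : V} (h : G.Adj u v) (hr : L.rk u < L.rk v) {x : Pt}
    (hx : x ∈ polyImage (L.route u v h hr).path) {w : V} (hw : w = u ∨ w = v)
    (hrow : row x = (L.pos w).2.2) :
    x = toPt (L.pos w) ∨ ∃ z, (w = u ∧ z = v ∨ w = v ∧ z = u) ∧
      (L.port w z).Sector (L.pos w).1 (L.pos w).2.1 (height x) (column x) := by
  have A := (L.route u v h hr).allowed_of_mem hx
  rcases hw with rfl | rfl
  · rcases A.left hrow with ⟨h1, h2⟩ | h1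
    · exact Or.inl (pt_ext (by simpa using h1) (by simpa using h2) (by simpa using hrow))
    · exact Or.inr ⟨v, Or.inl ⟨rfl, rfl⟩, h1⟩
  · rcases A.right hrow with ⟨h1, h2⟩ | h1
    · exact Or.inl (pt_ext (by simpa using h1) (by simpa using h2) (by simpa using hrow))
    · exact Or.inr ⟨u, Or.inr ⟨rfl, rfl⟩, h1⟩

theorem eq_of_height_close {w w' : V} {t : ℝ} (h : |t - (L.pos w).1| ≤ M)
    (h' : |t - (L.pos w').1| ≤ M) : w = w' := by
  by_contra hne
  have far : (2 * M : ℝ) < |((L.pos w).1 : ℝ) - (L.pos w').1| := by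
    exact_mod_cast L.height_far w w' hne
  rw [abs_le] at h h'
  rw [lt_abs] at far
  rcases far with far | far <;> linarith [h.1, h.2, h'.1, h'.2]

theorem eq_of_row_eq {w w' : V} {t : ℝ} (h : t = (L.pos w).2.2) (h' : t = (L.pos w').2.2) :
    w = w' :=
  L.row_inj w w' (by exact_mod_cast h.symm.trans h')

theorem polyImage_inter_range {u v : V} (h : G.Adj u v) (hr : L.rk u < L.rk v) :
    polyImage (L.route u v h hr).path ∩ Set.range (fun v => toPt (L.pos v)) =
      {toPt (L.pos u), toPt (L.pos v)} := by
  ext x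
  simp only [Set.mem_inter_iff, Set.mem_range, Set.mem_insert_iff, Set.mem_singleton_iff]
  constructor
  · rintro ⟨hx, w, rfl⟩
    have self : |height (toPt (L.pos w)) - (L.pos w).1| ≤ M := by
      simpa using L.margin_nonneg
    have key : w = u ∨ w = v := by
      rcases L.exists_of_mem h hr hx with ⟨z, hz, h1, -⟩ | ⟨-, z, hz, h1 | h1⟩
      · rwa [L.eq_of_row_eq (row_toPt _) h1]
      · rwa [L.eq_of_height_close self h1]
      · rwa [L.eq_of_row_eq (row_toPt _) h1]
    rcases key with rfl | rfl
    · exact Or.inl rfl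
    · exact Or.inr rfl
  · rintro (rfl | rfl)
    · exact ⟨Route.left_mem _, u, rfl⟩
    · exact ⟨Route.right_mem _, v, rfl⟩

theorem exists_common_end {u v u' v' : V} (h : G.Adj u v) (hr : L.rk u < L.rk v)
    (h' : G.Adj u' v') (hr' : L.rk u' < L.rk v') (hne : ¬ (u = u' ∧ v = v')) {x : Pt}
    (hx : x ∈ polyImage (L.route u v h hr).path)
    (hx' : x ∈ polyImage (L.route u' v' h' hr').path) :
    ∃ w, (w = u ∨ w = v) ∧ (w = u' ∨ w = v') ∧ x = toPt (L.pos w) := by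
  obtain ⟨w, hw, hw', hrow⟩ : ∃ w, (w = u ∨ w = v) ∧ (w = u' ∨ w = v') ∧
      row x = (L.pos w).2.2 := by
    rcases L.exists_of_mem h hr hx with ⟨w, hw, h1, h2⟩ | ⟨hc, w, hw, h1⟩ <;>
    rcases L.exists_of_mem h' hr' hx' with ⟨w', hw', h1', h2'⟩ | ⟨hc', w', hw', h1'⟩
    · obtain rfl := L.eq_of_row_eq h1 h1'
      exact ⟨w, hw, hw', h1⟩
    · rcases h1' with h1' | h1'
      · obtain rfl := L.eq_of_height_close h2 h1'
        exact ⟨w, hw, hw', h1⟩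
      · obtain rfl := L.eq_of_row_eq h1 h1'
        exact ⟨w, hw, hw', h1⟩
    · rcases h1 with h1 | h1
      · obtain rfl := L.eq_of_height_close h1 h2'
        exact ⟨w, hw, hw', h1'⟩
      · obtain rfl := L.eq_of_row_eq h1 h1'
        exact ⟨w, hw, hw', h1⟩
    · exact absurd (L.col_inj u v u' v' h h' hr hr' (by exact_mod_cast hc.symm.trans hc')) hne
  refine ⟨w, hw, hw', ?_⟩
  rcases L.eq_or_sector h hr hx hw hrow with hxw | ⟨z, hz, hs⟩
  · exact hxw
  rcases L.eq_or_sector h' hr' hx' hw' hrow with hxw | ⟨z', hz', hs'⟩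
  · exact hxw
  have hzz : z ≠ z' := by
    rintro rfl
    rcases hz with ⟨rfl, rfl⟩ | ⟨rfl, rfl⟩ <;> rcases hz' with ⟨rfl, rfl⟩ | ⟨rfl, rfl⟩
    · exact hne ⟨rfl, rfl⟩
    · exact absurd hr hr'.not_gt
    · exact absurd hr hr'.not_gt
    · exact hne ⟨rfl, rfl⟩
  have hwz : G.Adj w z := by
    rcases hz with ⟨rfl, rfl⟩ | ⟨rfl, rfl⟩
    exacts [h, h.symm]
  have hwz' : G.Adj w z' := by
    rcases hz' with ⟨rfl, rfl⟩ | ⟨rfl, rfl⟩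
    exacts [h', h'.symm]
  exact absurd hs' (Dir.not_sector_of_sector (L.port_dot w z z' hwz hwz' hzz) hs)

/-- Every edge, in either orientation, occupies the route of its increasing orientation. -/
theorem exists_route_of_adj {u v : V} (h : G.Adj u v) : ∃ a b, ∃ (hab : G.Adj a b)
    (hr : L.rk a < L.rk b), s(u, v) = s(a, b) ∧
    polyImage (L.seq u v h) = polyImage (L.route a b hab hr).path := by
  rcases lt_or_gt_of_ne (L.rk_inj.ne h.ne) with hr | hr
  · exact ⟨u, v, h, hr, rfl, by rw [L.seq_of_lt h hr]⟩
  · exact ⟨v, u, h.symm, hr, Sym2.eq_swap, L.polyImage_seq_of_gt h hr⟩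

theorem pair_eq_of_sym2_eq {α : Type*} {a b c d : α} (h : s(a, b) = s(c, d)) :
    ({a, b} : Set α) = {c, d} := by
  rcases Sym2.eq_iff.1 h with ⟨rfl, rfl⟩ | ⟨rfl, rfl⟩
  · rfl
  · exact Set.pair_comm _ _

theorem nonCrossing : NonCrossing L.drawing := by
  refine ⟨fun u v h => ?_, fun u v h => ?_, fun u v u' v' h h' hne => ?_⟩
  · change SimplePolyline (L.seq u v h)
    rcases lt_or_gt_of_ne (L.rk_inj.ne h.ne) with hr | hr
    · rw [L.seq_of_lt h hr]; exact Route.simplePolyline_path _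
    · rw [L.seq_of_gt h hr]; exact Route.simplePolyline_path_reverse _
  · change polyImage (L.seq u v h) ∩ Set.range (fun v => toPt (L.pos v)) =
      {toPt (L.pos u), toPt (L.pos v)}
    obtain ⟨a, b, hab, hr, he, hi⟩ := L.exists_route_of_adj h
    rw [hi, L.polyImage_inter_range]
    simpa only [Set.image_pair] using congrArg (Set.image fun v => toPt (L.pos v))
      (pair_eq_of_sym2_eq he).symm
  · change polyImage (L.seq u v h) ∩ polyImage (L.seq u' v' h') =
      (fun v => toPt (L.pos v)) '' (({u, v} : Set V) ∩ {u', v'})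
    obtain ⟨a, b, hab, hr, he, hi⟩ := L.exists_route_of_adj h
    obtain ⟨a', b', hab', hr', he', hi'⟩ := L.exists_route_of_adj h'
    rw [hi, hi', pair_eq_of_sym2_eq he, pair_eq_of_sym2_eq he']
    rw [he, he'] at hne
    ext x
    constructor
    · rintro ⟨hx, hx'⟩
      obtain ⟨w, hw, hw', rfl⟩ := L.exists_common_end hab hr hab' hr'
        (fun hh => hne (by rw [hh.1, hh.2])) hx hx'
      exact ⟨w, ⟨hw, hw'⟩, rfl⟩
    · rintro ⟨w, ⟨hw, hw'⟩, rfl⟩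
      constructor
      · rcases hw with rfl | rfl
        exacts [Route.left_mem _, Route.right_mem _]
      · rcases hw' with rfl | rfl
        exacts [Route.left_mem _, Route.right_mem _]

theorem maxBends : MaxBends L.drawing 3 := by
  intro u v h
  change (L.seq u v h).length ≤ 5
  rcases lt_or_gt_of_ne (L.rk_inj.ne h.ne) with hr | hr
  · rw [L.seq_of_lt h hr]; simp [Route.path]
  · rw [L.seq_of_gt h hr]; simp [Route.path]

theorem exists_of_getElem?_one {u v : V} (h : G.Adj u v) {a : Pt}
    (ha : (L.seq u v h)[1]? = some a) :
    ∃ κ : ℝ, 0 < κ ∧ a - toPt (L.pos u) = κ • (L.port u v).vec := by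
  rcases lt_or_gt_of_ne (L.rk_inj.ne h.ne) with hr | hr
  · rw [L.seq_of_lt h hr] at ha
    exact Route.exists_of_getElem?_one _ ha
  · rw [L.seq_of_gt h hr] at ha
    exact Route.exists_of_reverse_getElem?_one _ ha

theorem reverse_isInfix {α : Type*} {l m : List α} (h : l <:+: m.reverse) : l.reverse <:+: m := by
  have := List.reverse_infix.2 h
  rwa [List.reverse_reverse] at this

theorem angularRes : AngularResAtLeast L.drawing (2 * Real.pi / 3) := by
  refine ⟨fun u v h a q b hi => ?_, fun v u w hu hw hne a b ha hb => ?_⟩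
  · change [a, q, b] <:+: L.seq u v h at hi
    rcases lt_or_gt_of_ne (L.rk_inj.ne h.ne) with hr | hr
    · rw [L.seq_of_lt h hr] at hi
      exact Route.le_angle_of_triple _ hi
    · rw [L.seq_of_gt h hr] at hi
      rw [angle_comm]
      exact Route.le_angle_of_triple _ (reverse_isInfix hi)
  · obtain ⟨κ, hκ, ha'⟩ := L.exists_of_getElem?_one hu ha
    obtain ⟨μ, hμ, hb'⟩ := L.exists_of_getElem?_one hw hb
    change 2 * Real.pi / 3 ≤ angle (a - toPt (L.pos v)) (b - toPt (L.pos v))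
    rw [ha', hb']
    exact Dir.le_angle (L.port_dot v u w hu hw hne) hκ hμ

theorem integer_toPt (P : ℤ × ℤ × ℤ) (i : Fin 3) : ∃ m : ℤ, toPt P i = (m : ℝ) := by
  fin_cases i
  · exact ⟨P.1 + P.2.1 - P.2.2, by simp [toPt]⟩
  · exact ⟨P.2.1 - P.2.2 - P.1, by simp [toPt]⟩
  · exact ⟨2 * P.2.1 + 2 * P.2.2, by simp [toPt]⟩

theorem integer_of_mem_seq {u v : V} (h : G.Adj u v) {q : Pt} (hq : q ∈ L.seq u v h)
    (i : Fin 3) : ∃ m : ℤ, q i = (m : ℝ) := by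
  obtain ⟨A, rfl⟩ : ∃ A, q = toPt A := by
    rcases lt_or_gt_of_ne (L.rk_inj.ne h.ne) with hr | hr
    · rw [L.seq_of_lt h hr] at hq
      exact Route.exists_eq_toPt _ hq
    · rw [L.seq_of_gt h hr, List.mem_reverse] at hq
      exact Route.exists_eq_toPt _ hq
  exact integer_toPt A i

theorem diagonal_of_consecutive {u v : V} (h : G.Adj u v) {a b : Pt}
    (hi : [a, b] <:+: L.seq u v h) :
    ∃ k : ℝ, k ≠ 0 ∧ ∃ d : Fin 3 → ℝ,
      (∃ j : Fin 3, d j = 0 ∧ ∀ i : Fin 3, i ≠ j → (d i = 1 ∨ d i = -1)) ∧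
      ∀ i : Fin 3, b i - a i = k * d i := by
  obtain ⟨k, hk, f, hf⟩ : ∃ k : ℝ, k ≠ 0 ∧ ∃ f : Dir, b - a = k • f.vec := by
    rcases lt_or_gt_of_ne (L.rk_inj.ne h.ne) with hr | hr
    · rw [L.seq_of_lt h hr] at hi
      obtain ⟨κ, hκ, f, hf⟩ := Route.exists_of_consecutive _ hi
      exact ⟨κ, hκ.ne', f, hf⟩
    · rw [L.seq_of_gt h hr] at hi
      obtain ⟨κ, hκ, f, hf⟩ := Route.exists_of_consecutive _ (reverse_isInfix hi)
      exact ⟨-κ, neg_ne_zero.2 hκ.ne', f, by rw [neg_smul, ← hf, neg_sub]⟩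
  exact ⟨k, hk, f.vec, f.vec_isDiagonal, fun i => congrArg (fun x : Pt => x i) hf⟩

theorem abs_le_of_adapted {x : Pt} {N : ℝ} (h₁ : |height x| ≤ N) (h₂ : |column x| ≤ N)
    (h₃ : |row x| ≤ N) (i : Fin 3) : -(4 * N) ≤ x i ∧ x i ≤ 4 * N := by
  rw [abs_le] at h₁ h₂ h₃
  simp only [height, column, row, LinearMap.coe_mk, AddHom.coe_mk] at h₁ h₂ h₃
  fin_cases i <;> simp <;> constructor <;> linarith [h₁.1, h₁.2, h₂.1, h₂.2, h₃.1, h₃.2]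

theorem abs_le_of_mem (hpos : ∀ v, |(L.pos v).1| ≤ N ∧ |(L.pos v).2.1| ≤ N ∧ |(L.pos v).2.2| ≤ N)
    {x : Pt} (hx : x ∈ drawingImage L.drawing) (i : Fin 3) :
    -(4 * N : ℝ) ≤ x i ∧ x i ≤ 4 * N := by
  rcases hx with ⟨v, rfl⟩ | hx
  · change -(4 * N : ℝ) ≤ toPt (L.pos v) i ∧ toPt (L.pos v) i ≤ 4 * N
    obtain ⟨h1, h2, h3⟩ := hpos v
    refine abs_le_of_adapted ?_ ?_ ?_ i
    · rw [height_toPt]; exact_mod_cast h1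
    · rw [column_toPt]; exact_mod_cast h2
    · rw [row_toPt]; exact_mod_cast h3
  · simp only [Set.mem_iUnion] at hx
    obtain ⟨u, v, h, hx⟩ := hx
    change x ∈ polyImage (L.seq u v h) at hx
    obtain ⟨a, b, hab, hr, -, hi⟩ := L.exists_route_of_adj h
    rw [hi] at hx
    have A := Route.allowed_of_mem _ hx
    exact abs_le_of_adapted A.height_le A.column_le A.row_le i

end Layout

/-- A union of two matchings is bipartite. -/
theorem exists_two_coloring {E : Type*} [Finite E] (S : E → E → Prop) (hS : ∀ a b, S a b → S b a)
    (hS' : ∀ a, ¬ S a a) (hS'' : ∀ a b c, S a b → S a c → b = c) (R : E → E → Prop)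
    (hR : ∀ a b, R a b → R b a) (hR' : ∀ a, ¬ R a a) (hR'' : ∀ a b c, R a b → R a c → b = c) :
    ∃ χ : E → Bool, ∀ a b, R a b ∨ S a b → χ a ≠ χ b := by
  classical
  induction hk : {p : E × E | R p.1 p.2}.ncard using Nat.strong_induction_on generalizing R S with
  | _ k ih =>
  subst hk
  by_cases hne : ∃ a b, R a b
  · obtain ⟨a, b, hab⟩ := hne
    have hab' : a ≠ b := by rintro rfl; exact hR' _ hab
    let S' : E → E → Prop := fun x y => (x ≠ a ∧ x ≠ b ∧ y ≠ a ∧ y ≠ b) ∧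
      (S x y ∨ (S a x ∧ S b y) ∨ (S b x ∧ S a y))
    let R' : E → E → Prop := fun x y => (x ≠ a ∧ x ≠ b) ∧ R x y
    have hlt : {p : E × E | R' p.1 p.2}.ncard < {p : E × E | R p.1 p.2}.ncard := by
      apply Set.ncard_lt_ncard _ (Set.toFinite _)
      refine ⟨fun p hp => hp.2, fun hsub => ?_⟩
      exact (hsub (show (a, b) ∈ {p : E × E | R p.1 p.2} from hab)).1.1 rfl
    obtain ⟨χ, hχ⟩ := ih _ hlt S' (by grind) (by grind) (by grind) R' (by grind) (by grind)
      (by grind) rfl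
    let va : Bool := if h : ∃ x, x ≠ a ∧ x ≠ b ∧ S a x then !χ h.choose else
      if h : ∃ y, y ≠ a ∧ y ≠ b ∧ S b y then χ h.choose else true
    have ha : ∀ x, x ≠ a → x ≠ b → S a x → va = !χ x := by
      intro x hxa hxb hx
      have h : ∃ x, x ≠ a ∧ x ≠ b ∧ S a x := ⟨x, hxa, hxb, hx⟩
      have he : h.choose = x := hS'' a _ _ h.choose_spec.2.2 hx
      simp only [va, dif_pos h, he]
    have hb : ∀ y, y ≠ a → y ≠ b → S b y → va = χ y := by
      intro y hya hyb hy
      by_cases h : ∃ x, x ≠ a ∧ x ≠ b ∧ S a x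
      · obtain ⟨x, hxa, hxb, hx⟩ := h
        have := hχ x y (Or.inr ⟨⟨hxa, hxb, hya, hyb⟩, Or.inr (Or.inl ⟨hx, hy⟩)⟩)
        rw [ha x hxa hxb hx]
        revert this
        cases χ x <;> cases χ y <;> simp
      · have h' : ∃ y, y ≠ a ∧ y ≠ b ∧ S b y := ⟨y, hya, hyb, hy⟩
        have he : h'.choose = y := hS'' b _ _ h'.choose_spec.2.2 hy
        simp only [va, dif_neg h, dif_pos h', he]
    refine ⟨fun x => if x = a then va else if x = b then !va else χ x, fun x y hxy => ?_⟩
    clear_value va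
    grind
  · push Not at hne
    let _ : LinearOrder E := linearOrderOfSTO WellOrderingRel
    refine ⟨fun x => decide (∃ y, S x y ∧ x < y), fun x y hxy => ?_⟩
    rcases hxy with hxy | hxy
    · exact absurd hxy (hne x y)
    intro h
    rw [decide_eq_decide] at h
    rcases lt_trichotomy x y with hlt | rfl | hlt
    · obtain ⟨z, hz, hyz⟩ := h.1 ⟨y, hxy, hlt⟩
      obtain rfl := hS'' y _ _ (hS _ _ hxy) hz
      exact lt_asymm hlt hyz
    · exact hS' _ hxy
    · obtain ⟨z, hz, hyz⟩ := h.2 ⟨x, hS _ _ hxy, hlt⟩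
      obtain rfl := hS'' x _ _ hxy hz
      exact lt_asymm hlt hyz

/-- The vertices of degree three all of whose neighbours lie on the same side in an ordering. -/
def oneSided (G : SimpleGraph V) [Fintype V] [DecidableRel G.Adj] (r : V → ℤ) : Set V :=
  {v | G.degree v = 3 ∧ ((∀ w, G.Adj v w → r v < r w) ∨ ∀ w, G.Adj v w → r w < r v)}

theorem oneSided_neg (G : SimpleGraph V) [Fintype V] [DecidableRel G.Adj] (r : V → ℤ) :
    oneSided G (fun v => -r v) = oneSided G r := by
  ext v
  simp only [oneSided, Set.mem_ofPred_eq, neg_lt_neg_iff]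
  exact and_congr_right fun _ => or_comm

/-- In an ordering with the fewest one-sided vertices, every sink of degree three has a neighbour
of degree three with no other later neighbour. -/
theorem exists_helper_of_minimal [Fintype V] [DecidableEq V] [DecidableRel G.Adj] {r : V → ℤ}
    (hr : Function.Injective r) (hmin : ∀ r' : V → ℤ, Function.Injective r' →
      (oneSided G r).ncard ≤ (oneSided G r').ncard) {v : V} (hv : G.degree v = 3)
    (hsink : ∀ w, G.Adj v w → r w < r v) :
    ∃ h, G.Adj v h ∧ G.degree h = 3 ∧ ∀ w, G.Adj h w → r h < r w → w = v := by
  have hne : (G.neighborFinset v).Nonempty := by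
    rw [← Finset.card_pos, G.card_neighborFinset_eq_degree]; omega
  obtain ⟨h, hh, hmax⟩ := Finset.exists_max_image _ r hne
  simp only [SimpleGraph.mem_neighborFinset] at hh hmax
  by_contra hcon
  push Not at hcon
  have hcon' := hcon h hh
  obtain ⟨w₀, hw₀, hw₀h⟩ : ∃ w, G.Adj v w ∧ w ≠ h := by
    obtain ⟨w, hw, hwh⟩ := Finset.exists_mem_ne
      (by rw [G.card_neighborFinset_eq_degree]; omega : 1 < (G.neighborFinset v).card) h
    exact ⟨w, by simpa using hw, hwh⟩
  have hmax' : ∀ w, G.Adj v w → w ≠ h → r w < r h := fun w hw hwh =>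
    lt_of_le_of_ne (hmax w hw) (hr.ne hwh)
  let r' : V → ℤ := fun w => if w = v then 2 * r h - 1 else 2 * r w
  have r'v : r' v = 2 * r h - 1 := if_pos rfl
  have r'ne : ∀ w, w ≠ v → r' w = 2 * r w := fun w hw => if_neg hw
  have hr' : Function.Injective r' := by
    intro a b hab
    by_cases ha : a = v <;> by_cases hb : b = v
    · rw [ha, hb]
    · rw [ha, r'v, r'ne b hb] at hab; omega
    · rw [hb, r'v, r'ne a ha] at hab; omega
    · rw [r'ne a ha, r'ne b hb] at hab
      exact hr (by omega)
  clear_value r'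
  refine absurd (hmin r' hr') (not_le.2 (Set.ncard_lt_ncard ⟨fun x hx => ?_, fun hsub => ?_⟩))
  · have hxv : x ≠ v := by
      rintro rfl
      rcases hx.2 with h1 | h1
      · have := h1 w₀ hw₀
        rw [r'v, r'ne w₀ hw₀.ne'] at this
        have := hmax' w₀ hw₀ hw₀h
        omega
      · have := h1 h hh
        rw [r'v, r'ne h hh.ne'] at this
        omega
    by_cases hxh : x = h
    · subst hxh
      exfalso
      rcases hx.2 with h1 | h1
      · have := h1 v hh.symm
        rw [r'v, r'ne x hxv] at this
        omega
      · obtain ⟨w, hw, hlt, hwv⟩ := hcon' hx.1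
        have := h1 w hw
        rw [r'ne w hwv, r'ne x hxv] at this
        omega
    · have same : ∀ w, G.Adj x w → (r' x < r' w ↔ r x < r w) ∧ (r' w < r' x ↔ r w < r x) := by
        intro w hw
        by_cases hwv : w = v
        · subst hwv
          rw [r'v, r'ne x hxv]
          have h1 := hmax' x hw.symm hxh
          have h2 := hsink x hw.symm
          omega
        · rw [r'ne x hxv, r'ne w hwv]
          omega
      exact ⟨hx.1, hx.2.imp (fun H w hw => (same w hw).1.1 (H w hw))
        fun H w hw => (same w hw).2.1 (H w hw)⟩
  · rcases (hsub ⟨hv, Or.inr hsink⟩ : v ∈ oneSided G r').2 with h1 | h1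
    · have := h1 w₀ hw₀
      rw [r'v, r'ne w₀ hw₀.ne'] at this
      have := hmax' w₀ hw₀ hw₀h
      omega
    · have := h1 h hh
      rw [r'v, r'ne h hh.ne'] at this
      omega

theorem exists_rank_order [Fintype V] (r : V → ℤ) (hr : Function.Injective r) :
    ∃ k : V → ℕ, Function.Injective k ∧ (∀ v, k v < Fintype.card V) ∧
      ∀ u v, k u < k v ↔ r u < r v := by
  classical
  let k : V → ℕ := fun v => (Finset.univ.filter fun u => r u < r v).card
  have mono : ∀ u v, r u < r v → k u < k v := by
    intro u v huv
    apply Finset.card_lt_card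
    refine ⟨fun w hw => ?_, fun hsub => ?_⟩
    · simp only [Finset.mem_filter, Finset.mem_univ, true_and] at hw ⊢
      exact hw.trans huv
    · have := hsub (Finset.mem_filter.2 ⟨Finset.mem_univ u, huv⟩)
      simp at this
  have hiff : ∀ u v, k u < k v ↔ r u < r v := by
    refine fun u v => ⟨fun h => ?_, mono u v⟩
    rcases lt_trichotomy (r u) (r v) with h1 | h1 | h1
    · exact h1
    · rw [hr h1] at h; exact absurd h (lt_irrefl _)
    · exact absurd (mono _ _ h1) h.not_gt
  refine ⟨k, fun u v huv => ?_, fun v => ?_, hiff⟩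
  · rcases lt_trichotomy (r u) (r v) with h1 | h1 | h1
    · exact absurd huv (mono _ _ h1).ne
    · exact hr h1
    · exact absurd huv (mono _ _ h1).ne'
  · apply Finset.card_lt_card
    refine ⟨Finset.subset_univ _, fun hsub => ?_⟩
    have := hsub (Finset.mem_univ v)
    simp at this

/-- There is a vertex ordering in which every sink or source of degree three has a suitable
neighbour. -/
theorem exists_order [Fintype V] [DecidableEq V] (G : SimpleGraph V) [DecidableRel G.Adj] :
    ∃ k : V → ℕ, Function.Injective k ∧ (∀ v, k v < Fintype.card V) ∧
      (∀ v, G.degree v = 3 → (∀ w, G.Adj v w → k v < k w) →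
        ∃ h, G.Adj v h ∧ G.degree h = 3 ∧ ∀ w, G.Adj h w → k w < k h → w = v) ∧
      (∀ v, G.degree v = 3 → (∀ w, G.Adj v w → k w < k v) →
        ∃ h, G.Adj v h ∧ G.degree h = 3 ∧ ∀ w, G.Adj h w → k h < k w → w = v) := by
  classical
  have hex : ∃ m, ∃ r : V → ℤ, Function.Injective r ∧ (oneSided G r).ncard = m :=
    ⟨_, fun v => (Fintype.equivFin V v : ℕ),
      fun a b h => (Fintype.equivFin V).injective (Fin.ext (Nat.cast_injective (R := ℤ) h)), rfl⟩
  obtain ⟨r, hr, hm⟩ := Nat.find_spec hex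
  have hmin : ∀ r' : V → ℤ, Function.Injective r' →
      (oneSided G r).ncard ≤ (oneSided G r').ncard := fun r' hr' => by
    rw [hm]; exact Nat.find_min' hex ⟨r', hr', rfl⟩
  obtain ⟨k, hk, hlt, hiff⟩ := exists_rank_order r hr
  refine ⟨k, hk, hlt, fun v hv hsource => ?_, fun v hv hsink => ?_⟩
  · simp only [hiff] at hsource ⊢
    have := exists_helper_of_minimal (G := G) (r := fun v => -r v) (v := v)
      (fun a b h => hr (neg_injective h)) (by rw [oneSided_neg]; exact hmin) hv
      (fun w hw => neg_lt_neg (hsource w hw))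
    simpa only [neg_lt_neg_iff] using this
  · simp only [hiff] at hsink ⊢
    exact exists_helper_of_minimal hr hmin hv hsink

/-- An ordering of the vertices of a graph of maximum degree three, a partition of the
vertices into early ones (with at most one earlier neighbour) and late ones (with at most one
later neighbour), a signing of the edges, and helpers of the sources and sinks of degree three. -/
structure Scheme (G : SimpleGraph V) (n : ℕ) where
  rk : V → ℕ
  rk_inj : Function.Injective rk
  rk_lt : ∀ v, rk v < n
  Early : V → Prop
  SourceHelper : V → V → Prop
  SinkHelper : V → V → Prop
  sign : V → V → ℤ
  sign_eq : ∀ u v, sign u v = 1 ∨ sign u v = -1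
  back_unique : ∀ v, Early v → ∀ u u', G.Adj u v → G.Adj u' v → rk u < rk v → rk u' < rk v → u = u'
  fwd_unique : ∀ v, ¬ Early v → ∀ w w', G.Adj v w → G.Adj v w' → rk v < rk w → rk v < rk w' → w = w'
  source_spec : ∀ u v, SourceHelper u v → G.Adj u v ∧ rk u < rk v ∧ Early u ∧ Early v ∧
    ∀ w, G.Adj u w → rk u < rk w
  source_unique : ∀ u v v', SourceHelper u v → SourceHelper u v' → v = v'
  sink_spec : ∀ u v, SinkHelper u v → G.Adj u v ∧ rk u < rk v ∧ ¬ Early u ∧ ¬ Early v ∧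
    ∀ w, G.Adj v w → rk w < rk v
  sink_unique : ∀ u u' v, SinkHelper u v → SinkHelper u' v → u = u'
  sign_left : ∀ u v w, G.Adj u v → G.Adj u w → rk u < rk v → rk u < rk w → v ≠ w →
    ¬ SourceHelper u v → ¬ SourceHelper u w → sign u v ≠ sign u w
  sign_right : ∀ u v w, G.Adj u w → G.Adj v w → rk u < rk w → rk v < rk w → u ≠ v →
    ¬ SinkHelper u w → ¬ SinkHelper v w → sign u w ≠ sign v w

theorem degree_eq_three [Fintype V] [DecidableEq V] [DecidableRel G.Adj]
    (hG : ∀ v, G.degree v ≤ 3) {v a b c : V} (ha : G.Adj v a) (hb : G.Adj v b) (hc : G.Adj v c)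
    (hab : a ≠ b) (hac : a ≠ c) (hbc : b ≠ c) :
    G.degree v = 3 ∧ ∀ w, G.Adj v w → w = a ∨ w = b ∨ w = c := by
  have hsub : ({a, b, c} : Finset V) ⊆ G.neighborFinset v := by
    intro x hx
    simp only [Finset.mem_insert, Finset.mem_singleton] at hx
    rw [SimpleGraph.mem_neighborFinset]
    rcases hx with rfl | rfl | rfl <;> assumption
  have hcard : ({a, b, c} : Finset V).card = 3 :=
    Finset.card_eq_three.2 ⟨a, b, c, hab, hac, hbc, rfl⟩
  have hle := hG v
  rw [← G.card_neighborFinset_eq_degree] at hle ⊢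
  have heq := Finset.eq_of_subset_of_card_le hsub (by rw [hcard]; exact hle)
  refine ⟨by rw [← heq, hcard], fun w hw => ?_⟩
  rw [← SimpleGraph.mem_neighborFinset, ← heq] at hw
  simpa using hw

theorem exists_scheme [Fintype V] [DecidableEq V] [DecidableRel G.Adj]
    (hG : ∀ v, G.degree v ≤ 3) : Nonempty (Scheme G (Fintype.card V)) := by
  classical
  obtain ⟨rk, rk_inj, rk_lt, hsource, hsink⟩ := exists_order G
  choose! hS hS₁ hS₂ hS₃ using hsource
  choose! hZ hZ₁ hZ₂ hZ₃ using hsink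
  let Early : V → Prop := fun v => ∀ u u', G.Adj u v → G.Adj u' v → rk u < rk v → rk u' < rk v →
    u = u'
  let SH : V → V → Prop := fun u v => (G.degree u = 3 ∧ ∀ w, G.Adj u w → rk u < rk w) ∧ v = hS u
  let HZ : V → V → Prop := fun u v => (G.degree v = 3 ∧ ∀ w, G.Adj v w → rk w < rk v) ∧ u = hZ v
  have two_back : ∀ v, ¬ Early v → ∃ a b, a ≠ b ∧ G.Adj v a ∧ G.Adj v b ∧ rk a < rk v ∧
      rk b < rk v := by
    intro v hv
    simp only [Early] at hv
    push Not at hv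
    obtain ⟨a, b, ha, hb, ha', hb', hab⟩ := hv
    exact ⟨a, b, hab, ha.symm, hb.symm, ha', hb'⟩
  have three : ∀ v, G.degree v = 3 → ∃ a b c, G.Adj v a ∧ G.Adj v b ∧ G.Adj v c ∧
      a ≠ b ∧ a ≠ c ∧ b ≠ c := by
    intro v hv
    rw [← G.card_neighborFinset_eq_degree] at hv
    obtain ⟨a, b, c, hab, hac, hbc, h⟩ := Finset.card_eq_three.1 hv
    refine ⟨a, b, c, ?_, ?_, ?_, hab, hac, hbc⟩ <;>
      rw [← SimpleGraph.mem_neighborFinset, h] <;> simp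
  let Fwd : V × V → Prop := fun e => G.Adj e.1 e.2 ∧ rk e.1 < rk e.2
  let R : V × V → V × V → Prop := fun e f => Fwd e ∧ Fwd f ∧ ¬ SH e.1 e.2 ∧ ¬ SH f.1 f.2 ∧
    e.1 = f.1 ∧ e.2 ≠ f.2
  let S : V × V → V × V → Prop := fun e f => Fwd e ∧ Fwd f ∧ ¬ HZ e.1 e.2 ∧ ¬ HZ f.1 f.2 ∧
    e.2 = f.2 ∧ e.1 ≠ f.1
  obtain ⟨χ, hχ⟩ := exists_two_coloring S
    (fun a b ⟨h1, h2, h3, h4, h5, h6⟩ => ⟨h2, h1, h4, h3, h5.symm, h6.symm⟩)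
    (fun a h => h.2.2.2.2.2 rfl) (by
      rintro ⟨u, v⟩ ⟨u', v'⟩ ⟨u'', v''⟩ ⟨⟨h1, h1'⟩, ⟨h2, h2'⟩, h3, h4, h5, h6⟩
        ⟨-, ⟨h2'', h2'''⟩, -, h4', h5', h6'⟩
      simp only at *
      subst h5 h5'
      by_contra hne
      have hne' : u' ≠ u'' := fun h => hne (by rw [h])
      obtain ⟨hd, hall⟩ := degree_eq_three hG h1.symm h2.symm h2''.symm h6 h6' hne'
      have hz : G.degree v = 3 ∧ ∀ w, G.Adj v w → rk w < rk v :=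
        ⟨hd, fun w hw => by rcases hall w hw with rfl | rfl | rfl <;> assumption⟩
      rcases hall _ (hZ₁ v hz.1 hz.2) with h | h | h
      · exact h3 ⟨hz, h.symm⟩
      · exact h4 ⟨hz, h.symm⟩
      · exact h4' ⟨hz, h.symm⟩)
    R (fun a b ⟨h1, h2, h3, h4, h5, h6⟩ => ⟨h2, h1, h4, h3, h5.symm, h6.symm⟩)
    (fun a h => h.2.2.2.2.2 rfl) (by
      rintro ⟨u, v⟩ ⟨u', v'⟩ ⟨u'', v''⟩ ⟨⟨h1, h1'⟩, ⟨h2, h2'⟩, h3, h4, h5, h6⟩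
        ⟨-, ⟨h2'', h2'''⟩, -, h4', h5', h6'⟩
      simp only at *
      subst h5 h5'
      by_contra hne
      have hne' : v' ≠ v'' := fun h => hne (by rw [h])
      obtain ⟨hd, hall⟩ := degree_eq_three hG h1 h2 h2'' h6 h6' hne'
      have hs : G.degree u = 3 ∧ ∀ w, G.Adj u w → rk u < rk w :=
        ⟨hd, fun w hw => by rcases hall w hw with rfl | rfl | rfl <;> assumption⟩
      rcases hall _ (hS₁ u hs.1 hs.2) with h | h | h
      · exact h3 ⟨hs, h.symm⟩
      · exact h4 ⟨hs, h.symm⟩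
      · exact h4' ⟨hs, h.symm⟩)
  have sign_ne : ∀ a b : Bool, a ≠ b → (if a then (1 : ℤ) else -1) ≠ if b then 1 else -1 := by
    decide
  refine ⟨⟨rk, rk_inj, rk_lt, Early, SH, HZ, fun u v => if χ (u, v) then 1 else -1,
    fun u v => by cases χ (u, v) <;> simp, fun v hv => hv, ?_, ?_, ?_, ?_, ?_, ?_, ?_⟩⟩
  · intro v hv w w' hw hw' hlt hlt'
    obtain ⟨a, b, hab, ha, hb, ha', hb'⟩ := two_back v hv
    have hne : ∀ x y, rk x < rk v → rk v < rk y → x ≠ y := fun x y h1 h2 h => by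
      rw [h] at h1; exact lt_asymm h1 h2
    rcases (degree_eq_three hG ha hb hw hab (hne _ _ ha' hlt) (hne _ _ hb' hlt)).2 w' hw' with
      h | h | h
    · exact absurd h.symm (hne _ _ ha' hlt')
    · exact absurd h.symm (hne _ _ hb' hlt')
    · exact h.symm
  · rintro u v ⟨hu, rfl⟩
    refine ⟨hS₁ u hu.1 hu.2, hu.2 _ (hS₁ u hu.1 hu.2), fun a b ha _ hlt _ => ?_, ?_, hu.2⟩
    · exact absurd (hu.2 a ha.symm) hlt.not_gt
    · intro a b ha hb ha' hb'
      rw [hS₃ u hu.1 hu.2 a ha.symm ha', hS₃ u hu.1 hu.2 b hb.symm hb']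
  · rintro u v v' ⟨-, rfl⟩ ⟨-, rfl⟩
    rfl
  · rintro u v ⟨hv, rfl⟩
    have late : ∀ x, G.degree x = 3 → (∃ z, ∀ w, G.Adj x w → rk x < rk w → w = z) →
        ¬ Early x := by
      rintro x hx ⟨z, hz⟩ hearly
      obtain ⟨a, b, c, ha, hb, hc, hab, hac, hbc⟩ := three x hx
      have side : ∀ y, G.Adj x y → y ≠ z → rk y < rk x := fun y hy hyz =>
        lt_of_le_of_ne (not_lt.1 fun h => hyz (hz y hy h)) (rk_inj.ne hy.ne')
      have pair : ∀ y y', G.Adj x y → G.Adj x y' → y ≠ y' → y = z ∨ y' = z := by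
        intro y y' hy hy' hyy
        by_contra! h
        exact hyy (hearly y y' hy.symm hy'.symm (side y hy h.1) (side y' hy' h.2))
      have h1 := pair a b ha hb hab
      have h2 := pair a c ha hc hac
      have h3 := pair b c hb hc hbc
      grind
    refine ⟨(hZ₁ v hv.1 hv.2).symm, hv.2 _ (hZ₁ v hv.1 hv.2),
      late _ (hZ₂ v hv.1 hv.2) ⟨v, hZ₃ v hv.1 hv.2⟩,
      late v hv.1 ⟨v, fun w hw hlt => absurd (hv.2 w hw) hlt.not_gt⟩, hv.2⟩
  · rintro u u' v ⟨-, rfl⟩ ⟨-, rfl⟩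
    rfl
  · intro u v w hv hw hv' hw' hne h1 h2
    exact sign_ne _ _ (hχ (u, v) (u, w) (Or.inl ⟨⟨hv, hv'⟩, ⟨hw, hw'⟩, h1, h2, rfl, hne⟩))
  · intro u v w hu hv hu' hv' hne h1 h2
    exact sign_ne _ _ (hχ (u, w) (v, w) (Or.inr ⟨⟨hu, hu'⟩, ⟨hv, hv'⟩, h1, h2, rfl, hne⟩))

namespace Scheme

open Classical in
/-- The vertex whose block of rows and whose column a vertex shares. -/
def block {n : ℕ} (T : Scheme G n) (v : V) : V :=
  if h : ∃ u, T.SourceHelper u v then h.choose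
  else if h : ∃ z, T.SinkHelper v z then h.choose else v

open Classical in
/-- The distance of a block from the central column. -/
def dist {n : ℕ} (T : Scheme G n) (v : V) : ℤ :=
  if T.Early v then T.rk v + 1 else 2 * n - T.rk v

open Classical in
/-- The side of the central column on which a block lies. -/
def side {n : ℕ} (T : Scheme G n) (v : V) : ℤ :=
  if T.Early v then
    if h : ∃ u, G.Adj u v ∧ T.rk u < T.rk v then T.sign h.choose v else 1
  else if h : ∃ w, G.Adj v w ∧ T.rk v < T.rk w then T.sign v h.choose else 1

/-- The column of a block. -/
def blockColumn {n : ℕ} (T : Scheme G n) (v : V) : ℤ := T.side v * T.dist v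

open Classical in
/-- The position of a row within its block. -/
def offset {n : ℕ} (T : Scheme G n) (v : V) : ℤ :=
  if (∃ u, T.SourceHelper u v) ∨ ∃ z, T.SinkHelper z v then 2 else 0

/-- The column of a vertex. -/
def vcol {n : ℕ} (T : Scheme G n) (v : V) : ℤ := T.blockColumn (T.block v)

/-- The row of a vertex. -/
def vrow {n : ℕ} (T : Scheme G n) (v : V) : ℤ := 3 * T.blockColumn (T.block v) + T.offset v

variable {n : ℕ} (T : Scheme G n)

theorem block_of_sourceHelper {u v : V} (h : T.SourceHelper u v) : T.block v = u := by
  have hex : ∃ u, T.SourceHelper u v := ⟨u, h⟩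
  have hu := T.source_spec _ _ h
  have hc := T.source_spec _ _ hex.choose_spec
  rw [block, dif_pos hex]
  exact T.back_unique v hu.2.2.2.1 _ _ hc.1 hu.1 hc.2.1 hu.2.1

theorem block_of_sinkHelper {v z : V} (h : T.SinkHelper v z) : T.block v = z := by
  have hex : ∃ z, T.SinkHelper v z := ⟨z, h⟩
  have hz := T.sink_spec _ _ h
  have hc := T.sink_spec _ _ hex.choose_spec
  have hno : ¬ ∃ u, T.SourceHelper u v := fun ⟨u, hu⟩ => hz.2.2.1 (T.source_spec _ _ hu).2.2.2.1
  rw [block, dif_neg hno, dif_pos hex]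
  exact T.fwd_unique v hz.2.2.1 _ _ hc.1 hz.1 hc.2.1 hz.2.1

theorem block_of_not {v : V} (h₁ : ∀ u, ¬ T.SourceHelper u v) (h₂ : ∀ z, ¬ T.SinkHelper v z) :
    T.block v = v := by
  rw [block, dif_neg (not_exists.2 h₁), dif_neg (not_exists.2 h₂)]

theorem block_cases (v : V) : T.SourceHelper (T.block v) v ∨ T.SinkHelper v (T.block v) ∨
    T.block v = v := by
  by_cases h₁ : ∃ u, T.SourceHelper u v
  · obtain ⟨u, h⟩ := h₁
    exact Or.inl (by rwa [T.block_of_sourceHelper h])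
  by_cases h₂ : ∃ z, T.SinkHelper v z
  · obtain ⟨z, h⟩ := h₂
    exact Or.inr (Or.inl (by rwa [T.block_of_sinkHelper h]))
  exact Or.inr (Or.inr (T.block_of_not (not_exists.1 h₁) (not_exists.1 h₂)))

/-- A source with a helper is alone in its block with the helper. -/
theorem source_facts {u v : V} (h : T.SourceHelper u v) : T.block u = u ∧ T.offset u = 0 ∧
    T.block v = u ∧ T.offset v = 2 := by
  have hu := T.source_spec _ _ h
  have h₁ : ∀ w, ¬ T.SourceHelper w u := fun w hw => by
    have := T.source_spec _ _ hw
    exact lt_asymm this.2.1 (hu.2.2.2.2 w this.1.symm)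
  refine ⟨T.block_of_not h₁ fun z hz => (T.sink_spec _ _ hz).2.2.1 hu.2.2.1, ?_,
    T.block_of_sourceHelper h, if_pos (Or.inl ⟨u, h⟩)⟩
  exact if_neg (not_or.2 ⟨not_exists.2 h₁, fun ⟨z, hz⟩ => (T.sink_spec _ _ hz).2.2.2.1 hu.2.2.1⟩)

/-- A sink with a helper is alone in its block with the helper. -/
theorem sink_facts {u v : V} (h : T.SinkHelper u v) : T.block v = v ∧ T.offset v = 2 ∧
    T.block u = v ∧ T.offset u = 0 := by
  have hv := T.sink_spec _ _ h
  refine ⟨T.block_of_not (fun w hw => hv.2.2.2.1 (T.source_spec _ _ hw).2.2.2.1) fun z hz => ?_,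
    if_pos (Or.inr ⟨u, h⟩), T.block_of_sinkHelper h, if_neg (not_or.2 ⟨?_, ?_⟩)⟩
  · have := T.sink_spec _ _ hz
    exact lt_asymm this.2.1 (hv.2.2.2.2 z this.1)
  · rintro ⟨w, hw⟩
    exact hv.2.2.1 (T.source_spec _ _ hw).2.2.2.1
  · rintro ⟨z, hz⟩
    have := T.sink_spec _ _ hz
    exact lt_asymm hv.2.1 (this.2.2.2.2 v hv.1)

theorem offset_eq (v : V) : T.offset v = 0 ∨ T.offset v = 2 := by
  unfold offset
  split_ifs <;> simp

theorem side_eq (v : V) : T.side v = 1 ∨ T.side v = -1 := by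
  unfold side
  split_ifs <;> first | exact T.sign_eq _ _ | exact Or.inl rfl

theorem dist_pos (v : V) : 0 < T.dist v ∧ T.dist v ≤ 2 * n := by
  have := T.rk_lt v
  unfold dist
  split_ifs <;> omega

theorem dist_inj {u v : V} (h : T.dist u = T.dist v) : u = v := by
  have hu := T.rk_lt u
  have hv := T.rk_lt v
  apply T.rk_inj
  unfold dist at h
  split_ifs at h <;> omega

theorem abs_blockColumn (v : V) : |T.blockColumn v| = T.dist v := by
  have := T.dist_pos v
  unfold blockColumn
  rcases T.side_eq v with h | h <;> rw [h]
  · rw [one_mul, abs_of_pos this.1]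
  · rw [neg_one_mul, abs_neg, abs_of_pos this.1]

theorem blockColumn_inj {u v : V} (h : T.blockColumn u = T.blockColumn v) : u = v :=
  T.dist_inj (by rw [← abs_blockColumn, ← abs_blockColumn, h])

theorem abs_vcol_le (v : V) : |T.vcol v| ≤ 2 * n := by
  rw [vcol, abs_blockColumn]
  exact (T.dist_pos _).2

theorem abs_vrow_le (v : V) : |T.vrow v| ≤ 6 * n + 2 := by
  have h := abs_le.1 (T.abs_vcol_le v)
  have h' := T.offset_eq v
  rw [vcol] at h
  rw [vrow, abs_le]
  omega

theorem vrow_inj {u v : V} (h : T.vrow u = T.vrow v) : u = v := by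
  have hu := T.offset_eq u
  have hv := T.offset_eq v
  unfold vrow at h
  have ho : T.offset u = T.offset v := by omega
  have hb : T.block u = T.block v := T.blockColumn_inj (by omega)
  rcases T.block_cases u with h₁ | h₁ | h₁ <;> rcases T.block_cases v with h₂ | h₂ | h₂
  · rw [hb] at h₁
    exact T.source_unique _ _ _ h₁ h₂
  · rw [hb] at h₁
    exact absurd (T.source_spec _ _ h₁).2.2.1 (T.sink_spec _ _ h₂).2.2.2.1
  · have := T.source_facts h₁
    rw [hb, h₂] at this
    omega
  · rw [hb] at h₁
    exact absurd (T.source_spec _ _ h₂).2.2.1 (T.sink_spec _ _ h₁).2.2.2.1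
  · rw [hb] at h₁
    exact T.sink_unique _ _ _ h₁ h₂
  · have := T.sink_facts h₁
    rw [hb, h₂] at this
    omega
  · have := T.source_facts h₂
    rw [← hb, h₁] at this
    omega
  · have := T.sink_facts h₂
    rw [← hb, h₁] at this
    omega
  · rw [← h₁, ← h₂, hb]

/-- An early vertex with an earlier neighbour and a late vertex with a later neighbour determine
their column. -/
def Owns (v : V) : Prop :=
  (T.Early v ∧ ∃ u, G.Adj u v ∧ T.rk u < T.rk v) ∨ (¬ T.Early v ∧ ∃ w, G.Adj v w ∧ T.rk v < T.rk w)

theorem not_owns_of_sourceHelper {u v : V} (h : T.SourceHelper u v) : ¬ T.Owns u := by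
  have hu := T.source_spec _ _ h
  rintro (⟨-, w, hw, hlt⟩ | ⟨hn, -⟩)
  · exact lt_asymm hlt (hu.2.2.2.2 w hw.symm)
  · exact hn hu.2.2.1

theorem not_owns_of_sinkHelper {u v : V} (h : T.SinkHelper u v) : ¬ T.Owns v := by
  have hv := T.sink_spec _ _ h
  rintro (⟨hn, -⟩ | ⟨-, w, hw, hlt⟩)
  · exact hv.2.2.2.1 hn
  · exact lt_asymm hlt (hv.2.2.2.2 w hw)

theorem vcol_inj_of_owns {u v : V} (hu : T.Owns u) (hv : T.Owns v) (h : T.vcol u = T.vcol v) :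
    u = v := by
  have hb : T.block u = T.block v := T.blockColumn_inj h
  rcases T.block_cases u with h₁ | h₁ | h₁ <;> rcases T.block_cases v with h₂ | h₂ | h₂
  · rw [hb] at h₁
    exact T.source_unique _ _ _ h₁ h₂
  · rw [hb] at h₁
    exact absurd (T.source_spec _ _ h₁).2.2.1 (T.sink_spec _ _ h₂).2.2.2.1
  · rw [hb, h₂] at h₁
    exact absurd hv (T.not_owns_of_sourceHelper h₁)
  · rw [hb] at h₁
    exact absurd (T.source_spec _ _ h₂).2.2.1 (T.sink_spec _ _ h₁).2.2.2.1
  · rw [hb] at h₁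
    exact T.sink_unique _ _ _ h₁ h₂
  · rw [hb, h₂] at h₁
    exact absurd hv (T.not_owns_of_sinkHelper h₁)
  · rw [← hb, h₁] at h₂
    exact absurd hu (T.not_owns_of_sourceHelper h₂)
  · rw [← hb, h₁] at h₂
    exact absurd hu (T.not_owns_of_sinkHelper h₂)
  · rw [← h₁, ← h₂, hb]

open Classical in
/-- The column used by an edge. -/
def edgeColumn (u v : V) : ℤ :=
  if T.Early v then T.vcol v else if T.Early u then
    T.sign u v * (2 * n + 1 + T.rk u * n + T.rk v) else T.vcol u

theorem abs_edgeColumn_le (u v : V) : |T.edgeColumn u v| ≤ 4 * n + 1 + n ^ 2 := by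
  have hu := T.rk_lt u
  have hv := T.rk_lt v
  have h1 := T.abs_vcol_le u
  have h2 := T.abs_vcol_le v
  have hmul : (T.rk u : ℤ) * n ≤ n ^ 2 := by
    rw [sq]; exact mul_le_mul_of_nonneg_right (by omega) (by omega)
  have hmul' : (0 : ℤ) ≤ T.rk u * n := by positivity
  have hsq : (0 : ℤ) ≤ n ^ 2 := by positivity
  unfold edgeColumn
  split_ifs
  · linarith
  · rcases T.sign_eq u v with h | h <;> rw [h]
    · rw [one_mul, abs_le]; constructor <;> linarith
    · rw [neg_one_mul, abs_neg, abs_le]; constructor <;> linarith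
  · linarith

theorem edgeColumn_of_early_late {u v : V} (hu : T.Early u) (hv : ¬ T.Early v) :
    T.edgeColumn u v = T.sign u v * (2 * n + 1 + T.rk u * n + T.rk v) := by
  rw [edgeColumn, if_neg hv, if_pos hu]

/-- The private columns lie beyond the columns of the vertices. -/
theorem abs_private (u v : V) : |T.sign u v * (2 * n + 1 + T.rk u * n + T.rk v : ℤ)| =
    2 * n + 1 + T.rk u * n + T.rk v := by
  have h0 : (0 : ℤ) ≤ 2 * n + 1 + T.rk u * n + T.rk v := by positivity
  rcases T.sign_eq u v with h | h <;> rw [h]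
  · rw [one_mul, abs_of_nonneg h0]
  · rw [neg_one_mul, abs_neg, abs_of_nonneg h0]

theorem edgeColumn_cases {u v : V} (h : G.Adj u v) (hr : T.rk u < T.rk v) :
    (∃ w, T.Owns w ∧ T.edgeColumn u v = T.vcol w ∧ (T.Early w ∧ w = v ∨ ¬ T.Early w ∧ w = u)) ∨
    |T.edgeColumn u v| = 2 * n + 1 + T.rk u * n + T.rk v := by
  by_cases hv : T.Early v
  · exact Or.inl ⟨v, Or.inl ⟨hv, u, h, hr⟩, if_pos hv, Or.inl ⟨hv, rfl⟩⟩
  by_cases hu : T.Early u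
  · right
    rw [T.edgeColumn_of_early_late hu hv, T.abs_private]
  · exact Or.inl ⟨u, Or.inr ⟨hu, v, h, hr⟩, by rw [edgeColumn, if_neg hv, if_neg hu],
      Or.inr ⟨hu, rfl⟩⟩

theorem edgeColumn_inj (u v u' v' : V) (h : G.Adj u v) (h' : G.Adj u' v') (hr : T.rk u < T.rk v)
    (hr' : T.rk u' < T.rk v') (he : T.edgeColumn u v = T.edgeColumn u' v') :
    u = u' ∧ v = v' := by
  have beyond : ∀ w x y : V, T.vcol w = T.edgeColumn x y →
      |T.edgeColumn x y| = 2 * n + 1 + T.rk x * n + T.rk y → False := by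
    intro w x y h1 h2
    have h3 := T.abs_vcol_le w
    have h4 : (0 : ℤ) ≤ T.rk x * n := by positivity
    rw [h1, h2] at h3
    omega
  rcases T.edgeColumn_cases h hr with ⟨w, hw, hc, ho⟩ | hc <;>
  rcases T.edgeColumn_cases h' hr' with ⟨w', hw', hc', ho'⟩ | hc'
  · obtain rfl := T.vcol_inj_of_owns hw hw' (by rw [← hc, ← hc', he])
    rcases ho with ⟨hE, rfl⟩ | ⟨hE, rfl⟩ <;> rcases ho' with ⟨hE', rfl⟩ | ⟨hE', rfl⟩
    · exact ⟨T.back_unique _ hE _ _ h h' hr hr', rfl⟩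
    · exact absurd hE hE'
    · exact absurd hE' hE
    · exact ⟨rfl, T.fwd_unique _ hE _ _ h h' hr hr'⟩
  · exact (beyond w u' v' (by rw [← hc, he]) hc').elim
  · exact (beyond w' u v (by rw [← hc', he]) hc).elim
  · rw [he, hc'] at hc
    have hv := T.rk_lt v
    have hv' := T.rk_lt v'
    have hc2 : T.rk u' * n + T.rk v' = T.rk u * n + T.rk v := by
      zify; linarith
    have hn : 0 < n := by omega
    have hq : T.rk u' = T.rk u := by
      have h1 : (T.rk v' + n * T.rk u') / n = T.rk u' := by
        rw [Nat.add_mul_div_left _ _ hn, Nat.div_eq_of_lt hv', zero_add]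
      have h2 : (T.rk v + n * T.rk u) / n = T.rk u := by
        rw [Nat.add_mul_div_left _ _ hn, Nat.div_eq_of_lt hv, zero_add]
      rw [← h1, ← h2]
      congr 1
      linarith
    rw [hq] at hc2
    exact ⟨T.rk_inj hq.symm, T.rk_inj (by omega)⟩

open Classical in
/-- The direction in which the edge from `u` to `v` leaves `u`. -/
def port (u v : V) : Dir :=
  if T.Early u then
    if T.rk u < T.rk v ∧ ¬ T.SourceHelper u v then if T.sign u v = 1 then .fp else .fm else .ba
  else
    if T.rk v < T.rk u ∧ ¬ T.SinkHelper v u then if T.sign v u = 1 then .bm else .bp else .fa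

theorem port_dot (v u w : V) (hu : G.Adj v u) (hw : G.Adj v w) (hne : u ≠ w) :
    (T.port v u).dot (T.port v w) ≤ -1 := by
  have hru := T.rk_inj.ne hu.ne
  have hrw := T.rk_inj.ne hw.ne
  by_cases hv : T.Early v
  · have back : ∀ x, G.Adj v x → ¬ (T.rk v < T.rk x ∧ ¬ T.SourceHelper v x) →
        T.SourceHelper v x ∨ T.rk x < T.rk v := by
      intro x hx h
      by_contra! h'
      exact h ⟨lt_of_le_of_ne h'.2 (T.rk_inj.ne hx.ne), h'.1⟩
    simp only [port, if_pos hv]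
    by_cases h₁ : T.rk v < T.rk u ∧ ¬ T.SourceHelper v u <;>
    by_cases h₂ : T.rk v < T.rk w ∧ ¬ T.SourceHelper v w
    · have := T.sign_left v u w hu hw h₁.1 h₂.1 hne h₁.2 h₂.2
      rw [if_pos h₁, if_pos h₂]
      rcases T.sign_eq v u with h | h <;> rcases T.sign_eq v w with h' | h' <;>
        rw [h, h'] at this ⊢ <;> first | decide | exact absurd rfl this
    · rw [if_pos h₁, if_neg h₂]
      split_ifs <;> decide
    · rw [if_neg h₁, if_pos h₂]
      split_ifs <;> decide
    · exfalso
      rcases back u hu h₁ with h₁ | h₁ <;> rcases back w hw h₂ with h₂ | h₂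
      · exact hne (T.source_unique _ _ _ h₁ h₂)
      · exact lt_asymm h₂ ((T.source_spec _ _ h₁).2.2.2.2 w hw)
      · exact lt_asymm h₁ ((T.source_spec _ _ h₂).2.2.2.2 u hu)
      · exact hne (T.back_unique v hv _ _ hu.symm hw.symm h₁ h₂)
  · have fwd : ∀ x, G.Adj v x → ¬ (T.rk x < T.rk v ∧ ¬ T.SinkHelper x v) →
        T.SinkHelper x v ∨ T.rk v < T.rk x := by
      intro x hx h
      by_contra! h'
      exact h ⟨lt_of_le_of_ne h'.2 (T.rk_inj.ne hx.ne'), h'.1⟩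
    simp only [port, if_neg hv]
    by_cases h₁ : T.rk u < T.rk v ∧ ¬ T.SinkHelper u v <;>
    by_cases h₂ : T.rk w < T.rk v ∧ ¬ T.SinkHelper w v
    · have := T.sign_right u w v hu.symm hw.symm h₁.1 h₂.1 hne h₁.2 h₂.2
      rw [if_pos h₁, if_pos h₂]
      rcases T.sign_eq u v with h | h <;> rcases T.sign_eq w v with h' | h' <;>
        rw [h, h'] at this ⊢ <;> first | decide | exact absurd rfl this
    · rw [if_pos h₁, if_neg h₂]
      split_ifs <;> decide
    · rw [if_neg h₁, if_pos h₂]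
      split_ifs <;> decide
    · exfalso
      rcases fwd u hu h₁ with h₁ | h₁ <;> rcases fwd w hw h₂ with h₂ | h₂
      · exact hne (T.sink_unique _ _ _ h₁ h₂)
      · exact lt_asymm h₂ ((T.sink_spec _ _ h₁).2.2.2.2 w hw)
      · exact lt_asymm h₁ ((T.sink_spec _ _ h₂).2.2.2.2 u hu)
      · exact hne (T.fwd_unique v hv _ _ hu hw h₁ h₂)

theorem lt_of_blockColumn_lt {u v : V} (h : T.blockColumn (T.block u) < T.blockColumn (T.block v)) :
    T.vcol u < T.vcol v ∧ T.vrow u < T.vrow v := by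
  have hu := T.offset_eq u
  have hv := T.offset_eq v
  unfold vcol vrow
  omega

theorem side_of_early {u v : V} (hv : T.Early v) (h : G.Adj u v) (hr : T.rk u < T.rk v) :
    T.side v = T.sign u v := by
  have hex : ∃ u, G.Adj u v ∧ T.rk u < T.rk v := ⟨u, h, hr⟩
  rw [side, if_pos hv, dif_pos hex,
    T.back_unique v hv _ _ hex.choose_spec.1 h hex.choose_spec.2 hr]

theorem side_of_late {v w : V} (hv : ¬ T.Early v) (h : G.Adj v w) (hr : T.rk v < T.rk w) :
    T.side v = T.sign v w := by
  have hex : ∃ w, G.Adj v w ∧ T.rk v < T.rk w := ⟨w, h, hr⟩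
  rw [side, if_neg hv, dif_pos hex,
    T.fwd_unique v hv _ _ hex.choose_spec.1 h hex.choose_spec.2 hr]

theorem block_early {v : V} (hv : T.Early v) :
    T.Early (T.block v) ∧ T.rk (T.block v) ≤ T.rk v := by
  rcases T.block_cases v with h | h | h
  · exact ⟨(T.source_spec _ _ h).2.2.1, (T.source_spec _ _ h).2.1.le⟩
  · exact absurd hv (T.sink_spec _ _ h).2.2.1
  · rw [h]
    exact ⟨hv, le_rfl⟩

theorem block_late {v : V} (hv : ¬ T.Early v) :
    ¬ T.Early (T.block v) ∧ T.rk v ≤ T.rk (T.block v) := by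
  rcases T.block_cases v with h | h | h
  · exact absurd (T.source_spec _ _ h).2.2.2.1 hv
  · exact ⟨(T.sink_spec _ _ h).2.2.2.1, (T.sink_spec _ _ h).2.1.le⟩
  · rw [h]
    exact ⟨hv, le_rfl⟩

theorem block_of_early_edge {u v : V} (hv : T.Early v) (h : G.Adj u v) (hr : T.rk u < T.rk v)
    (hs : ¬ T.SourceHelper u v) : T.block v = v := by
  refine T.block_of_not (fun w hw => hs ?_) fun z hz => (T.sink_spec _ _ hz).2.2.1 hv
  have := T.source_spec _ _ hw
  rwa [T.back_unique v hv u w h this.1 hr this.2.1]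

theorem block_of_late_edge {u v : V} (hu : ¬ T.Early u) (h : G.Adj u v) (hr : T.rk u < T.rk v)
    (hs : ¬ T.SinkHelper u v) : T.block u = u := by
  refine T.block_of_not (fun w hw => hu (T.source_spec _ _ hw).2.2.2.1) fun z hz => hs ?_
  have := T.sink_spec _ _ hz
  rwa [T.fwd_unique u hu v z h this.1 hr this.2.1]

theorem early_early {u v : V} (hu : T.Early u) (hv : T.Early v) (h : G.Adj u v)
    (hr : T.rk u < T.rk v) (hs : ¬ T.SourceHelper u v) :
    (T.sign u v = 1 → T.vcol u < T.vcol v ∧ T.vrow u < T.vrow v) ∧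
    (T.sign u v = -1 → T.vcol v < T.vcol u ∧ T.vrow v < T.vrow u) := by
  have hb := T.block_of_early_edge hv h hr hs
  have hu' := T.block_early hu
  have hdist : |T.blockColumn (T.block u)| < T.dist v := by
    rw [abs_blockColumn, dist, dist, if_pos hu'.1, if_pos hv]
    omega
  rw [abs_lt] at hdist
  have hcol : T.blockColumn (T.block v) = T.sign u v * T.dist v := by
    rw [hb, blockColumn, T.side_of_early hv h hr]
  constructor <;> intro hsg <;> rw [hsg] at hcol <;> exact T.lt_of_blockColumn_lt (by omega)

theorem late_late {u v : V} (hu : ¬ T.Early u) (hv : ¬ T.Early v) (h : G.Adj u v)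
    (hr : T.rk u < T.rk v) (hs : ¬ T.SinkHelper u v) :
    (T.sign u v = 1 → T.vcol v < T.vcol u ∧ T.vrow v < T.vrow u) ∧
    (T.sign u v = -1 → T.vcol u < T.vcol v ∧ T.vrow u < T.vrow v) := by
  have hb := T.block_of_late_edge hu h hr hs
  have hv' := T.block_late hv
  have hdist : |T.blockColumn (T.block v)| < T.dist u := by
    rw [abs_blockColumn, dist, dist, if_neg hv'.1, if_neg hu]
    omega
  rw [abs_lt] at hdist
  have hcol : T.blockColumn (T.block u) = T.sign u v * T.dist u := by
    rw [hb, blockColumn, T.side_of_late hu h hr]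
  constructor <;> intro hsg <;> rw [hsg] at hcol <;> exact T.lt_of_blockColumn_lt (by omega)

theorem late_early {u v : V} (hu : ¬ T.Early u) (hv : T.Early v) :
    (T.vcol u < T.vcol v ∧ T.vrow u < T.vrow v) ∨ (T.vcol v < T.vcol u ∧ T.vrow v < T.vrow u) := by
  have hne : T.blockColumn (T.block u) ≠ T.blockColumn (T.block v) := fun h =>
    (T.block_late hu).1 (T.blockColumn_inj h ▸ (T.block_early hv).1)
  rcases lt_or_gt_of_ne hne with h | h
  · exact Or.inl (T.lt_of_blockColumn_lt h)
  · exact Or.inr (T.lt_of_blockColumn_lt h)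

/-- A bound for all columns and rows. -/
def extent (n : ℕ) : ℤ := n ^ 2 + 6 * n + 3

/-- The margin around the height of a vertex. -/
def margin (n : ℕ) : ℤ := 4 * extent n + 5

/-- A bound for all coordinates. -/
def bound (n : ℕ) : ℤ := (2 * margin n + 1) * n + margin n

/-- The position of a vertex. -/
def pos (v : V) : ℤ × ℤ × ℤ := ((2 * margin n + 1) * T.rk v, T.vcol v, T.vrow v)

theorem margin_pos (n : ℕ) : 0 < margin n := by
  unfold margin extent
  positivity

theorem height_bound (v : V) : |(T.pos v).1| + margin n ≤ bound n := by
  have hm := margin_pos n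
  have h0 : (0 : ℤ) ≤ (2 * margin n + 1) * T.rk v := by positivity
  have hle : (2 * margin n + 1) * (T.rk v : ℤ) ≤ (2 * margin n + 1) * n :=
    mul_le_mul_of_nonneg_left (by exact_mod_cast (T.rk_lt v).le) (by linarith)
  simp only [pos]
  rw [abs_of_nonneg h0, bound]
  linarith

theorem vcol_bound (v : V) : |T.vcol v| ≤ extent n := by
  have := T.abs_vcol_le v
  unfold extent
  nlinarith

theorem vrow_bound (v : V) : |T.vrow v| ≤ extent n := by
  have := T.abs_vrow_le v
  unfold extent
  nlinarith

theorem height_lt {u v : V} (hr : T.rk u < T.rk v) :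
    (T.pos u).1 + 2 * margin n < (T.pos v).1 := by
  have hm := margin_pos n
  have : (T.rk u : ℤ) + 1 ≤ T.rk v := by exact_mod_cast hr
  simp only [pos]
  nlinarith

theorem fits {u v : V} (hr : T.rk u < T.rk v) {k : ℤ} (hk : |k| ≤ extent n) :
    Fits (T.pos u) (T.pos v) k (extent n) (margin n) (bound n) where
  column_left := T.vcol_bound u
  column_right := T.vcol_bound v
  column_le := hk
  row_left := T.vrow_bound u
  row_right := T.vrow_bound v
  width := le_rfl
  height_lt := T.height_lt hr
  height_left := T.height_bound u
  height_right := T.height_bound v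

theorem edgeColumn_bound (u v : V) : |T.edgeColumn u v| ≤ extent n := by
  have := T.abs_edgeColumn_le u v
  unfold extent
  linarith

theorem private_beyond (u v w : V) : (T.sign u v = 1 →
      T.vcol w < T.sign u v * (2 * n + 1 + T.rk u * n + T.rk v)) ∧
    (T.sign u v = -1 → T.sign u v * (2 * n + 1 + T.rk u * n + T.rk v) < T.vcol w) := by
  have h1 := abs_le.1 (T.abs_vcol_le w)
  have h2 : (0 : ℤ) ≤ T.rk u * n := by positivity
  constructor <;> intro h <;> rw [h] <;> linarith

theorem exists_route {u v : V} (h : G.Adj u v) (hr : T.rk u < T.rk v) :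
    Nonempty (Route (T.pos u) (T.pos v) (T.port u v) (T.port v u) (T.edgeColumn u v)
      (margin n) (bound n)) := by
  have F := T.fits hr (T.edgeColumn_bound u v)
  have hne : T.vrow u ≠ T.vrow v := fun hh => h.ne (T.vrow_inj hh)
  by_cases hu : T.Early u <;> by_cases hv : T.Early v
  · have hcol : T.edgeColumn u v = T.vcol v := if_pos hv
    have hpv : T.port v u = .ba := by rw [port, if_pos hv, if_neg fun hh => hr.not_gt hh.1]
    rw [hcol] at F ⊢
    rw [hpv]
    by_cases hs : T.SourceHelper u v
    · have hpu : T.port u v = .ba := by rw [port, if_pos hu, if_neg fun hh => hh.2 hs]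
      have hf := T.source_facts hs
      have hc : T.vcol u = T.vcol v := by rw [vcol, vcol, hf.1, hf.2.2.1]
      have hrow : T.vrow v = T.vrow u + 2 := by
        rw [vrow, vrow, hf.1, hf.2.1, hf.2.2.1, hf.2.2.2]; ring
      rw [hpu]
      unfold pos at F ⊢
      rw [hc] at F ⊢
      exact exists_route_dip F hrow
    · have hlt := T.early_early hu hv h hr hs
      rcases T.sign_eq u v with hsg | hsg
      · have hpu : T.port u v = .fp := by rw [port, if_pos hu, if_pos ⟨hr, hs⟩, if_pos hsg]
        rw [hpu]
        exact exists_route_forward_pos F (hlt.1 hsg).1 (hlt.1 hsg).2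
      · have hpu : T.port u v = .fm := by
          rw [port, if_pos hu, if_pos ⟨hr, hs⟩, if_neg (by omega)]
        rw [hpu]
        exact exists_route_forward_neg F (hlt.2 hsg).1 (hlt.2 hsg).2
  · rw [T.edgeColumn_of_early_late hu hv] at F ⊢
    have hs : ¬ T.SourceHelper u v := fun hs => hv (T.source_spec _ _ hs).2.2.2.1
    have hs' : ¬ T.SinkHelper u v := fun hs => (T.sink_spec _ _ hs).2.2.1 hu
    have hbu := T.private_beyond u v u
    have hbv := T.private_beyond u v v
    rcases T.sign_eq u v with hsg | hsg
    · have hpu : T.port u v = .fp := by rw [port, if_pos hu, if_pos ⟨hr, hs⟩, if_pos hsg]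
      have hpv : T.port v u = .bm := by rw [port, if_neg hv, if_pos ⟨hr, hs'⟩, if_pos hsg]
      rw [hpu, hpv]
      rcases lt_or_gt_of_ne hne with hrow | hrow
      · exact exists_route_private_pos_pos F (hbu.1 hsg) (hbv.1 hsg) hrow
      · exact exists_route_private_pos_neg F (hbu.1 hsg) (hbv.1 hsg) hrow
    · have hpu : T.port u v = .fm := by
        rw [port, if_pos hu, if_pos ⟨hr, hs⟩, if_neg (by omega)]
      have hpv : T.port v u = .bp := by
        rw [port, if_neg hv, if_pos ⟨hr, hs'⟩, if_neg (by omega)]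
      rw [hpu, hpv]
      rcases lt_or_gt_of_ne hne with hrow | hrow
      · exact exists_route_private_neg_pos F (hbu.2 hsg) (hbv.2 hsg) hrow
      · exact exists_route_private_neg_neg F (hbu.2 hsg) (hbv.2 hsg) hrow
  · have hcol : T.edgeColumn u v = T.vcol v := if_pos hv
    have hpu : T.port u v = .fa := by rw [port, if_neg hu, if_neg fun hh => hr.not_gt hh.1]
    have hpv : T.port v u = .ba := by rw [port, if_pos hv, if_neg fun hh => hr.not_gt hh.1]
    rw [hcol] at F ⊢
    rw [hpu, hpv]
    rcases T.late_early hu hv with hlt | hlt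
    · exact exists_route_axial_pos F hlt.1 hlt.2
    · exact exists_route_axial_neg F hlt.1 hlt.2
  · have hcol : T.edgeColumn u v = T.vcol u := by rw [edgeColumn, if_neg hv, if_neg hu]
    have hpu : T.port u v = .fa := by rw [port, if_neg hu, if_neg fun hh => hr.not_gt hh.1]
    rw [hcol] at F ⊢
    rw [hpu]
    by_cases hs : T.SinkHelper u v
    · have hpv : T.port v u = .fa := by rw [port, if_neg hv, if_neg fun hh => hh.2 hs]
      have hf := T.sink_facts hs
      have hc : T.vcol v = T.vcol u := by rw [vcol, vcol, hf.1, hf.2.2.1]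
      have hrow : T.vrow v = T.vrow u + 2 := by
        rw [vrow, vrow, hf.1, hf.2.1, hf.2.2.1, hf.2.2.2]; ring
      rw [hpv]
      unfold pos at F ⊢
      rw [hc] at F ⊢
      exact exists_route_overshoot F hrow
    · have hlt := T.late_late hu hv h hr hs
      rcases T.sign_eq u v with hsg | hsg
      · have hpv : T.port v u = .bm := by rw [port, if_neg hv, if_pos ⟨hr, hs⟩, if_pos hsg]
        rw [hpv]
        exact exists_route_backward_neg F (hlt.1 hsg).1 (hlt.1 hsg).2
      · have hpv : T.port v u = .bp := by
          rw [port, if_neg hv, if_pos ⟨hr, hs⟩, if_neg (by omega)]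
        rw [hpv]
        exact exists_route_backward_pos F (hlt.2 hsg).1 (hlt.2 hsg).2

/-- The layout given by a scheme. -/
def layout : Layout G (margin n) (bound n) where
  rk := T.rk
  rk_inj := T.rk_inj
  pos := T.pos
  port := T.port
  col := T.edgeColumn
  margin_nonneg := (margin_pos n).le
  row_inj _ _ h := T.vrow_inj h
  height_far u v h := by
    rw [lt_abs]
    rcases lt_or_gt_of_ne (T.rk_inj.ne h) with hr | hr
    · have := T.height_lt hr
      right; linarith
    · have := T.height_lt hr
      left; linarith
  col_inj := T.edgeColumn_inj
  port_dot := T.port_dot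
  route _ _ h hr := (T.exists_route h hr).some

theorem extent_le_bound (n : ℕ) : extent n ≤ bound n := by
  have hm := margin_pos n
  have h1 : 0 ≤ (2 * margin n + 1) * n := by positivity
  have h2 : 0 ≤ extent n := by unfold extent; positivity
  unfold bound
  have : extent n ≤ margin n := by unfold margin; linarith
  linarith

theorem pos_le_bound (v : V) :
    |(T.pos v).1| ≤ bound n ∧ |(T.pos v).2.1| ≤ bound n ∧ |(T.pos v).2.2| ≤ bound n :=
  ⟨by linarith [T.height_bound v, margin_pos n], (T.vcol_bound v).trans (extent_le_bound n),
    (T.vrow_bound v).trans (extent_le_bound n)⟩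

theorem bound_le {n : ℕ} (hn : 0 < n) : (bound n : ℝ) ≤ 136 * (n : ℝ) ^ 3 := by
  have h1 : (1 : ℤ) ≤ n := by exact_mod_cast hn
  have hX : extent n ≤ 10 * (n : ℤ) ^ 2 := by unfold extent; nlinarith
  have hM : margin n ≤ 45 * (n : ℤ) ^ 2 := by unfold margin; nlinarith
  have hK : 2 * margin n + 1 ≤ 91 * (n : ℤ) ^ 2 := by nlinarith
  have : bound n ≤ 136 * (n : ℤ) ^ 3 := by
    have h2 : (2 * margin n + 1) * n ≤ 91 * (n : ℤ) ^ 2 * n :=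
      mul_le_mul_of_nonneg_right hK (by linarith)
    have h3 : 45 * (n : ℤ) ^ 2 ≤ 45 * (n : ℤ) ^ 2 * n := le_mul_of_one_le_right (by positivity) h1
    unfold bound
    calc _ ≤ 91 * (n : ℤ) ^ 2 * n + 45 * (n : ℤ) ^ 2 * n := by linarith
      _ = 136 * (n : ℤ) ^ 3 := by ring
  exact_mod_cast this

end Scheme

/-- There is a constant `c > 0` such that every graph on `n` vertices
with maximum degree at most three has a non-crossing polyline drawing in ℝ³ with all
vertices and bends at integer coordinates, inside a box with all side lengths at most
`c·n³`, at most three bends per edge, all edge segments parallel to face diagonals of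
the integer grid, and angular resolution at least `2π/3` (120°). -/
theorem degree_three_grid_drawing :
    ∃ c : ℝ, 0 < c ∧
      ∀ (n : ℕ) (V : Type) [Fintype V] [DecidableEq V]
        (G : SimpleGraph V) [DecidableRel G.Adj],
        Fintype.card V = n → (∀ v, G.degree v ≤ 3) →
        ∃ D : PolylineDrawing G,
          NonCrossing D ∧
          MaxBends D 3 ∧
          AngularResAtLeast D (2 * Real.pi / 3) ∧
          (∀ v : V, ∀ i : Fin 3, ∃ m : ℤ, D.p v i = (m : ℝ)) ∧
          (∀ u v : V, ∀ h : G.Adj u v, ∀ q ∈ D.seq u v h, ∀ i : Fin 3, ∃ m : ℤ, q i = (m : ℝ)) ∧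
          (∃ lo s : Fin 3 → ℝ, (∀ i : Fin 3, s i ≤ c * (n : ℝ) ^ 3) ∧
            ∀ x ∈ drawingImage D, ∀ i : Fin 3, lo i ≤ x i ∧ x i ≤ lo i + s i) ∧
          (∀ u v : V, ∀ h : G.Adj u v, ∀ a b : Pt, [a, b] <:+: D.seq u v h →
            ∃ k : ℝ, k ≠ 0 ∧ ∃ d : Fin 3 → ℝ,
              (∃ j : Fin 3, d j = 0 ∧ ∀ i : Fin 3, i ≠ j → (d i = 1 ∨ d i = -1)) ∧
              ∀ i : Fin 3, b i - a i = k * d i) := by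
  refine ⟨1088, by norm_num, fun n V _ _ G _ hn hG => ?_⟩
  subst hn
  obtain ⟨T⟩ := exists_scheme hG
  have hbound : ∀ v : V, (Scheme.bound (Fintype.card V) : ℝ) ≤ 136 * (Fintype.card V : ℝ) ^ 3 :=
    fun v => Scheme.bound_le (Fintype.card_pos_iff.2 ⟨v⟩)
  refine ⟨T.layout.drawing, T.layout.nonCrossing, T.layout.maxBends, T.layout.angularRes,
    fun v i => Layout.integer_toPt _ i, fun u v h q hq i => T.layout.integer_of_mem_seq h hq i,
    ⟨fun _ => -(544 * (Fintype.card V : ℝ) ^ 3), fun _ => 1088 * (Fintype.card V : ℝ) ^ 3,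
      fun _ => le_rfl, fun x hx i => ?_⟩, fun u v h a b hi => T.layout.diagonal_of_consecutive h hi⟩
  have hb := T.layout.abs_le_of_mem T.pos_le_bound hx i
  obtain ⟨v⟩ : Nonempty V := by
    rcases hx with ⟨v, -⟩ | hx
    · exact ⟨v⟩
    · simp only [Set.mem_iUnion] at hx
      exact ⟨hx.choose⟩
  have := hbound v
  constructor <;> linarith [hb.1, hb.2]
end
end

section
/- The complete graph K₄ has a non-crossing polyline drawing in ℝ³ in which all four vertices are placed at points with integer coordinates, every edge is drawn with at most 2 bends, and the drawing has angular resolution at least 2π/3 (120°). -/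
open InnerProductGeometry

noncomputable section

variable {V : Type*} {G : SimpleGraph V}

/-- The point of `ℝ³` with the given integer coordinates. -/
def latticePt (z : Fin 3 → ℤ) : Pt := WithLp.toLp 2 fun i => (z i : ℝ)

/-- The bounding boxes of the integer segments `[a, b]` and `[c, d]` are strictly
separated in some coordinate. -/
def BoxSeparated (a b c d : Fin 3 → ℤ) : Prop :=
  ∃ i, max (a i) (b i) < min (c i) (d i) ∨ max (c i) (d i) < min (a i) (b i)

/-- The integer vectors `x` and `y` enclose an angle of at least `2π/3`: the inner
product is negative and `4 ⟪x, y⟫² ≥ ‖x‖² ‖y‖²`. -/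
def WideAngle (x y : Fin 3 → ℤ) : Prop :=
  x ⬝ᵥ y < 0 ∧ (x ⬝ᵥ x) * (y ⬝ᵥ y) ≤ 4 * (x ⬝ᵥ y) ^ 2

instance (a b c d : Fin 3 → ℤ) : Decidable (BoxSeparated a b c d) := by
  unfold BoxSeparated; infer_instance

instance (x y : Fin 3 → ℤ) : Decidable (WideAngle x y) := by
  unfold WideAngle; infer_instance

theorem latticePt_apply (z : Fin 3 → ℤ) (i : Fin 3) : latticePt z i = z i := rfl

theorem latticePt_injective : Function.Injective latticePt := fun a b h => by
  funext i
  have := congrArg (fun x : Pt => x i) h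
  simpa [latticePt_apply] using this

theorem latticePt_sub (x y : Fin 3 → ℤ) :
    latticePt (x - y) = latticePt x - latticePt y := by
  ext i
  simp [latticePt_apply]

theorem inner_latticePt (x y : Fin 3 → ℤ) :
    inner ℝ (latticePt x) (latticePt y) = ((x ⬝ᵥ y : ℤ) : ℝ) := by
  simp [PiLp.inner_apply, latticePt_apply, dotProduct, mul_comm]

theorem WideAngle.angle_ge {a q b : Fin 3 → ℤ} (h : WideAngle (a - q) (b - q)) :
    2 * Real.pi / 3 ≤ angle (latticePt a - latticePt q) (latticePt b - latticePt q) := by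
  rw [← latticePt_sub, ← latticePt_sub]
  generalize a - q = x at h ⊢
  generalize b - q = y at h ⊢
  obtain ⟨h1, h2⟩ := h
  have h1' : inner ℝ (latticePt x) (latticePt y) < 0 := by
    rw [inner_latticePt]; exact_mod_cast h1
  have h2' : (‖latticePt x‖ * ‖latticePt y‖) ^ 2 ≤
      4 * (inner ℝ (latticePt x) (latticePt y)) ^ 2 := by
    rw [mul_pow, ← real_inner_self_eq_norm_sq, ← real_inner_self_eq_norm_sq]
    simp only [inner_latticePt]
    exact_mod_cast h2
  have hx : latticePt x ≠ 0 := fun h => by simp [h] at h1'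
  have hy : latticePt y ≠ 0 := fun h => by simp [h] at h1'
  have hpos : 0 < ‖latticePt x‖ * ‖latticePt y‖ := by positivity
  have hcos : Real.cos (2 * Real.pi / 3) = -(1 / 2) := by
    rw [show 2 * Real.pi / 3 = Real.pi - Real.pi / 3 by ring, Real.cos_pi_sub,
      Real.cos_pi_div_three]
  have key : Real.cos (angle (latticePt x) (latticePt y)) ≤ Real.cos (2 * Real.pi / 3) := by
    rw [hcos, cos_angle, div_le_iff₀ hpos]
    nlinarith
  by_contra hlt
  push Not at hlt
  have := Real.cos_lt_cos_of_nonneg_of_le_pi (angle_nonneg _ _)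
    (by linarith [Real.pi_pos] : 2 * Real.pi / 3 ≤ Real.pi) hlt
  linarith

theorem BoxSeparated.disjoint {a b c d : Fin 3 → ℤ} (h : BoxSeparated a b c d) :
    Disjoint (segment ℝ (latticePt a) (latticePt b))
      (segment ℝ (latticePt c) (latticePt d)) := by
  rw [Set.disjoint_left]
  rintro x ⟨s, t, hs, ht, hst, rfl⟩ ⟨s', t', hs', ht', hst', hx⟩
  obtain ⟨i, h⟩ := h
  have hi := congrArg (fun x : Pt => x i) hx
  simp only [PiLp.add_apply, PiLp.smul_apply, latticePt_apply, smul_eq_mul] at hi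
  have bounds (s t p q : ℝ) (hs : 0 ≤ s) (ht : 0 ≤ t) (hst : s + t = 1) :
      min p q ≤ s * p + t * q ∧ s * p + t * q ≤ max p q :=
    ⟨Convex.min_le_combo p q hs ht hst, Convex.combo_le_max p q hs ht hst⟩
  have h₁ := bounds s t (a i) (b i) hs ht hst
  have h₂ := bounds s' t' (c i) (d i) hs' ht' hst'
  rcases h with h | h
  all_goals
    rify at h
    linarith

/-- Two segments leaving a common point `q` at an obtuse angle meet only in `q`. -/
theorem segment_inter_segment_of_inner_neg {a b q : Pt}
    (h : inner ℝ (a - q) (b - q) < 0) :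
    segment ℝ q a ∩ segment ℝ q b = {q} := by
  ext x
  constructor
  · rw [segment_eq_image', segment_eq_image']
    rintro ⟨⟨s, ⟨hs, -⟩, rfl⟩, ⟨t, ⟨ht, -⟩, hx⟩⟩
    have hx' : t • (b - q) = s • (a - q) := by simpa using hx
    have h1 : inner ℝ (s • (a - q)) (t • (b - q)) = s * t * inner ℝ (a - q) (b - q) := by
      rw [real_inner_smul_left, real_inner_smul_right]; ring
    have h2 : (0 : ℝ) ≤ inner ℝ (s • (a - q)) (t • (b - q)) := by
      rw [hx']; exact real_inner_self_nonneg
    have h3 : inner ℝ (s • (a - q)) (s • (a - q)) ≤ 0 := by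
      nth_rewrite 2 [← hx']
      rw [h1]
      exact mul_nonpos_of_nonneg_of_nonpos (mul_nonneg hs ht) h.le
    have h4 := real_inner_self_nonpos.mp h3
    simp [h4]
  · rintro rfl
    exact ⟨left_mem_segment _ _ _, left_mem_segment _ _ _⟩

theorem WideAngle.segment_inter {a q b : Fin 3 → ℤ} (h : WideAngle (a - q) (b - q)) :
    segment ℝ (latticePt q) (latticePt a) ∩ segment ℝ (latticePt q) (latticePt b) =
      {latticePt q} := by
  apply segment_inter_segment_of_inner_neg
  rw [← latticePt_sub, ← latticePt_sub, inner_latticePt]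
  exact_mod_cast h.1

/-- The integer segments `[a, b]` and `[c, d]` share the endpoint `q`, where they enclose
a wide angle. -/
def WideCorner (a b c d q : Fin 3 → ℤ) : Prop :=
  (a = q ∧ c = q ∧ WideAngle (b - q) (d - q)) ∨ (a = q ∧ d = q ∧ WideAngle (b - q) (c - q)) ∨
    (b = q ∧ c = q ∧ WideAngle (a - q) (d - q)) ∨ (b = q ∧ d = q ∧ WideAngle (a - q) (c - q))

instance (a b c d q : Fin 3 → ℤ) : Decidable (WideCorner a b c d q) := by
  unfold WideCorner; infer_instance

theorem WideCorner.segment_inter {a b c d q : Fin 3 → ℤ} (h : WideCorner a b c d q) :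
    segment ℝ (latticePt a) (latticePt b) ∩ segment ℝ (latticePt c) (latticePt d) =
      {latticePt q} := by
  rcases h with ⟨rfl, rfl, h⟩ | ⟨rfl, rfl, h⟩ | ⟨rfl, rfl, h⟩ | ⟨rfl, rfl, h⟩
  · exact h.segment_inter
  · rw [segment_symm ℝ (latticePt c)]
    exact h.segment_inter
  · rw [segment_symm ℝ (latticePt a)]
    exact h.segment_inter
  · rw [segment_symm ℝ (latticePt a), segment_symm ℝ (latticePt c)]
    exact h.segment_inter

theorem mem_polyImage_map {l : List (Fin 3 → ℤ)} {x : Pt} :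
    x ∈ polyImage (l.map latticePt) ↔
      ∃ q ∈ l.zip l.tail, x ∈ segment ℝ (latticePt q.1) (latticePt q.2) := by
  simp only [polyImage, ← List.map_tail, List.zip_map, Set.mem_iUnion,
    List.mem_map, exists_prop]
  constructor
  · rintro ⟨_, ⟨q, hq, rfl⟩, hx⟩
    exact ⟨q, hq, hx⟩
  · rintro ⟨q, hq, hx⟩
    exact ⟨_, ⟨q, hq, rfl⟩, hx⟩

/-- The positions of the four vertices of the drawing of `K₄`. -/
def K4Vertex : Fin 4 → Fin 3 → ℤ
  | 0 => ![0, 0, 0]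
  | 1 => ![0, -3, -3]
  | 2 => ![-3, 0, -3]
  | 3 => ![-3, -3, 0]

/-- The polygonal paths of the drawing of `K₄`, which is invariant under cyclic
permutations of the coordinates. -/
def K4Path : Fin 4 → Fin 4 → List (Fin 3 → ℤ)
  | 0, 1 => [![0, 0, 0], ![2, -1, -1], ![2, -2, -2], ![0, -3, -3]]
  | 0, 2 => [![0, 0, 0], ![-1, 2, -1], ![-2, 2, -2], ![-3, 0, -3]]
  | 0, 3 => [![0, 0, 0], ![-1, -1, 2], ![-2, -2, 2], ![-3, -3, 0]]
  | 1, 2 => [![0, -3, -3], ![-1, -2, -5], ![-2, -1, -5], ![-3, 0, -3]]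
  | 2, 3 => [![-3, 0, -3], ![-5, -1, -2], ![-5, -2, -1], ![-3, -3, 0]]
  | 3, 1 => [![-3, -3, 0], ![-2, -5, -1], ![-1, -5, -2], ![0, -3, -3]]
  | 1, 0 => [![0, -3, -3], ![2, -2, -2], ![2, -1, -1], ![0, 0, 0]]
  | 2, 0 => [![-3, 0, -3], ![-2, 2, -2], ![-1, 2, -1], ![0, 0, 0]]
  | 3, 0 => [![-3, -3, 0], ![-2, -2, 2], ![-1, -1, 2], ![0, 0, 0]]
  | 2, 1 => [![-3, 0, -3], ![-2, -1, -5], ![-1, -2, -5], ![0, -3, -3]]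
  | 3, 2 => [![-3, -3, 0], ![-5, -2, -1], ![-5, -1, -2], ![-3, 0, -3]]
  | 1, 3 => [![0, -3, -3], ![-1, -5, -2], ![-2, -5, -1], ![-3, -3, 0]]
  | _, _ => []

theorem K4Path_head : ∀ u v : Fin 4, u ≠ v → (K4Path u v).head? = some (K4Vertex u) := by
  decide +kernel

theorem K4Path_last : ∀ u v : Fin 4, u ≠ v → (K4Path u v).getLast? = some (K4Vertex v) := by
  decide +kernel

theorem K4Path_symm : ∀ u v : Fin 4, u ≠ v → K4Path v u = (K4Path u v).reverse := by
  decide +kernel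

theorem K4Path_length : ∀ u v : Fin 4, u ≠ v → (K4Path u v).length = 4 := by
  decide +kernel

theorem K4Vertex_injective : Function.Injective K4Vertex := by
  unfold Function.Injective
  decide +kernel

/-- The two-bend drawing of `K₄` on the integer lattice. -/
def K4Drawing : PolylineDrawing (⊤ : SimpleGraph (Fin 4)) where
  p v := latticePt (K4Vertex v)
  p_inj := latticePt_injective.comp K4Vertex_injective
  seq u v _ := (K4Path u v).map latticePt
  seq_head u v h := by rw [List.head?_map, K4Path_head u v h.ne]; rfl
  seq_last u v h := by rw [List.getLast?_map, K4Path_last u v h.ne]; rfl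
  seq_symm u v h := by rw [K4Path_symm u v h.ne, List.map_reverse]

theorem simplePolyline_map {l : List (Fin 3 → ℤ)} (hne : l.IsChain (· ≠ ·))
    (hsucc : ∀ i, ∀ h : i + 2 < l.length, WideAngle (l[i] - l[i + 1]) (l[i + 2] - l[i + 1]))
    (hsep : ∀ j, ∀ h : j + 1 < l.length, ∀ i, ∀ _ : i + 1 < j,
      BoxSeparated l[i] l[i + 1] l[j] l[j + 1]) :
    SimplePolyline (l.map latticePt) := by
  constructor
  · refine (List.isChain_map latticePt).mpr (hne.imp fun a b h => ?_)
    exact latticePt_injective.ne h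
  · intro i j hi hj hij
    simp only [List.length_map] at hi hj
    simp only [List.get_eq_getElem, List.getElem_map]
    split_ifs with h
    · subst h
      rw [segment_symm]
      exact (hsucc i hj).segment_inter
    · exact (hsep j hj i (by omega)).disjoint.inter_eq

theorem K4Path_simple (u v : Fin 4) (h : u ≠ v) :
    SimplePolyline ((K4Path u v).map latticePt) := by
  apply simplePolyline_map
  · revert u v
    decide +kernel
  · have : ∀ u v : Fin 4, u ≠ v → ∀ i : Fin 4, ∀ h : (i : ℕ) + 2 < (K4Path u v).length,
        WideAngle ((K4Path u v)[(i : ℕ)] - (K4Path u v)[(i : ℕ) + 1])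
          ((K4Path u v)[(i : ℕ) + 2] - (K4Path u v)[(i : ℕ) + 1]) := by
      decide +kernel
    intro i hi
    have hl := K4Path_length u v h
    exact this u v h ⟨i, by omega⟩ hi
  · have : ∀ u v : Fin 4, u ≠ v → ∀ j : Fin 4, ∀ _ : (j : ℕ) + 1 < (K4Path u v).length,
        ∀ i : Fin 4, ∀ _ : (i : ℕ) + 1 < (j : ℕ),
        BoxSeparated (K4Path u v)[(i : ℕ)] (K4Path u v)[(i : ℕ) + 1]
          (K4Path u v)[(j : ℕ)] (K4Path u v)[(j : ℕ) + 1] := by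
      decide +kernel
    intro j hj i hi
    have hl := K4Path_length u v h
    exact this u v h ⟨j, by omega⟩ hj ⟨i, by omega⟩ hi

theorem head_mem_polyImage_K4Path {u v : Fin 4} (h : u ≠ v) :
    latticePt (K4Vertex u) ∈ polyImage ((K4Path u v).map latticePt) := by
  have : ∃ q ∈ (K4Path u v).zip (K4Path u v).tail, q.1 = K4Vertex u := by
    revert u v
    decide +kernel
  obtain ⟨q, hq, hqu⟩ := this
  exact mem_polyImage_map.mpr ⟨q, hq, hqu ▸ left_mem_segment _ _ _⟩

theorem last_mem_polyImage_K4Path {u v : Fin 4} (h : u ≠ v) :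
    latticePt (K4Vertex v) ∈ polyImage ((K4Path u v).map latticePt) := by
  have : ∃ q ∈ (K4Path u v).zip (K4Path u v).tail, q.2 = K4Vertex v := by
    revert u v
    decide +kernel
  obtain ⟨q, hq, hqv⟩ := this
  exact mem_polyImage_map.mpr ⟨q, hq, hqv ▸ right_mem_segment _ _ _⟩

theorem K4Path_vertex_separated : ∀ u v w : Fin 4, u ≠ v → w ≠ u → w ≠ v →
    ∀ q ∈ (K4Path u v).zip (K4Path u v).tail,
      BoxSeparated q.1 q.2 (K4Vertex w) (K4Vertex w) := by
  decide +kernel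

set_option synthInstance.maxSize 1000 in
set_option synthInstance.maxHeartbeats 200000 in
theorem K4Path_pair_separated : ∀ u v u' v' : Fin 4, u ≠ v → u' ≠ v' → s(u, v) ≠ s(u', v') →
    ∀ q ∈ (K4Path u v).zip (K4Path u v).tail, ∀ q' ∈ (K4Path u' v').zip (K4Path u' v').tail,
      BoxSeparated q.1 q.2 q'.1 q'.2 ∨ ∃ w, (w = u ∨ w = v) ∧ (w = u' ∨ w = v') ∧
        WideCorner q.1 q.2 q'.1 q'.2 (K4Vertex w) := by
  decide +kernel

theorem K4Drawing_nonCrossing : NonCrossing K4Drawing := by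
  refine ⟨fun u v h => K4Path_simple u v h.ne, fun u v h => ?_, fun u v u' v' h h' hne => ?_⟩
  · ext x
    constructor
    · rintro ⟨hx, w, rfl⟩
      by_contra hw
      have hwu : w ≠ u := fun e => hw (Or.inl (e ▸ rfl))
      have hwv : w ≠ v := fun e => hw (Or.inr (e ▸ rfl))
      obtain ⟨q, hq, hxq⟩ := mem_polyImage_map.mp hx
      exact Set.disjoint_left.mp (K4Path_vertex_separated u v w h.ne hwu hwv q hq).disjoint hxq
        (left_mem_segment _ _ _)
    · rintro (rfl | rfl)
      · exact ⟨head_mem_polyImage_K4Path h.ne, u, rfl⟩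
      · exact ⟨last_mem_polyImage_K4Path h.ne, v, rfl⟩
  · ext x
    constructor
    · rintro ⟨hx, hx'⟩
      obtain ⟨q, hq, hxq⟩ := mem_polyImage_map.mp hx
      obtain ⟨q', hq', hxq'⟩ := mem_polyImage_map.mp hx'
      rcases K4Path_pair_separated u v u' v' h.ne h'.ne hne q hq q' hq' with
        hs | ⟨w, hw, hw', hm⟩
      · exact (Set.disjoint_left.mp hs.disjoint hxq hxq').elim
      · exact ⟨w, ⟨hw, hw'⟩, (hm.segment_inter.subset ⟨hxq, hxq'⟩).symm⟩
    · rintro ⟨w, ⟨hw, hw'⟩, rfl⟩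
      constructor
      · rcases hw with rfl | rfl
        exacts [head_mem_polyImage_K4Path h.ne, last_mem_polyImage_K4Path h.ne]
      · rcases hw' with rfl | rfl
        exacts [head_mem_polyImage_K4Path h'.ne, last_mem_polyImage_K4Path h'.ne]

theorem K4Path_bend_wide : ∀ u v : Fin 4, u ≠ v → ∀ a ∈ K4Path u v, ∀ q ∈ K4Path u v,
    ∀ b ∈ K4Path u v, [a, q, b] <:+: K4Path u v → WideAngle (a - q) (b - q) := by
  decide +kernel

theorem K4Path_vertex_wide : ∀ v u w : Fin 4, v ≠ u → v ≠ w → u ≠ w →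
    ∀ a ∈ (K4Path v u)[1]?, ∀ b ∈ (K4Path v w)[1]?,
      WideAngle (a - K4Vertex v) (b - K4Vertex v) := by
  decide +kernel

theorem K4Drawing_angularRes : AngularResAtLeast K4Drawing (2 * Real.pi / 3) := by
  constructor
  · rintro u v h _ _ _ hinf
    obtain ⟨l, hl, hmap⟩ := (List.infix_map_iff).mp hinf
    obtain ⟨a, l₁, rfl, rfl, h₁⟩ := List.map_eq_cons_iff.mp hmap.symm
    obtain ⟨q, l₂, rfl, rfl, h₂⟩ := List.map_eq_cons_iff.mp h₁
    obtain ⟨b, l₃, rfl, rfl, h₃⟩ := List.map_eq_cons_iff.mp h₂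
    obtain rfl := List.map_eq_nil_iff.mp h₃
    have hs := hl.subset
    exact (K4Path_bend_wide u v h.ne a (hs (by simp)) q (hs (by simp)) b (hs (by simp))
      hl).angle_ge
  · intro v u w hu hw huw a b ha hb
    change ((K4Path v u).map latticePt)[1]? = some a at ha
    change ((K4Path v w).map latticePt)[1]? = some b at hb
    rw [List.getElem?_map, Option.map_eq_some_iff] at ha hb
    obtain ⟨a, ha, rfl⟩ := ha
    obtain ⟨b, hb, rfl⟩ := hb
    exact (K4Path_vertex_wide v u w hu.ne hw.ne huw a ha b hb).angle_ge

/-- The complete graph `K₄` has a non-crossing polyline drawing in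
ℝ³ with all four vertices at integer coordinates, at most two bends per edge, and
angular resolution at least `2π/3` (120°). -/
theorem K4_two_bend_drawing :
    ∃ D : PolylineDrawing (⊤ : SimpleGraph (Fin 4)),
      NonCrossing D ∧ MaxBends D 2 ∧ AngularResAtLeast D (2 * Real.pi / 3) ∧
      ∀ v : Fin 4, ∀ i : Fin 3, ∃ m : ℤ, D.p v i = (m : ℝ) := by
  refine ⟨K4Drawing, K4Drawing_nonCrossing, fun u v h => ?_, K4Drawing_angularRes,
    fun v i => ⟨K4Vertex v i, rfl⟩⟩
  change ((K4Path u v).map latticePt).length ≤ 4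
  rw [List.length_map, K4Path_length u v h.ne]
end
end

section
/- Let G be a finite simple graph with maximum degree at most 3 consisting of a cycle C on n ≥ 4 vertices together with some number of degree-one vertices each adjacent to a vertex of C, and suppose each degree-one vertex ℓ is labeled σ(ℓ) ∈ {+1, −1}. Then G has a non-crossing polyline drawing in ℝ³ such that: the drawing has angular resolution at least 2π/3; every edge of C is drawn with at most 2 bends; every edge joining a degree-one vertex to C is drawn as a straight segment with no bends; every degree-one vertex ℓ with neighbor v satisfies p(ℓ) = p(v) + (0,0,σ(ℓ)), so that all such edges are parallel to the z-axis, positively labeled vertices lie above their neighbors and negatively labeled vertices lie below; and no three vertices of C project to collinear points under the orthogonal projection to the xy-plane. -/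
open InnerProductGeometry

noncomputable section

variable {V : Type*} {G : SimpleGraph V}

/-- The point of `ℝ³` with horizontal projection `z` and height `h`. -/
def ptOf (z : ℂ) (h : ℝ) : Pt := !₂[z.re, z.im, h]

/-- The horizontal projection of a point. -/
def horiz (X : Pt) : ℂ := ⟨X 0, X 1⟩

@[simp] lemma ptOf_zero (z : ℂ) (h : ℝ) : ptOf z h 0 = z.re := rfl
@[simp] lemma ptOf_one (z : ℂ) (h : ℝ) : ptOf z h 1 = z.im := rfl
@[simp] lemma ptOf_two (z : ℂ) (h : ℝ) : ptOf z h 2 = h := rfl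
@[simp] lemma horiz_ptOf (z : ℂ) (h : ℝ) : horiz (ptOf z h) = z := rfl

lemma horiz_smul_add_smul (a b : ℝ) (X Y : Pt) :
    horiz (a • X + b • Y) = a • horiz X + b • horiz Y := by
  apply Complex.ext <;> simp [horiz]

lemma inner_eq_coords (X Y : Pt) :
    inner ℝ X Y = X 0 * Y 0 + X 1 * Y 1 + X 2 * Y 2 := by
  simp [PiLp.inner_apply, Fin.sum_univ_three, mul_comm]

/-- A criterion for two vectors to form an angle of at least `2π/3`. -/
lemma two_pi_div_three_le_angle {X Y : Pt} (hneg : inner ℝ X Y < 0)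
    (h : inner ℝ X X * inner ℝ Y Y ≤ 4 * (inner ℝ X Y) ^ 2) :
    2 * Real.pi / 3 ≤ angle X Y := by
  have hX : X ≠ 0 := by rintro rfl; simp at hneg
  have hY : Y ≠ 0 := by rintro rfl; simp at hneg
  have hpos : 0 < ‖X‖ * ‖Y‖ := by positivity
  rw [real_inner_self_eq_norm_sq, real_inner_self_eq_norm_sq] at h
  have hle : ‖X‖ * ‖Y‖ ≤ -(2 * inner ℝ X Y) := by
    apply le_of_sq_le_sq _ (by linarith)
    nlinarith
  have hcos : Real.cos (2 * Real.pi / 3) = -(1 / 2) := by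
    rw [show 2 * Real.pi / 3 = Real.pi - Real.pi / 3 by ring, Real.cos_pi_sub,
      Real.cos_pi_div_three]
  have hpi := Real.pi_pos
  rw [angle, ← Real.arccos_cos (x := 2 * Real.pi / 3) (by linarith) (by linarith), hcos]
  apply Real.arccos_le_arccos
  rw [div_le_iff₀ hpos]
  linarith

/-- A polyline with at most two bends is simple if a linear functional increases along it. -/
lemma simplePolyline_of_strictMono {a b c d : Pt} (g : Pt →ₗ[ℝ] ℝ)
    (hab : g a < g b) (hbc : g b < g c) (hcd : g c < g d) :
    SimplePolyline [a, b, c, d] := by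
  have key : ∀ {x y z : Pt}, g x < g y → g y < g z → segment ℝ x y ∩ segment ℝ y z = {y} := by
    intro x y z hxy hyz
    ext w
    simp only [Set.mem_inter_iff, Set.mem_singleton_iff]
    refine ⟨?_, by rintro rfl; exact ⟨right_mem_segment ℝ x w, left_mem_segment ℝ w z⟩⟩
    rintro ⟨⟨s, t, hs, ht, hst, rfl⟩, ⟨s', t', hs', ht', hst', h⟩⟩
    have hg := congrArg g h
    simp only [map_add, map_smul, smul_eq_mul] at hg
    obtain rfl : t = 1 - s := by linarith
    obtain rfl : t' = 1 - s' := by linarith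
    have : s = 0 := by nlinarith
    subst this
    simp
  refine ⟨?_, ?_⟩
  · have hne : ∀ {x y : Pt}, g x < g y → x ≠ y := fun h e => (e ▸ h).ne rfl
    simp [List.Chain', hne hab, hne hbc, hne hcd]
  · intro i j hi hj hij
    simp only [List.length_cons, List.length_nil] at hi hj
    have hj' : j < 3 := by omega
    interval_cases j <;> interval_cases i
    · simpa using key hab hbc
    · simp only [List.get_eq_getElem]
      simp only [List.getElem_cons_zero, List.getElem_cons_succ, zero_add]
      rw [if_neg (by norm_num), Set.eq_empty_iff_forall_notMem]
      rintro w ⟨⟨s, t, hs, ht, hst, rfl⟩, ⟨s', t', hs', ht', hst', h⟩⟩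
      have hg := congrArg g h
      simp only [map_add, map_smul, smul_eq_mul] at hg
      obtain rfl : t = 1 - s := by linarith
      obtain rfl : t' = 1 - s' := by linarith
      nlinarith
    · simpa using key hbc hcd

/-- Half-open sectors spanned by consecutive roots of unity are pairwise disjoint. -/
lemma sector_unique {n : ℕ} [NeZero n] (hn : 4 ≤ n) {i j : ZMod n} {l m l' m' : ℝ}
    (hl : 0 < l) (hm : 0 ≤ m) (hl' : 0 < l') (hm' : 0 ≤ m')
    (h : l • (ZMod.toCircle i : ℂ) + m • (ZMod.toCircle (i + 1) : ℂ) =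
      l' • (ZMod.toCircle j : ℂ) + m' • (ZMod.toCircle (j + 1) : ℂ)) : i = j := by
  have hn0 : (0 : ℝ) < n := by positivity
  have hn4 : (4 : ℝ) ≤ n := by exact_mod_cast hn
  have hpi := Real.pi_pos
  set α : ℝ := 2 * Real.pi / n with hα
  have hα0 : 0 < α := by positivity
  have hαn : n * α = 2 * Real.pi := by rw [hα]; field_simp
  have hαpi : α < Real.pi := by nlinarith
  have hval : ∀ k : ZMod n, (ZMod.toCircle k : ℂ) = Complex.exp ((α * k.val : ℝ) * Complex.I) := by
    intro k
    rw [ZMod.toCircle_apply]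
    congr 1
    rw [hα]; push_cast; ring
  have hone : (ZMod.toCircle (1 : ZMod n) : ℂ) = Complex.exp (α * Complex.I) := by
    rw [hval]
    have : Fact (1 < n) := ⟨by omega⟩
    simp [ZMod.val_one]
  have polar : ∀ {l m : ℝ}, 0 < l → 0 ≤ m → ∃ r φ : ℝ, 0 < r ∧ 0 ≤ φ ∧ φ < α ∧
      (l : ℂ) + m * Complex.exp (α * Complex.I) = r * Complex.exp (φ * Complex.I) := by
    intro l m hl hm
    have hsin := Real.sin_pos_of_pos_of_lt_pi hα0 hαpi
    set z := (l : ℂ) + m * Complex.exp (α * Complex.I) with hz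
    have hre : z.re = l + m * Real.cos α := by
      simp [hz, Complex.exp_ofReal_mul_I_re]
    have him : z.im = m * Real.sin α := by
      simp [hz, Complex.exp_ofReal_mul_I_im]
    have hz0 : z ≠ 0 := by
      intro h0
      rw [h0] at hre him
      have : m = 0 := by
        rcases mul_eq_zero.1 him.symm with h | h
        · exact h
        · exact absurd h hsin.ne'
      simp [this] at hre
      exact hl.ne hre
    have hr : 0 < ‖z‖ := norm_pos_iff.2 hz0
    have harg : 0 ≤ z.arg := Complex.arg_nonneg_iff.2 (by rw [him]; positivity)
    refine ⟨‖z‖, z.arg, hr, harg, ?_, (Complex.norm_mul_exp_arg_mul_I z).symm⟩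
    by_contra! hge
    have h1 := Real.sin_nonneg_of_nonneg_of_le_pi (x := z.arg - α) (by linarith)
      (by linarith [Complex.arg_le_pi z])
    rw [Real.sin_sub] at h1
    have h2 := mul_nonneg hr.le h1
    have e1 := Complex.norm_mul_cos_arg z
    have e2 := Complex.norm_mul_sin_arg z
    have e3 := Real.sin_sq_add_cos_sq α
    have : z.im * Real.cos α - z.re * Real.sin α = - (l * Real.sin α) := by
      rw [hre, him]; ring
    have : 0 ≤ z.im * Real.cos α - z.re * Real.sin α := by
      rw [← e1, ← e2]; linarith
    nlinarith [mul_pos hl hsin]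
  obtain ⟨r, φ, hr, hφ, hφα, e⟩ := polar hl hm
  obtain ⟨r', φ', hr', hφ', hφα', e'⟩ := polar hl' hm'
  have expand : ∀ (k : ZMod n) (l m r φ : ℝ),
      (l : ℂ) + m * Complex.exp (α * Complex.I) = r * Complex.exp (φ * Complex.I) →
      l • (ZMod.toCircle k : ℂ) + m • (ZMod.toCircle (k + 1) : ℂ) =
        r * Complex.exp ((α * k.val + φ : ℝ) * Complex.I) := by
    intro k l m r φ e
    rw [AddChar.map_add_eq_mul, Circle.coe_mul, hone, hval]
    push_cast
    rw [add_mul, Complex.exp_add, mul_left_comm, ← e]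
    simp only [Complex.real_smul]
    ring
  rw [expand i l m r φ e, expand j l' m' r' φ' e'] at h
  have hnorm := congrArg norm h
  simp only [norm_mul, Complex.norm_exp_ofReal_mul_I, Complex.norm_real, mul_one,
    Real.norm_of_nonneg hr.le, Real.norm_of_nonneg hr'.le] at hnorm
  subst hnorm
  have hexp := mul_left_cancel₀ (by exact_mod_cast hr.ne') h
  obtain ⟨k, hk⟩ := Complex.exp_eq_exp_iff_exists_int.1 hexp
  have hk' : α * i.val + φ = α * j.val + φ' + k * (2 * Real.pi) := by
    have := congrArg Complex.im hk
    simpa using this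
  have bound : ∀ (k : ZMod n) {φ : ℝ}, 0 ≤ φ → φ < α →
      0 ≤ α * k.val + φ ∧ α * k.val + φ < 2 * Real.pi := by
    intro k φ h0 h1
    have : (k.val : ℝ) + 1 ≤ n := by exact_mod_cast ZMod.val_lt k
    refine ⟨by positivity, ?_⟩
    nlinarith
  have b1 := bound i hφ hφα
  have b2 := bound j hφ' hφα'
  have k1 : (-1 : ℝ) < k := by nlinarith
  have k2 : (k : ℝ) < 1 := by nlinarith
  have hk0 : k = 0 := by
    have : (-1 : ℤ) < k := by exact_mod_cast k1
    have : k < (1 : ℤ) := by exact_mod_cast k2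
    omega
  subst hk0
  have v1 : (i.val : ℝ) < j.val + 1 := by push_cast at hk'; nlinarith
  have v2 : (j.val : ℝ) < i.val + 1 := by push_cast at hk'; nlinarith
  have v1' : i.val < j.val + 1 := by exact_mod_cast v1
  have v2' : j.val < i.val + 1 := by exact_mod_cast v2
  exact ZMod.val_injective n (by omega)

/-- The bend of a cycle edge near its endpoint `x`, the other endpoint being `y`, when the
cycle vertices project to unit vectors with consecutive inner products `c`. -/
def bend (c : ℝ) (x y : ℂ) : Pt := ptOf ((2 * (1 + c))⁻¹ • ((2 + c) • x + y)) 0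

lemma simplePolyline_cycleEdge {c : ℝ} (hc : 0 ≤ c) (hc1 : c < 1) {x y : ℂ} (h k : ℝ)
    (hx : x.re ^ 2 + x.im ^ 2 = 1) (hy : y.re ^ 2 + y.im ^ 2 = 1)
    (hxy : x.re * y.re + x.im * y.im = c) :
    SimplePolyline [ptOf x h, bend c x y, bend c y x, ptOf y k] := by
  have h2 : 0 < 2 * (1 + c) := by positivity
  have hg : ∀ X : Pt, innerₗ Pt (ptOf (y - x) 0) X =
      (y.re - x.re) * X 0 + (y.im - x.im) * X 1 := by
    intro X; simp [inner_eq_coords]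
  apply simplePolyline_of_strictMono (innerₗ Pt (ptOf (y - x) 0))
  all_goals
    simp only [hg, bend, ptOf_zero, ptOf_one, Complex.smul_re, Complex.smul_im, Complex.add_re,
      Complex.add_im, smul_eq_mul]
  · have : (y.re - x.re) * ((2 * (1 + c))⁻¹ * ((2 + c) * x.re + y.re)) +
      (y.im - x.im) * ((2 * (1 + c))⁻¹ * ((2 + c) * x.im + y.im)) = - (1 - c) / 2 := by
      field_simp
      linear_combination (-2 - c) * hx + hy + (1 + c) * hxy
    rw [this]
    nlinarith
  · have e1 : (y.re - x.re) * ((2 * (1 + c))⁻¹ * ((2 + c) * x.re + y.re)) +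
      (y.im - x.im) * ((2 * (1 + c))⁻¹ * ((2 + c) * x.im + y.im)) = - (1 - c) / 2 := by
      field_simp
      linear_combination (-2 - c) * hx + hy + (1 + c) * hxy
    have e2 : (y.re - x.re) * ((2 * (1 + c))⁻¹ * ((2 + c) * y.re + x.re)) +
      (y.im - x.im) * ((2 * (1 + c))⁻¹ * ((2 + c) * y.im + x.im)) = (1 - c) / 2 := by
      field_simp
      linear_combination (2 + c) * hy - hx - (1 + c) * hxy
    rw [e1, e2]
    linarith
  · have : (y.re - x.re) * ((2 * (1 + c))⁻¹ * ((2 + c) * y.re + x.re)) +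
      (y.im - x.im) * ((2 * (1 + c))⁻¹ * ((2 + c) * y.im + x.im)) = (1 - c) / 2 := by
      field_simp
      linear_combination (2 + c) * hy - hx - (1 + c) * hxy
    rw [this]
    nlinarith

lemma inner_ptOf (z w : ℂ) (h k : ℝ) :
    inner ℝ (ptOf z h) (ptOf w k) = z.re * w.re + z.im * w.im + h * k := by
  simp [inner_eq_coords]

lemma ptOf_sub_ptOf (z w : ℂ) (h k : ℝ) : ptOf z h - ptOf w k = ptOf (z - w) (h - k) := by
  ext t; fin_cases t <;> simp [ptOf]

lemma bend_sub_ptOf {c : ℝ} (hc : 0 ≤ c) (x y : ℂ) (h : ℝ) :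
    bend c x y - ptOf x h = ptOf ((2 * (1 + c))⁻¹ • (y - c • x)) (-h) := by
  have h2 : 0 < 1 + c := by positivity
  rw [bend, ptOf_sub_ptOf, zero_sub]
  congr 1
  apply Complex.ext <;>
    simp only [Complex.sub_re, Complex.sub_im, Complex.smul_re, Complex.smul_im, Complex.add_re,
      Complex.add_im, smul_eq_mul] <;> field_simp <;> ring

lemma bend_sub_bend {c : ℝ} (hc : 0 ≤ c) (x y : ℂ) :
    bend c y x - bend c x y = ptOf ((1 / 2 : ℝ) • (y - x)) 0 := by
  have h2 : 0 < 1 + c := by positivity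
  rw [bend, bend, ptOf_sub_ptOf, sub_zero]
  congr 1
  apply Complex.ext <;>
    simp only [Complex.sub_re, Complex.sub_im, Complex.smul_re, Complex.smul_im, Complex.add_re,
      Complex.add_im, smul_eq_mul] <;> field_simp <;> ring

lemma two_pi_div_three_le_angle_bend {c : ℝ} (hc : 0 ≤ c) (hc1 : c < 1) {x y : ℂ} {h : ℝ}
    (hx : x.re ^ 2 + x.im ^ 2 = 1) (hy : y.re ^ 2 + y.im ^ 2 = 1)
    (hxy : x.re * y.re + x.im * y.im = c)
    (hh : h ^ 2 = ((2 * (1 + c))⁻¹) ^ 2 * (1 - c ^ 2) / 3) :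
    2 * Real.pi / 3 ≤ angle (ptOf x h - bend c x y) (bend c y x - bend c x y) := by
  have h2 : 0 < 1 + c := by positivity
  rw [← neg_sub (bend c x y), bend_sub_ptOf hc, bend_sub_bend hc]
  set κ := (2 * (1 + c))⁻¹ with hκ
  have hκ2 : κ * (1 + c) = 1 / 2 := by rw [hκ]; field_simp
  apply two_pi_div_three_le_angle
  all_goals
    simp only [inner_neg_left, inner_neg_right, inner_ptOf, Complex.sub_re, Complex.sub_im,
      Complex.smul_re, Complex.smul_im, smul_eq_mul]
  · have e : κ * (y.re - c * x.re) * (1 / 2 * (y.re - x.re)) +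
        κ * (y.im - c * x.im) * (1 / 2 * (y.im - x.im)) + -h * 0 = (1 - c) / 4 := by
      linear_combination κ / 2 * hy + κ / 2 * c * hx - κ / 2 * (1 + c) * hxy + (1 - c) / 2 * hκ2
    rw [e]; linarith
  · have e : κ * (y.re - c * x.re) * (1 / 2 * (y.re - x.re)) +
        κ * (y.im - c * x.im) * (1 / 2 * (y.im - x.im)) + -h * 0 = (1 - c) / 4 := by
      linear_combination κ / 2 * hy + κ / 2 * c * hx - κ / 2 * (1 + c) * hxy + (1 - c) / 2 * hκ2
    have e1 : κ * (y.re - c * x.re) * (κ * (y.re - c * x.re)) +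
        κ * (y.im - c * x.im) * (κ * (y.im - c * x.im)) + -h * -h =
          2 / 3 * κ * (1 - c) := by
      linear_combination hh + κ ^ 2 * hy + κ ^ 2 * c ^ 2 * hx - 2 * κ ^ 2 * c * hxy +
        κ * (1 - c) * 4 / 3 * hκ2
    have e2 : 1 / 2 * (y.re - x.re) * (1 / 2 * (y.re - x.re)) +
        1 / 2 * (y.im - x.im) * (1 / 2 * (y.im - x.im)) + 0 * 0 = (1 - c) / 2 := by
      linear_combination hy / 4 + hx / 4 - hxy / 2
    rw [e, neg_neg, e1, e2]
    have : 0 ≤ κ * c := by positivity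
    have hκle : κ ≤ 1 / 2 := by linarith
    nlinarith [mul_nonneg (sub_nonneg.2 hc1.le) (sub_nonneg.2 hc1.le)]

/-- Two cycle edges leaving a cycle vertex in opposite horizontal directions. -/
lemma two_pi_div_three_le_angle_opposite {c : ℝ} (hc : 0 ≤ c) (hc1 : c < 1) {x y z : ℂ} {h : ℝ}
    (hx : x.re ^ 2 + x.im ^ 2 = 1) (hy : y.re ^ 2 + y.im ^ 2 = 1)
    (hxy : x.re * y.re + x.im * y.im = c) (hz : z = (2 * c) • x - y)
    (hh : h ^ 2 = ((2 * (1 + c))⁻¹) ^ 2 * (1 - c ^ 2) / 3) :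
    2 * Real.pi / 3 ≤ angle (bend c x y - ptOf x h) (bend c x z - ptOf x h) := by
  have h2 : 0 < 1 + c := by positivity
  have hz' : z - c • x = -(y - c • x) := by rw [hz, mul_smul, two_smul]; abel
  rw [bend_sub_ptOf hc, bend_sub_ptOf hc, hz']
  set κ := (2 * (1 + c))⁻¹ with hκ
  have hκ0 : 0 < κ := by positivity
  have hs : (y.re - c * x.re) ^ 2 + (y.im - c * x.im) ^ 2 = 1 - c ^ 2 := by
    linear_combination hy + c ^ 2 * hx - 2 * c * hxy
  have hpos : 0 < κ ^ 2 * (1 - c ^ 2) := mul_pos (by positivity) (by nlinarith)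
  apply two_pi_div_three_le_angle
  all_goals
    simp only [inner_ptOf, Complex.sub_re, Complex.sub_im, Complex.neg_re, Complex.neg_im,
      Complex.smul_re, Complex.smul_im, smul_eq_mul]
  · nlinarith
  · apply le_of_eq
    set a := y.re - c * x.re
    set b := y.im - c * x.im
    have e : κ ^ 2 * a ^ 2 + κ ^ 2 * b ^ 2 = 3 * h ^ 2 := by
      linear_combination κ ^ 2 * hs - 3 * hh
    linear_combination (-3 * (κ ^ 2 * a ^ 2 + κ ^ 2 * b ^ 2) + h ^ 2) * e

/-- A cycle edge and a vertical pendant edge leaving the same cycle vertex. -/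
lemma two_pi_div_three_le_angle_vertical {c : ℝ} (hc : 0 ≤ c) {x y : ℂ}
    {h s : ℝ} (h0 : 0 < h) (hs : s = 1 ∨ s = -1)
    (hx : x.re ^ 2 + x.im ^ 2 = 1) (hy : y.re ^ 2 + y.im ^ 2 = 1)
    (hxy : x.re * y.re + x.im * y.im = c)
    (hh : h ^ 2 = ((2 * (1 + c))⁻¹) ^ 2 * (1 - c ^ 2) / 3) :
    2 * Real.pi / 3 ≤ angle (bend c x y - ptOf x (s * h))
      (ptOf x (s * (h + 1)) - ptOf x (s * h)) := by
  rw [bend_sub_ptOf hc, ptOf_sub_ptOf]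
  set κ := (2 * (1 + c))⁻¹ with hκ
  have hs2 : s ^ 2 = 1 := by rcases hs with rfl | rfl <;> norm_num
  apply two_pi_div_three_le_angle
  all_goals
    simp only [inner_ptOf, Complex.sub_re, Complex.sub_im,
      Complex.smul_re, Complex.smul_im, smul_eq_mul]
  · nlinarith
  · apply le_of_eq
    have e : κ ^ 2 * (y.re - c * x.re) ^ 2 + κ ^ 2 * (y.im - c * x.im) ^ 2 = 3 * h ^ 2 := by
      linear_combination κ ^ 2 * hy + κ ^ 2 * c ^ 2 * hx - 2 * κ ^ 2 * c * hxy - 3 * hh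
    linear_combination s ^ 2 * e - 3 * s ^ 2 * h ^ 2 * hs2

/-- The points projecting into the open sector spanned by `x` and `y`. -/
def openSector (x y : ℂ) : Set Pt :=
  {X | ∃ l m : ℝ, 0 < l ∧ 0 < m ∧ horiz X = l • x + m • y}

lemma openSector_comm (x y : ℂ) : openSector x y = openSector y x := by
  ext X
  constructor <;> rintro ⟨l, m, hl, hm, h⟩ <;> exact ⟨m, l, hm, hl, by rw [h, add_comm]⟩

lemma polyImage_pair (a b : Pt) : polyImage [a, b] = segment ℝ a b := by
  simp [polyImage]

lemma polyImage_cycleEdge_subset {c : ℝ} (hc : 0 ≤ c) (x y : ℂ) (h k : ℝ) :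
    polyImage [ptOf x h, bend c x y, bend c y x, ptOf y k] ⊆
      {ptOf x h, ptOf y k} ∪ openSector x y := by
  have h2 : 0 < 2 * (1 + c) := by positivity
  have first : ∀ (x y : ℂ) (h : ℝ), segment ℝ (ptOf x h) (bend c x y) ⊆
      {ptOf x h} ∪ openSector x y := by
    rintro x y h X ⟨s, t, hs, ht, hst, rfl⟩
    rcases ht.eq_or_lt with rfl | ht
    · left; simp [show s = 1 by linarith]
    · right
      refine ⟨s + t * (2 * (1 + c))⁻¹ * (2 + c), t * (2 * (1 + c))⁻¹, by positivity,
        by positivity, ?_⟩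
      rw [horiz_smul_add_smul, bend, horiz_ptOf, horiz_ptOf]
      module
  intro X hX
  simp only [polyImage, List.tail_cons, List.zip_cons_cons, List.zip_nil_right, List.mem_cons,
    List.not_mem_nil, or_false, Set.iUnion_iUnion_eq_or_left, Set.iUnion_iUnion_eq_left,
    Set.mem_union] at hX
  rcases hX with hX | hX | hX
  · rcases first x y h hX with h | h
    · left; left; exact h
    · right; exact h
  · right
    obtain ⟨s, t, hs, ht, hst, rfl⟩ := hX
    refine ⟨(2 * (1 + c))⁻¹ * (s * (2 + c) + t), (2 * (1 + c))⁻¹ * (s + t * (2 + c)), ?_, ?_, ?_⟩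
    · apply mul_pos (by positivity); nlinarith
    · apply mul_pos (by positivity); nlinarith
    · rw [horiz_smul_add_smul, bend, bend, horiz_ptOf, horiz_ptOf]
      module
  · rw [segment_symm] at hX
    rcases first y x k hX with h | h
    · left; right; exact h
    · right; rwa [openSector_comm]

lemma endpoints_mem_polyImage (a b c d : Pt) :
    a ∈ polyImage [a, b, c, d] ∧ d ∈ polyImage [a, b, c, d] := by
  simp only [polyImage, List.tail_cons, List.zip_cons_cons, List.zip_nil_right, List.mem_cons,
    List.not_mem_nil, or_false, Set.iUnion_iUnion_eq_or_left, Set.iUnion_iUnion_eq_left,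
    Set.mem_union]
  exact ⟨Or.inl (left_mem_segment ℝ a b), Or.inr (Or.inr (right_mem_segment ℝ c d))⟩

lemma horiz_of_mem_segment_vertical {x : ℂ} {h k : ℝ} {X : Pt}
    (hX : X ∈ segment ℝ (ptOf x h) (ptOf x k)) : horiz X = x := by
  obtain ⟨s, t, hs, ht, hst, rfl⟩ := hX
  rw [horiz_smul_add_smul, horiz_ptOf, horiz_ptOf, ← add_smul, hst, one_smul]

/-- No line meets the unit circle in three points. -/
lemma not_collinear_of_mem_circle {x y z : ℂ} (hx : x.re ^ 2 + x.im ^ 2 = 1)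
    (hy : y.re ^ 2 + y.im ^ 2 = 1) (hz : z.re ^ 2 + z.im ^ 2 = 1)
    (hxy : x ≠ y) (hxz : x ≠ z) (hyz : y ≠ z) :
    ¬ Collinear ℝ ({![x.re, x.im], ![y.re, y.im], ![z.re, z.im]} : Set (Fin 2 → ℝ)) := by
  intro hcol
  obtain ⟨v, hv⟩ := (collinear_iff_of_mem (p₀ := ![x.re, x.im]) (by simp)).1 hcol
  obtain ⟨r, hr⟩ := hv ![y.re, y.im] (by simp)
  obtain ⟨s, hs⟩ := hv ![z.re, z.im] (by simp)
  have r0 : y.re = r * v 0 + x.re := by simpa using congrFun hr 0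
  have r1 : y.im = r * v 1 + x.im := by simpa using congrFun hr 1
  have s0 : z.re = s * v 0 + x.re := by simpa using congrFun hs 0
  have s1 : z.im = s * v 1 + x.im := by simpa using congrFun hs 1
  have hr0 : r ≠ 0 := by
    rintro rfl; exact hxy (Complex.ext (by simp [r0]) (by simp [r1]))
  have hs0 : s ≠ 0 := by
    rintro rfl; exact hxz (Complex.ext (by simp [s0]) (by simp [s1]))
  have hrs : r - s ≠ 0 := by
    intro h
    obtain rfl : r = s := by linarith
    exact hyz (Complex.ext (by rw [r0, s0]) (by rw [r1, s1]))
  rw [r0, r1] at hy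
  rw [s0, s1] at hz
  have e1 : 2 * (x.re * v 0 + x.im * v 1) + r * (v 0 ^ 2 + v 1 ^ 2) = 0 :=
    mul_left_cancel₀ hr0 (by linear_combination hy - hx)
  have e2 : 2 * (x.re * v 0 + x.im * v 1) + s * (v 0 ^ 2 + v 1 ^ 2) = 0 :=
    mul_left_cancel₀ hs0 (by linear_combination hz - hx)
  have e3 : v 0 ^ 2 + v 1 ^ 2 = 0 := mul_left_cancel₀ hrs (by linear_combination e1 - e2)
  have v0 : v 0 = 0 := by nlinarith [sq_nonneg (v 0), sq_nonneg (v 1)]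
  have v1 : v 1 = 0 := by nlinarith [sq_nonneg (v 0), sq_nonneg (v 1)]
  exact hxy (Complex.ext (by simp [r0, v0]) (by simp [r1, v1]))

/-- In a cycle with pendant vertices and maximum degree three, every vertex has a cycle vertex
`base v` as itself or as its unique neighbor, distinct pendant vertices have distinct bases, and
the labels of the pendant vertices extend to a sign for each cycle vertex. -/
lemma exists_base_and_sign {V : Type} [Fintype V] [DecidableEq V]
    (G : SimpleGraph V) [DecidableRel G.Adj] (hdeg : ∀ v, G.degree v ≤ 3)
    (n : ℕ) (hn : 4 ≤ n) (f : ZMod n → V) (hf : Function.Injective f)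
    (hcyc : ∀ i j : ZMod n, G.Adj (f i) (f j) ↔ (j = i + 1 ∨ i = j + 1))
    (hleaf : ∀ v : V, v ∉ Set.range f →
      (∃! w : V, G.Adj v w) ∧ ∀ w : V, G.Adj v w → w ∈ Set.range f)
    (σ : V → ℤ) (hσ : ∀ v ∉ Set.range f, σ v = 1 ∨ σ v = -1) :
    ∃ (base : V → ZMod n) (s : ZMod n → ℝ), (∀ i, base (f i) = i) ∧
      (∀ v ∉ Set.range f, ∀ w, G.Adj v w ↔ w = f (base v)) ∧
      (∀ v ∉ Set.range f, ∀ w ∉ Set.range f, base v = base w → v = w) ∧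
      (∀ i, s i = 1 ∨ s i = -1) ∧
      (∀ v ∉ Set.range f, (σ v : ℝ) = s (base v)) := by
  classical
  have hex : ∀ v, ∃ i, v = f i ∨ (v ∉ Set.range f ∧ G.Adj v (f i)) := by
    intro v
    by_cases hv : v ∈ Set.range f
    · obtain ⟨i, rfl⟩ := hv
      exact ⟨i, Or.inl rfl⟩
    · obtain ⟨⟨w, hw, -⟩, hall⟩ := hleaf v hv
      obtain ⟨i, rfl⟩ := hall w hw
      exact ⟨i, Or.inr ⟨hv, hw⟩⟩
  choose base hbase using hex
  have hadj : ∀ v ∉ Set.range f, G.Adj v (f (base v)) := by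
    intro v hv
    rcases hbase v with h | h
    · exact absurd ⟨_, h.symm⟩ hv
    · exact h.2
  have huniq : ∀ v ∉ Set.range f, ∀ w ∉ Set.range f, base v = base w → v = w := by
    intro v hv w hw hvw
    by_contra hne
    have hnot : ∀ k : ℕ, 0 < k → k < n → (k : ZMod n) ≠ 0 := by
      intro k h0 h1 h2
      exact absurd (Nat.le_of_dvd h0 ((ZMod.natCast_eq_zero_iff k n).1 h2)) (by omega)
    have h12 : f (base v + 1) ≠ f (base v - 1) := by
      intro h
      have h' := hf h
      apply hnot 2 (by norm_num) (by omega)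
      push_cast
      linear_combination h'
    have hsub : ({f (base v + 1), f (base v - 1), v, w} : Finset V) ⊆
        G.neighborFinset (f (base v)) := by
      intro x hx
      rw [SimpleGraph.mem_neighborFinset]
      simp only [Finset.mem_insert, Finset.mem_singleton] at hx
      rcases hx with rfl | rfl | rfl | rfl
      · rw [hcyc]; left; rfl
      · rw [hcyc]; right; ring
      · exact (hadj _ hv).symm
      · rw [hvw]; exact (hadj _ hw).symm
    have hcard := Finset.card_le_card hsub
    rw [SimpleGraph.card_neighborFinset_eq_degree] at hcard
    have hr : ∀ i x, x ∉ Set.range f → f i ≠ x := fun i x hx h => hx ⟨i, h⟩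
    rw [Finset.card_insert_of_notMem, Finset.card_insert_of_notMem, Finset.card_pair hne] at hcard
    · linarith [hdeg (f (base v))]
    · simp [hr _ v hv, hr _ w hw]
    · simp [hr _ v hv, hr _ w hw, h12]
  refine ⟨base, fun i => if h : ∃ v, v ∉ Set.range f ∧ base v = i then (σ h.choose : ℝ) else 1,
    ?_, ?_, huniq, ?_, ?_⟩
  · intro i
    rcases hbase (f i) with h | h
    · exact (hf h).symm
    · exact absurd ⟨i, rfl⟩ h.1
  · intro v hv w
    refine ⟨fun h => (hleaf v hv).1.unique h (hadj v hv), ?_⟩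
    rintro rfl
    exact hadj v hv
  · intro i
    dsimp only
    split_ifs with h
    · exact_mod_cast hσ _ h.choose_spec.1
    · left; rfl
  · intro v hv
    have h : ∃ w, w ∉ Set.range f ∧ base w = base v := ⟨v, hv, rfl⟩
    dsimp only
    rw [dif_pos h]
    rw [← huniq v hv _ h.choose_spec.1 h.choose_spec.2.symm]

/-- Consecutive roots of unity, as unit vectors in the plane. -/
lemma toCircle_facts {n : ℕ} [NeZero n] (hn : 4 ≤ n) :
    ∃ c : ℝ, 0 ≤ c ∧ c < 1 ∧
      (∀ i : ZMod n, (ZMod.toCircle i : ℂ).re ^ 2 + (ZMod.toCircle i : ℂ).im ^ 2 = 1) ∧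
      (∀ i : ZMod n, (ZMod.toCircle i : ℂ).re * (ZMod.toCircle (i + 1) : ℂ).re +
        (ZMod.toCircle i : ℂ).im * (ZMod.toCircle (i + 1) : ℂ).im = c) ∧
      ∀ i : ZMod n, (ZMod.toCircle i : ℂ) =
        (2 * c) • (ZMod.toCircle (i + 1) : ℂ) - (ZMod.toCircle (i + 1 + 1) : ℂ) := by
  have hn4 : (4 : ℝ) ≤ n := by exact_mod_cast hn
  have hpi := Real.pi_pos
  have hone : (ZMod.toCircle (1 : ZMod n) : ℂ) =
      Complex.exp ((2 * Real.pi / n : ℝ) * Complex.I) := by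
    have : Fact (1 < n) := ⟨by omega⟩
    rw [ZMod.toCircle_apply, ZMod.val_one]
    congr 1
    push_cast; ring
  have hunit : ∀ i : ZMod n,
      (ZMod.toCircle i : ℂ).re ^ 2 + (ZMod.toCircle i : ℂ).im ^ 2 = 1 := by
    intro i
    have := Circle.normSq_coe (ZMod.toCircle i)
    rw [Complex.normSq_apply] at this
    linarith
  have hle : 2 * Real.pi / n ≤ Real.pi / 2 := by
    rw [div_le_iff₀ (by positivity)]; nlinarith
  have hpos : 0 < 2 * Real.pi / n := by positivity
  refine ⟨(ZMod.toCircle (1 : ZMod n) : ℂ).re, ?_, ?_, hunit, ?_, ?_⟩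
  · rw [hone, Complex.exp_ofReal_mul_I_re]
    exact Real.cos_nonneg_of_neg_pi_div_two_le_of_le (by linarith) hle
  · rw [hone, Complex.exp_ofReal_mul_I_re, ← Real.cos_zero]
    exact Real.cos_lt_cos_of_nonneg_of_le_pi le_rfl (by linarith) hpos
  · intro i
    rw [AddChar.map_add_eq_mul, Circle.coe_mul, Complex.mul_re, Complex.mul_im]
    linear_combination (ZMod.toCircle (1 : ZMod n) : ℂ).re * hunit i
  · intro i
    have h1 := hunit 1
    rw [AddChar.map_add_eq_mul _ (i + 1) 1, AddChar.map_add_eq_mul _ i 1]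
    simp only [Circle.coe_mul]
    apply Complex.ext <;>
      simp only [Complex.sub_re, Complex.sub_im, Complex.smul_re, Complex.smul_im, Complex.mul_re,
        Complex.mul_im, smul_eq_mul]
    · linear_combination -(ZMod.toCircle i : ℂ).re * h1
    · linear_combination -(ZMod.toCircle i : ℂ).im * h1

/-- Three consecutive entries of a list of length four. -/
lemma infix_of_four {α : Type*} {a q b x y z w : α} (h : [a, q, b] <:+: [x, y, z, w]) :
    (a = x ∧ q = y ∧ b = z) ∨ (a = y ∧ q = z ∧ b = w) := by
  simpa [List.infix_cons_iff, List.cons_prefix_cons] using h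

/-- Let `G` be a graph of maximum degree at most three consisting of a
cycle `C` on `n ≥ 4` vertices (given by an injection `f : ZMod n → V` with the cycle
adjacency) together with degree-one vertices adjacent to vertices of `C`, each labeled
`σ ∈ {+1, -1}`.  Then `G` has a non-crossing polyline drawing with angular resolution at
least `2π/3`, at most two bends on each cycle edge, no bends on the pendant edges, each
degree-one vertex placed exactly one unit above (`σ = 1`) or below (`σ = -1`) its
neighbor in the `z`-direction, and no three cycle vertices projecting to collinear
points in the `xy`-plane. -/
theorem cycle_with_leaves_drawing (V : Type) [Fintype V] [DecidableEq V]
    (G : SimpleGraph V) [DecidableRel G.Adj]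
    (hdeg : ∀ v, G.degree v ≤ 3)
    (n : ℕ) (hn : 4 ≤ n) (f : ZMod n → V) (hf : Function.Injective f)
    (hcyc : ∀ i j : ZMod n, G.Adj (f i) (f j) ↔ (j = i + 1 ∨ i = j + 1))
    (hleaf : ∀ v : V, v ∉ Set.range f →
      (∃! w : V, G.Adj v w) ∧ ∀ w : V, G.Adj v w → w ∈ Set.range f)
    (σ : V → ℤ) (hσ : ∀ v ∉ Set.range f, σ v = 1 ∨ σ v = -1) :
    ∃ D : PolylineDrawing G,
      NonCrossing D ∧
      AngularResAtLeast D (2 * Real.pi / 3) ∧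
      (∀ i j : ZMod n, ∀ h : G.Adj (f i) (f j), (D.seq (f i) (f j) h).length ≤ 4) ∧
      (∀ v : V, v ∉ Set.range f → ∀ w : V, ∀ h : G.Adj v w, (D.seq v w h).length = 2) ∧
      (∀ v : V, v ∉ Set.range f → ∀ w : V, G.Adj v w →
        D.p v 0 = D.p w 0 ∧ D.p v 1 = D.p w 1 ∧ D.p v 2 = D.p w 2 + (σ v : ℝ)) ∧
      (∀ i j k : ZMod n, i ≠ j → i ≠ k → j ≠ k →
        ¬ Collinear ℝ ({![D.p (f i) 0, D.p (f i) 1], ![D.p (f j) 0, D.p (f j) 1],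
            ![D.p (f k) 0, D.p (f k) 1]} : Set (Fin 2 → ℝ))) := by
  classical
  have : NeZero n := ⟨by omega⟩
  obtain ⟨base, s, hbf, hadj, huniq, hs, hσs⟩ :=
    exists_base_and_sign G hdeg n hn f hf hcyc hleaf σ hσ
  obtain ⟨c, hc, hc1, hunit, hstep, hopp⟩ := toCircle_facts hn
  set U : ZMod n → ℂ := fun i => (ZMod.toCircle i : ℂ)
  change ∀ i, (U i).re ^ 2 + (U i).im ^ 2 = 1 at hunit
  change ∀ i, (U i).re * (U (i + 1)).re + (U i).im * (U (i + 1)).im = c at hstep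
  change ∀ i, U i = (2 * c) • U (i + 1) - U (i + 1 + 1) at hopp
  have hsector : ∀ {i j : ZMod n} {l m l' m' : ℝ}, 0 < l → 0 ≤ m → 0 < l' → 0 ≤ m' →
      l • U i + m • U (i + 1) = l' • U j + m' • U (j + 1) → i = j :=
    fun h1 h2 h3 h4 h => sector_unique hn h1 h2 h3 h4 h
  have hUinj : ∀ {i j}, U i = U j → i = j := fun h =>
    hsector one_pos le_rfl one_pos le_rfl (by simpa using h)
  have hUstep : ∀ {i j}, G.Adj (f i) (f j) → (U i).re * (U j).re + (U i).im * (U j).im = c := by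
    intro i j h
    rcases (hcyc i j).1 h with rfl | rfl
    · exact hstep i
    · linarith [hstep j]
  obtain ⟨η, hη0, hη⟩ : ∃ η : ℝ, 0 < η ∧ η ^ 2 = ((2 * (1 + c))⁻¹) ^ 2 * (1 - c ^ 2) / 3 := by
    have : 0 < ((2 * (1 + c))⁻¹) ^ 2 * (1 - c ^ 2) / 3 := by
      have : 0 < 1 - c ^ 2 := by nlinarith
      positivity
    exact ⟨_, Real.sqrt_pos.2 this, Real.sq_sqrt this.le⟩
  have hs2 : ∀ i, (s i * η) ^ 2 = ((2 * (1 + c))⁻¹) ^ 2 * (1 - c ^ 2) / 3 := by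
    intro i
    rcases hs i with h | h <;> rw [h, ← hη] <;> ring
  let p : V → Pt := fun v => if v ∈ Set.range f then ptOf (U (base v)) (s (base v) * η)
    else ptOf (U (base v)) (s (base v) * (η + 1))
  have pf : ∀ i, p (f i) = ptOf (U i) (s i * η) := by
    intro i; simp only [p]; rw [if_pos ⟨i, rfl⟩, hbf]
  have pl : ∀ v ∉ Set.range f, p v = ptOf (U (base v)) (s (base v) * (η + 1)) := by
    intro v hv; simp only [p]; rw [if_neg hv]
  have hp_horiz : ∀ v, horiz (p v) = U (base v) := by
    intro v; simp only [p]; split_ifs <;> rfl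
  have p_inj : Function.Injective p := by
    intro v w h
    have hb : base v = base w := hUinj (by rw [← hp_horiz, ← hp_horiz, h])
    have key : ∀ v w, p v = p w → base v = base w → v ∈ Set.range f → w ∈ Set.range f := by
      rintro v w h hb ⟨i, rfl⟩
      by_contra hw
      rw [pf, pl w hw, ← hb, hbf] at h
      have := congrFun (congrArg (fun X : Pt => (X : Fin 3 → ℝ)) h) 2
      simp only [ptOf_two] at this
      rcases hs i with h | h <;> rw [h] at this <;> linarith
    by_cases hv : v ∈ Set.range f
    · have hw := key v w h hb hv
      obtain ⟨i, rfl⟩ := hv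
      obtain ⟨j, rfl⟩ := hw
      rw [hbf, hbf] at hb
      rw [hb]
    · exact huniq v hv w (fun hw => hv (key w v h.symm hb.symm hw)) hb
  let D : PolylineDrawing G :=
    { p := p
      p_inj := p_inj
      seq := fun v w _ => if v ∈ Set.range f ∧ w ∈ Set.range f then
          [p v, bend c (U (base v)) (U (base w)), bend c (U (base w)) (U (base v)), p w]
        else [p v, p w]
      seq_head := by intro v w h; split_ifs <;> rfl
      seq_last := by intro v w h; split_ifs <;> rfl
      seq_symm := by
        intro v w h
        by_cases hv : v ∈ Set.range f <;> by_cases hw : w ∈ Set.range f <;> simp [hv, hw] }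
  have seq_cycle : ∀ i j h, D.seq (f i) (f j) h =
      [ptOf (U i) (s i * η), bend c (U i) (U j), bend c (U j) (U i), ptOf (U j) (s j * η)] := by
    intro i j h
    simp only [D]
    rw [if_pos ⟨⟨i, rfl⟩, ⟨j, rfl⟩⟩, hbf, hbf, pf, pf]
  have seq_leaf : ∀ v w h, (v ∉ Set.range f ∨ w ∉ Set.range f) → D.seq v w h = [p v, p w] := by
    intro v w h hvw
    simp only [D]
    rw [if_neg (by tauto)]
  have hpair : ∀ v ∉ Set.range f, segment ℝ (p v) (p (f (base v))) ⊆
      {X | horiz X = U (base v)} := by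
    intro v hv X hX
    rw [pl v hv, pf] at hX
    exact horiz_of_mem_segment_vertical hX
  have himg : ∀ v w h,
      (∃ i, s(v, w) = s(f i, f (i + 1)) ∧
        polyImage (D.seq v w h) ⊆ {p v, p w} ∪ openSector (U i) (U (i + 1))) ∨
      (∃ l, l ∉ Set.range f ∧ s(v, w) = s(l, f (base l)) ∧
        polyImage (D.seq v w h) ⊆ {X | horiz X = U (base l)}) := by
    intro v w h
    by_cases hv : v ∈ Set.range f
    · by_cases hw : w ∈ Set.range f
      · obtain ⟨i, rfl⟩ := hv
        obtain ⟨j, rfl⟩ := hw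
        left
        have hsub := polyImage_cycleEdge_subset hc (U i) (U j) (s i * η) (s j * η)
        rw [← seq_cycle i j h, ← pf, ← pf] at hsub
        rcases (hcyc i j).1 h with rfl | rfl
        · exact ⟨i, rfl, hsub⟩
        · rw [openSector_comm] at hsub
          exact ⟨j, Sym2.eq_swap, hsub⟩
      · right
        obtain rfl := (hadj w hw v).1 h.symm
        refine ⟨w, hw, Sym2.eq_swap, ?_⟩
        rw [seq_leaf _ _ h (Or.inr hw), polyImage_pair, segment_symm]
        exact hpair w hw
    · right
      obtain rfl := (hadj v hv w).1 h
      refine ⟨v, hv, rfl, ?_⟩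
      rw [seq_leaf _ _ h (Or.inl hv), polyImage_pair]
      exact hpair v hv
  have hends : ∀ v w h, p v ∈ polyImage (D.seq v w h) ∧ p w ∈ polyImage (D.seq v w h) := by
    intro v w h
    simp only [D]
    split_ifs
    · exact endpoints_mem_polyImage _ _ _ _
    · rw [polyImage_pair]
      exact ⟨left_mem_segment _ _ _, right_mem_segment _ _ _⟩
  have hopen_ray : ∀ {i k X}, X ∈ openSector (U i) (U (i + 1)) → horiz X ≠ U k := by
    rintro i k X ⟨l, m, hl, hm, hX⟩ hk
    rw [hX] at hk
    obtain rfl : i = k := hsector hl hm.le one_pos le_rfl (by simpa using hk)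
    have hi := hunit i
    have hi' := hunit (i + 1)
    have hst := hstep i
    have h0 := congrArg Complex.re hk
    have h1 := congrArg Complex.im hk
    simp only [Complex.add_re, Complex.add_im, Complex.smul_re, Complex.smul_im,
      smul_eq_mul] at h0 h1
    have e1 : l + m * c = 1 := by
      linear_combination (U i).re * h0 + (U i).im * h1 + (1 - l) * hi - m * hst
    have e2 : l * c + m = c := by
      linear_combination (U (i + 1)).re * h0 + (U (i + 1)).im * h1 + (1 - l) * hst - m * hi'
    have : m * (1 - c ^ 2) = 0 := by linear_combination e2 - c * e1
    nlinarith [mul_pos hm (show 0 < 1 - c ^ 2 by nlinarith)]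
  have hopen_open : ∀ {i j X}, X ∈ openSector (U i) (U (i + 1)) →
      X ∈ openSector (U j) (U (j + 1)) → i = j := by
    rintro i j X ⟨l, m, hl, hm, hX⟩ ⟨l', m', hl', hm', hX'⟩
    exact hsector hl hm.le hl' hm'.le (hX.symm.trans hX')
  have hvert : ∀ v w h, polyImage (D.seq v w h) ∩ Set.range D.p = {D.p v, D.p w} := by
    intro v w h
    change _ ∩ Set.range p = {p v, p w}
    apply Set.Subset.antisymm
    · rintro X ⟨hX, x, rfl⟩
      rcases himg v w h with ⟨i, -, hsub⟩ | ⟨l, hl, hvw, hsub⟩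
      · exact (hsub hX).resolve_right fun h => hopen_ray h (hp_horiz x)
      · have hb : base x = base l := hUinj (by rw [← hp_horiz]; exact hsub hX)
        have hx : x = l ∨ x = f (base l) := by
          by_cases hx : x ∈ Set.range f
          · obtain ⟨i, rfl⟩ := hx
            rw [hbf] at hb
            right; rw [hb]
          · left; exact huniq x hx l hl hb
        have hx' : x ∈ s(v, w) := by rw [hvw, Sym2.mem_iff]; exact hx
        rcases Sym2.mem_iff.1 hx' with rfl | rfl <;> simp
    · rintro X (rfl | rfl)
      · exact ⟨(hends v w h).1, v, rfl⟩
      · exact ⟨(hends v w h).2, w, rfl⟩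
  refine ⟨D, ⟨?_, hvert, ?_⟩, ⟨?_, ?_⟩, ?_, ?_, ?_, ?_⟩
  · intro v w h
    by_cases hvw : v ∈ Set.range f ∧ w ∈ Set.range f
    · obtain ⟨⟨i, rfl⟩, ⟨j, rfl⟩⟩ := hvw
      rw [seq_cycle]
      exact simplePolyline_cycleEdge hc hc1 _ _ (hunit i) (hunit j) (hUstep h)
    · rw [seq_leaf v w h (by tauto)]
      refine ⟨by simpa [List.Chain'] using fun e => h.ne (p_inj e), ?_⟩
      intro i j hi hj hij
      simp only [List.length_cons, List.length_nil] at hi hj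
      omega
  · intro v w v' w' h h' hne
    have hrange : polyImage (D.seq v w h) ∩ polyImage (D.seq v' w' h') ⊆ Set.range p := by
      rintro X ⟨hX, hX'⟩
      have ends : ∀ {a b}, X ∈ ({p a, p b} : Set Pt) → X ∈ Set.range p := by
        rintro a b (rfl | rfl)
        exacts [⟨a, rfl⟩, ⟨b, rfl⟩]
      rcases himg v w h with ⟨i, hi, hsub⟩ | ⟨l, hl, hvw, hsub⟩ <;>
        rcases himg v' w' h' with ⟨i', hi', hsub'⟩ | ⟨l', hl', hvw', hsub'⟩
      · rcases hsub hX with h1 | h1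
        · exact ends h1
        rcases hsub' hX' with h2 | h2
        · exact ends h2
        obtain rfl := hopen_open h1 h2
        exact absurd (hi.trans hi'.symm) hne
      · rcases hsub hX with h1 | h1
        · exact ends h1
        exact absurd (hsub' hX') (hopen_ray h1)
      · rcases hsub' hX' with h1 | h1
        · exact ends h1
        exact absurd (hsub hX) (hopen_ray h1)
      · have hb : base l = base l' := hUinj ((hsub hX).symm.trans (hsub' hX'))
        obtain rfl := huniq l hl l' hl' hb
        exact absurd (hvw.trans hvw'.symm) hne
    rw [← Set.inter_eq_left.2 hrange, Set.inter_inter_distrib_right]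
    change (_ ∩ Set.range D.p) ∩ (_ ∩ Set.range D.p) = _
    rw [hvert, hvert, Set.image_inter D.p_inj, Set.image_pair, Set.image_pair]
  · intro v w h a q b hin
    by_cases hvw : v ∈ Set.range f ∧ w ∈ Set.range f
    · obtain ⟨⟨i, rfl⟩, ⟨j, rfl⟩⟩ := hvw
      rw [seq_cycle] at hin
      rcases infix_of_four hin with ⟨rfl, rfl, rfl⟩ | ⟨rfl, rfl, rfl⟩
      · exact two_pi_div_three_le_angle_bend hc hc1 (hunit i) (hunit j) (hUstep h) (hs2 i)
      · rw [angle_comm]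
        exact two_pi_div_three_le_angle_bend hc hc1 (hunit j) (hunit i) (hUstep h.symm) (hs2 j)
    · rw [seq_leaf v w h (by tauto)] at hin
      have := hin.length_le
      simp at this
  · intro v u w hu hw huw a b ha hb
    by_cases hv : v ∈ Set.range f
    · obtain ⟨i, rfl⟩ := hv
      have second_leaf : ∀ x (hx : G.Adj (f i) x) a, x ∉ Set.range f →
          (D.seq (f i) x hx)[1]? = some a → a = ptOf (U i) (s i * (η + 1)) := by
        intro x hx a hxf ha
        have hxi := (hadj x hxf (f i)).1 hx.symm
        rw [seq_leaf _ _ _ (Or.inr hxf), pl x hxf, ← hf hxi] at ha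
        simpa using ha.symm
      have second_cycle : ∀ j (hx : G.Adj (f i) (f j)) a,
          (D.seq (f i) (f j) hx)[1]? = some a → a = bend c (U i) (U j) := by
        intro j hx a ha
        rw [seq_cycle] at ha
        simpa using ha.symm
      change _ ≤ angle (a - p (f i)) (b - p (f i))
      rw [pf]
      by_cases hur : u ∈ Set.range f <;> by_cases hwr : w ∈ Set.range f
      · obtain ⟨j, rfl⟩ := hur
        obtain ⟨k, rfl⟩ := hwr
        rw [second_cycle j hu a ha, second_cycle k hw b hb]
        apply two_pi_div_three_le_angle_opposite hc hc1 (hunit i) (hunit j) (hUstep hu) _ (hs2 i)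
        rcases (hcyc i j).1 hu with hj | hj <;> rcases (hcyc i k).1 hw with hk | hk
        · exact absurd (by rw [hj, hk]) huw
        · subst hk hj
          exact hopp k
        · subst hk hj
          rw [hopp j, sub_sub_cancel]
        · exact absurd (congrArg f (add_right_cancel (hj.symm.trans hk))) huw
      · obtain ⟨j, rfl⟩ := hur
        rw [second_cycle j hu a ha, second_leaf w hw b hwr hb]
        exact two_pi_div_three_le_angle_vertical hc hη0 (hs i) (hunit i) (hunit j) (hUstep hu) hη
      · obtain ⟨k, rfl⟩ := hwr
        rw [second_leaf u hu a hur ha, second_cycle k hw b hb, angle_comm]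
        exact two_pi_div_three_le_angle_vertical hc hη0 (hs i) (hunit i) (hunit k) (hUstep hw) hη
      · have e1 := (hadj u hur (f i)).1 hu.symm
        have e2 := (hadj w hwr (f i)).1 hw.symm
        exact absurd (huniq u hur w hwr (hf (e1.symm.trans e2))) huw
    · exact absurd (((hadj v hv u).1 hu).trans ((hadj v hv w).1 hw).symm) huw
  · intro i j h
    rw [seq_cycle]
    simp
  · intro v hv w h
    rw [seq_leaf v w h (Or.inl hv)]
    rfl
  · intro v hv w h
    obtain rfl := (hadj v hv w).1 h
    change p v 0 = p (f (base v)) 0 ∧ p v 1 = p (f (base v)) 1 ∧ p v 2 = p (f (base v)) 2 + _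
    rw [pf, pl v hv, hσs v hv]
    refine ⟨rfl, rfl, ?_⟩
    simp only [ptOf_two]
    ring
  · intro i j k hij hik hjk
    change ¬ Collinear ℝ ({![p (f i) 0, p (f i) 1], ![p (f j) 0, p (f j) 1],
      ![p (f k) 0, p (f k) 1]} : Set (Fin 2 → ℝ))
    simp only [pf, ptOf_zero, ptOf_one]
    exact not_collinear_of_mem_circle (hunit i) (hunit j) (hunit k)
      (fun h => hij (hUinj h)) (fun h => hik (hUinj h)) (fun h => hjk (hUinj h))
end
end
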